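/- arXiv:1307.5037 — 2 statements merged into one kernel-verified Lean document; each statement's English description precedes it below -/
import Mathlib

section
/- Let K ⊆ ℝ² be a closed, hyperplane diffuse set which is the support of an Ahlfors regular Borel measure. Let (sₙ, tₙ), n ∈ ℕ, be a countable collection of pairs of real numbers with sₙ, tₙ ≥ 0 and sₙ + tₙ = 1, and let (fₙ), n ∈ ℕ, be a countable collection of C¹ diffeomorphisms of ℝ² onto itself. Then the intersection K ∩ ⋂_{n∈ℕ} fₙ(Bad(sₙ,tₙ)) has full Hausdorff dimension in K; that is, dim_H( K ∩ ⋂_{n∈ℕ} fₙ(Bad(sₙ,tₙ)) ) = dim_H(K). -/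
open Metric Filter

/-- Distance from a real number to the nearest integer. -/
noncomputable def distNearestInt (x : ℝ) : ℝ := |x - ((round x : ℤ) : ℝ)|

/-- The set `Bad(s,t) ⊆ ℝ²` of pairs `(x,y)` such that
`inf_{q ∈ ℕ⁺} max (q^s ‖qx‖) (q^t ‖qy‖) > 0`. -/
noncomputable def badPair (s t : ℝ) : Set (ℝ × ℝ) :=
  {p | 0 < ⨅ q : ℕ+, max (((q : ℕ) : ℝ) ^ s * distNearestInt (((q : ℕ) : ℝ) * p.1))
      (((q : ℕ) : ℝ) ^ t * distNearestInt (((q : ℕ) : ℝ) * p.2))}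

/-- An affine line in ℝ²: a nonempty affine subspace whose direction has dimension 1. -/
def IsLine (L : AffineSubspace ℝ (ℝ × ℝ)) : Prop :=
  (L : Set (ℝ × ℝ)).Nonempty ∧ Module.finrank ℝ L.direction = 1

/-- A set `K ⊆ ℝ²` is hyperplane diffuse if there are `β > 0` and `ρ₀ > 0` such that for
every `x ∈ K`, every `0 < ρ ≤ ρ₀` and every affine line `L ⊂ ℝ²` there exists `y ∈ K` with
`y ∈ B(x, ρ)` and `dist(y, L) > β ρ`. -/
def HyperplaneDiffuse (K : Set (ℝ × ℝ)) : Prop :=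
  ∃ β : ℝ, 0 < β ∧ ∃ ρ₀ : ℝ, 0 < ρ₀ ∧ ∀ x ∈ K, ∀ ρ : ℝ, 0 < ρ → ρ ≤ ρ₀ →
    ∀ L : AffineSubspace ℝ (ℝ × ℝ), IsLine L →
      ∃ y ∈ K, y ∈ closedBall x ρ ∧ β * ρ < Metric.infDist y (L : Set (ℝ × ℝ))

section
open MeasureTheory ENNReal NNReal Topology Set

/-- A sequence of nonnegative functions (a potential) whose average over the ball of radius `ρ m`
around an admissible point drops by the factor `θ` from each stage `m ≥ n` to the next,
as long as the potential does not exceed the threshold `τ`. -/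
structure IsContracting {X : Type*} [PseudoMetricSpace X] [MeasurableSpace X] (μ : Measure X)
    (A : ℕ → Set X) (ρ : ℕ → ℝ) (τ θ : ℝ≥0∞) (n : ℕ) (ψ : ℕ → X → ℝ≥0∞) : Prop where
  measurable : ∀ m, Measurable (ψ m)
  lintegral_le : ∀ m, n ≤ m → ∀ x ∈ A m, ψ m x ≤ τ →
    ∫⁻ y in closedBall x (ρ m), ψ (m + 1) y ∂μ ≤ θ * ψ m x * μ (closedBall x (ρ m))

namespace IsContracting

variable {X : Type*} [PseudoMetricSpace X] [MeasurableSpace X] {μ : Measure X}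
  {A : ℕ → Set X} {ρ : ℕ → ℝ} {τ θ : ℝ≥0∞} {n : ℕ}

lemma mono {ψ : ℕ → X → ℝ≥0∞} (h : IsContracting μ A ρ τ θ n ψ) {m : ℕ} (hnm : n ≤ m) :
    IsContracting μ A ρ τ θ m ψ :=
  ⟨h.measurable, fun k hk => h.lintegral_le k (hnm.trans hk)⟩

lemma tsum {ι : Type*} [Countable ι] {ψ : ι → ℕ → X → ℝ≥0∞}
    (h : ∀ i, IsContracting μ A ρ τ θ n (ψ i)) :
    IsContracting μ A ρ τ θ n (fun m x => ∑' i, ψ i m x) := by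
  refine ⟨fun m => Measurable.tsum fun i => (h i).measurable m, fun m hm x hx hτ => ?_⟩
  rw [lintegral_tsum fun i => ((h i).measurable _).aemeasurable, ← ENNReal.tsum_mul_left,
    ← ENNReal.tsum_mul_right]
  exact ENNReal.tsum_le_tsum fun i =>
    (h i).lintegral_le m hm x hx ((ENNReal.le_tsum i).trans hτ)

lemma add {ψ φ : ℕ → X → ℝ≥0∞} (hψ : IsContracting μ A ρ τ θ n ψ)
    (hφ : IsContracting μ A ρ τ θ n φ) :
    IsContracting μ A ρ τ θ n (fun m x => ψ m x + φ m x) := by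
  refine ⟨fun m => (hψ.measurable m).add (hφ.measurable m), fun m hm x hx hτ => ?_⟩
  rw [lintegral_add_left (hψ.measurable _), mul_add, add_mul]
  exact add_le_add (hψ.lintegral_le m hm x hx (le_self_add.trans hτ))
    (hφ.lintegral_le m hm x hx (le_add_self.trans hτ))

lemma exists_next [OpensMeasurableSpace X] {ψ : ℕ → X → ℝ≥0∞} (h : IsContracting μ A ρ τ θ n ψ)
    (hpos : ∀ m, ∀ x ∈ A m, μ (closedBall x (ρ m)) ≠ 0)
    (htop : ∀ m, ∀ x ∈ A m, μ (closedBall x (ρ m)) ≠ ⊤)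
    (hA : ∀ m, ∀ x ∈ A m, ∀ᵐ y ∂μ, y ∈ closedBall x (ρ m) → y ∈ A (m + 1))
    {x : X} (hx : x ∈ A n) (hτ : ψ n x ≤ τ) :
    ∃ y ∈ A (n + 1), dist y x ≤ ρ n ∧ ψ (n + 1) y ≤ θ * τ := by
  have h1 := measure_le_setLAverage_pos (μ := μ) (hpos n x hx) (htop n x hx)
    (h.measurable (n + 1)).aemeasurable
  obtain ⟨y, ⟨hy1, hy2⟩, hy3⟩ := ((frequently_ae_iff.2 h1.ne').and_eventually (hA n x hx)).exists
  refine ⟨y, hy3 hy1, hy1, hy2.trans ?_⟩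
  rw [setLAverage_eq]
  refine (ENNReal.div_le_of_le_mul (h.lintegral_le n le_rfl x hx hτ)).trans ?_
  gcongr

/-- The greedy strategy: if new contracting potentials of initial size at most `(1 - θ) τ` appear
at each stage, depending on the current position, then some path of admissible points
keeps all of them below the threshold `τ` forever. -/
theorem exists_path [OpensMeasurableSpace X]
    (hpos : ∀ m, ∀ x ∈ A m, μ (closedBall x (ρ m)) ≠ 0)
    (htop : ∀ m, ∀ x ∈ A m, μ (closedBall x (ρ m)) ≠ ⊤)
    (hA : ∀ m, ∀ x ∈ A m, ∀ᵐ y ∂μ, y ∈ closedBall x (ρ m) → y ∈ A (m + 1))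
    (hθ : θ ≤ 1)
    (φ : ℕ → X → ℕ → X → ℝ≥0∞) (hφ : ∀ m, ∀ x ∈ A m, IsContracting μ A ρ τ θ m (φ m x))
    (hsmall : ∀ m, ∀ x ∈ A m, φ m x m x ≤ (1 - θ) * τ) {x₀ : X} (hx₀ : x₀ ∈ A 0) :
    ∃ x : ℕ → X, (∀ n, x n ∈ A n) ∧ (∀ n, dist (x (n + 1)) (x n) ≤ ρ n) ∧
      ∀ m n, m ≤ n → φ m (x m) n (x n) ≤ τ := by
  let S (n : ℕ) := {p : X × (ℕ → X → ℝ≥0∞) //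
    p.1 ∈ A n ∧ IsContracting μ A ρ τ θ n p.2 ∧ p.2 n p.1 ≤ τ}
  have key : ∀ n, ∀ p : S n, ∃ q : S (n + 1), dist q.1.1 p.1.1 ≤ ρ n ∧
      ∀ m x, q.1.2 m x = p.1.2 m x + φ (n + 1) q.1.1 m x := by
    rintro n ⟨⟨x, ψ⟩, hx, hψ, hτ⟩
    obtain ⟨y, hy, hxy, hyτ⟩ := hψ.exists_next hpos htop hA hx hτ
    refine ⟨⟨⟨y, fun m x => ψ m x + φ (n + 1) y m x⟩, hy,
      (hψ.mono n.le_succ).add (hφ _ y hy), ?_⟩, hxy, fun _ _ => rfl⟩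
    calc ψ (n + 1) y + φ (n + 1) y (n + 1) y ≤ θ * τ + (1 - θ) * τ :=
          add_le_add hyτ (hsmall _ y hy)
      _ = τ := by rw [← add_mul, add_tsub_cancel_of_le hθ, one_mul]
  choose next hnext1 hnext2 using key
  have h0 : φ 0 x₀ 0 x₀ ≤ τ := (hsmall 0 x₀ hx₀).trans
    (by simpa using mul_le_mul_left (tsub_le_self : 1 - θ ≤ 1) τ)
  let seq : ∀ n, S n := fun n => Nat.rec ⟨⟨x₀, φ 0 x₀⟩, hx₀, hφ 0 x₀ hx₀, h0⟩ next n
  have hseq : ∀ n, seq (n + 1) = next n (seq n) := fun _ => rfl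
  have hle : ∀ m n, m ≤ n → ∀ k x, φ m (seq m).1.1 k x ≤ (seq n).1.2 k x := by
    intro m n hmn
    induction n, hmn using Nat.le_induction with
    | base =>
      intro k x
      cases m with
      | zero => exact le_rfl
      | succ m => rw [hseq, hnext2]; exact le_add_self
    | succ n _ ih =>
      intro k x
      rw [hseq n, hnext2]
      exact (ih k x).trans le_self_add
  exact ⟨fun n => (seq n).1.1, fun n => (seq n).2.1, fun n => hnext1 n (seq n),
    fun m n hmn => (hle m n hmn n _).trans (seq n).2.2.2⟩

end IsContracting
end

section
open MeasureTheory ENNReal NNReal Topology Set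

/-- The potential of an obstacle `Z` of thickness `δ`: it equals `(δ / ρ m) ^ e` at the points whose
distance to `Z` is at most `3 * ρ m`, and vanishes elsewhere. -/
noncomputable def obstaclePotential {X : Type*} [PseudoEMetricSpace X] (ρ : ℕ → ℝ) (e : ℝ)
    (Z : Set X) (δ : ℝ) (m : ℕ) : X → ℝ≥0∞ :=
  {y | infEDist y Z ≤ ENNReal.ofReal (3 * ρ m)}.indicator
    fun _ => ENNReal.ofReal ((δ / ρ m) ^ e)

lemma obstaclePotential_le {X : Type*} [PseudoEMetricSpace X] (ρ : ℕ → ℝ) (e : ℝ)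
    (Z : Set X) (δ : ℝ) (m : ℕ) (x : X) :
    obstaclePotential ρ e Z δ m x ≤ ENNReal.ofReal ((δ / ρ m) ^ e) :=
  indicator_le_self _ _ x

lemma obstaclePotential_isContracting {X : Type*} [PseudoMetricSpace X] [MeasurableSpace X]
    [OpensMeasurableSpace X] {μ : Measure X} {A : ℕ → Set X} {ρ : ℕ → ℝ} {τ θ κ : ℝ≥0∞} {n : ℕ}
    {β e δ : ℝ} {Z : Set X} (hβ : 0 < β) (hβ' : 3 * β ≤ 2) (hρ0 : ∀ m, 0 < ρ m)
    (hρ : ∀ m, ρ (m + 1) = β * ρ m) (hδ : 0 < δ) (hκ : κ * ENNReal.ofReal (β ^ (-e)) ≤ θ)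
    (h : ∀ m, n ≤ m → ∀ x ∈ A m, ENNReal.ofReal ((δ / ρ m) ^ e) ≤ τ →
      μ {y ∈ closedBall x (ρ m) | infEDist y Z ≤ ENNReal.ofReal (3 * (β * ρ m))} ≤
        κ * μ (closedBall x (ρ m))) :
    IsContracting μ A ρ τ θ n (obstaclePotential ρ e Z δ) := by
  have hmeas : ∀ r : ℝ≥0∞, MeasurableSet {y : X | infEDist y Z ≤ r} := fun r =>
    (isClosed_le continuous_infEDist continuous_const).measurableSet
  refine ⟨fun m => measurable_const.indicator (hmeas _), fun m hm x hx hτ => ?_⟩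
  by_cases hxZ : infEDist x Z ≤ ENNReal.ofReal (3 * ρ m)
  · have hψ : obstaclePotential ρ e Z δ m x = ENNReal.ofReal ((δ / ρ m) ^ e) :=
      indicator_of_mem (s := {y | infEDist y Z ≤ ENNReal.ofReal (3 * ρ m)}) hxZ _
    rw [hψ] at hτ ⊢
    have hpow : (δ / ρ (m + 1)) ^ e = β ^ (-e) * (δ / ρ m) ^ e := by
      rw [hρ, Real.rpow_neg hβ.le, ← Real.inv_rpow hβ.le, ← Real.mul_rpow (by positivity)
        (div_pos hδ (hρ0 m)).le]
      congr 1
      field_simp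
    unfold obstaclePotential
    rw [lintegral_indicator_const (hmeas _), Measure.restrict_apply (hmeas _), hpow,
      ENNReal.ofReal_mul (by positivity), inter_comm, hρ]
    calc ENNReal.ofReal (β ^ (-e)) * ENNReal.ofReal ((δ / ρ m) ^ e) *
          μ (closedBall x (ρ m) ∩ {y | infEDist y Z ≤ ENNReal.ofReal (3 * (β * ρ m))})
        ≤ ENNReal.ofReal (β ^ (-e)) * ENNReal.ofReal ((δ / ρ m) ^ e) *
          (κ * μ (closedBall x (ρ m))) := by gcongr; exact h m hm x hx hτ
      _ = (κ * ENNReal.ofReal (β ^ (-e))) * ENNReal.ofReal ((δ / ρ m) ^ e) *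
          μ (closedBall x (ρ m)) := by ring
      _ ≤ _ := by gcongr
  · have : ∫⁻ y in closedBall x (ρ m), obstaclePotential ρ e Z δ (m + 1) y ∂μ = 0 := by
      refine setLIntegral_eq_zero measurableSet_closedBall fun y hy => ?_
      refine indicator_of_notMem (fun hyZ => hxZ ?_) _
      have hxy : edist x y ≤ ENNReal.ofReal (ρ m) := by
        rw [edist_comm, edist_dist]
        exact ENNReal.ofReal_le_ofReal hy
      refine (infEDist_le_infEDist_add_edist.trans (add_le_add hyZ hxy)).trans ?_
      rw [← ENNReal.ofReal_add (by linarith [hρ0 (m + 1)]) (hρ0 m).le, hρ]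
      exact ENNReal.ofReal_le_ofReal (by nlinarith [hρ0 m])
    rw [this]
    exact bot_le

end

section
open MeasureTheory ENNReal NNReal Topology Set

lemma exists_dist_lt_of_infEDist_le {X : Type*} [PseudoMetricSpace X] {Z : Set X} {y : X} {a b : ℝ}
    (h : infEDist y Z ≤ ENNReal.ofReal a) (hab : a < b) (hb : 0 < b) : ∃ z ∈ Z, dist y z < b := by
  obtain ⟨z, hz, hyz⟩ := infEDist_lt_iff.1 (h.trans_lt ((ENNReal.ofReal_lt_ofReal_iff hb).2 hab))
  exact ⟨z, hz, by rwa [edist_dist, ENNReal.ofReal_lt_ofReal_iff hb] at hyz⟩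

/-- `μ` is Ahlfors regular of exponent `α` on `K` at scales up to `r₀`, with constant `C`. -/
def AhlforsRegularOn {X : Type*} [PseudoMetricSpace X] [MeasurableSpace X] (μ : Measure X)
    (K : Set X) (α C r₀ : ℝ) : Prop :=
  ∀ x ∈ K, ∀ r : ℝ, 0 < r → r ≤ r₀ → ENNReal.ofReal (C⁻¹ * r ^ α) ≤ μ (closedBall x r) ∧
    μ (closedBall x r) ≤ ENNReal.ofReal (C * r ^ α)

namespace AhlforsRegularOn

variable {X : Type*} [PseudoMetricSpace X] [MeasurableSpace X] {μ : Measure X} {K : Set X}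
  {α C r₀ : ℝ}

lemma measure_closedBall_ne_top (h : AhlforsRegularOn μ K α C r₀) {x : X} (hx : x ∈ K) {r : ℝ}
    (hr : 0 < r) (hr₀ : r ≤ r₀) : μ (closedBall x r) ≠ ⊤ :=
  ((h x hx r hr hr₀).2.trans_lt ENNReal.ofReal_lt_top).ne

lemma measure_closedBall_ne_zero (h : AhlforsRegularOn μ K α C r₀) (hC : 1 ≤ C) {x : X}
    (hx : x ∈ K) {r : ℝ} (hr : 0 < r) (hr₀ : r ≤ r₀) : μ (closedBall x r) ≠ 0 := by
  refine ((ENNReal.ofReal_pos.2 ?_).trans_le (h x hx r hr hr₀).1).ne'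
  positivity

/-- Comparison of the measures of two balls of comparable radii. -/
lemma measure_closedBall_le (h : AhlforsRegularOn μ K α C r₀) (hC : 1 ≤ C) {x y : X}
    (hx : x ∈ K) (hy : y ∈ K) {r l : ℝ} (hr : 0 < r) (hl : 0 < l) (hr₀ : r ≤ r₀)
    (hlr : l * r ≤ r₀) :
    μ (closedBall y (l * r)) ≤ ENNReal.ofReal (C ^ 2 * l ^ α) * μ (closedBall x r) := by
  calc μ (closedBall y (l * r)) ≤ ENNReal.ofReal (C * (l * r) ^ α) :=
        (h y hy _ (by positivity) hlr).2
    _ = ENNReal.ofReal (C ^ 2 * l ^ α) * ENNReal.ofReal (C⁻¹ * r ^ α) := by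
        rw [← ENNReal.ofReal_mul (by positivity), Real.mul_rpow hl.le hr.le]
        congr 1
        field_simp
    _ ≤ _ := by gcongr; exact (h x hx r hr hr₀).1

lemma le_measure_closedBall (h : AhlforsRegularOn μ K α C r₀) (hC : 1 ≤ C) {x y : X}
    (hx : x ∈ K) (hy : y ∈ K) {r l : ℝ} (hr : 0 < r) (hl : 0 < l) (hr₀ : r ≤ r₀)
    (hlr : l * r ≤ r₀) :
    ENNReal.ofReal ((C ^ 2)⁻¹ * l ^ α) * μ (closedBall x r) ≤ μ (closedBall y (l * r)) := by
  calc ENNReal.ofReal ((C ^ 2)⁻¹ * l ^ α) * μ (closedBall x r)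
      ≤ ENNReal.ofReal ((C ^ 2)⁻¹ * l ^ α) * ENNReal.ofReal (C * r ^ α) := by
        gcongr; exact (h x hx r hr hr₀).2
    _ = ENNReal.ofReal (C⁻¹ * (l * r) ^ α) := by
        rw [← ENNReal.ofReal_mul (by positivity), Real.mul_rpow hl.le hr.le]
        congr 1
        field_simp
    _ ≤ _ := (h y hy _ (by positivity) hlr).1

/-- A set of small diameter has a neighborhood of small measure. -/
lemma measure_near_small_le (h : AhlforsRegularOn μ K α C r₀) (hC : 1 ≤ C) (hK : μ Kᶜ = 0)
    {x : X} (hx : x ∈ K) {r β : ℝ} (hr : 0 < r) (hr₀ : r ≤ r₀) (hβ : 0 < β) (hβ' : 9 * β ≤ 1)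
    {U : Set X} (hU : ∀ u ∈ U, ∀ v ∈ U, dist u v ≤ β * r) :
    μ {y ∈ closedBall x r | infEDist y U ≤ ENNReal.ofReal (3 * (β * r))} ≤
      ENNReal.ofReal (C ^ 2 * (9 * β) ^ α) * μ (closedBall x r) := by
  set S := {y ∈ closedBall x r | infEDist y U ≤ ENNReal.ofReal (3 * (β * r))} with hS
  have hβr : 0 < β * r := by positivity
  have hSK : μ S ≤ μ (S ∩ K) := by
    calc μ S ≤ μ (S ∩ K ∪ Kᶜ) := measure_mono fun y hy => by
          by_cases hyK : y ∈ K
          exacts [Or.inl ⟨hy, hyK⟩, Or.inr hyK]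
      _ ≤ μ (S ∩ K) + μ Kᶜ := measure_union_le _ _
      _ = _ := by rw [hK, add_zero]
  rcases (S ∩ K).eq_empty_or_nonempty with he | ⟨y, hyS, hyK⟩
  · rw [he, measure_empty] at hSK
    exact hSK.trans bot_le
  · refine hSK.trans ((measure_mono (t := closedBall y (9 * β * r)) fun w hw => ?_).trans
      (h.measure_closedBall_le hC hx hyK hr (by positivity) hr₀ (by nlinarith)))
    obtain ⟨u, hu, hyu⟩ := exists_dist_lt_of_infEDist_le hyS.2
      (show 3 * (β * r) < 4 * (β * r) by linarith) (by linarith)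
    obtain ⟨v, hv, hwv⟩ := exists_dist_lt_of_infEDist_le hw.1.2
      (show 3 * (β * r) < 4 * (β * r) by linarith) (by linarith)
    have := dist_triangle4 w v u y
    rw [dist_comm u y] at this
    rw [mem_closedBall]
    linarith [hU v hv u hu]

end AhlforsRegularOn

/-- In a regular hyperplane diffuse set, neighborhoods of lines do not fill up balls. -/
lemma measure_near_line_le {μ : Measure (ℝ × ℝ)} {K : Set (ℝ × ℝ)} {α C r₀ β₀ : ℝ}
    (h : AhlforsRegularOn μ K α C r₀) (hC : 1 ≤ C) (hβ₀ : 0 < β₀) (hβ₀' : β₀ ≤ 1)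
    (hdiff : ∀ x ∈ K, ∀ ρ : ℝ, 0 < ρ → ρ ≤ r₀ → ∀ L : AffineSubspace ℝ (ℝ × ℝ), IsLine L →
      ∃ y ∈ K, y ∈ closedBall x ρ ∧ β₀ * ρ < Metric.infDist y (L : Set (ℝ × ℝ)))
    {x : ℝ × ℝ} (hx : x ∈ K) {r β : ℝ} (hr : 0 < r) (hr₀ : r ≤ r₀) (hβ : 0 < β)
    (hβ' : 20 * β ≤ β₀) {Z : Set (ℝ × ℝ)} {L : AffineSubspace ℝ (ℝ × ℝ)} (hL : IsLine L)
    (hZ : ∀ z ∈ Z, z ∈ closedBall x (2 * r) → infDist z (L : Set (ℝ × ℝ)) ≤ β * r) :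
    μ {y ∈ closedBall x r | infEDist y Z ≤ ENNReal.ofReal (3 * (β * r))} ≤
      (1 - ENNReal.ofReal ((C ^ 2)⁻¹ * (β₀ / 4) ^ α)) * μ (closedBall x r) := by
  obtain ⟨y₀, hy₀K, hy₀, hy₀L⟩ := hdiff x hx (r / 2) (by positivity) (by linarith) L hL
  have hβr : 0 < β * r := by positivity
  have hball : closedBall y₀ (β₀ / 4 * r) ⊆ closedBall x r :=
    closedBall_subset_closedBall' (by rw [mem_closedBall] at hy₀; nlinarith)
  have hsub : {y ∈ closedBall x r | infEDist y Z ≤ ENNReal.ofReal (3 * (β * r))} ⊆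
      closedBall x r \ closedBall y₀ (β₀ / 4 * r) := by
    rintro y ⟨hy, hyZ⟩
    refine ⟨hy, fun hy' => ?_⟩
    obtain ⟨z, hz, hyz⟩ := exists_dist_lt_of_infEDist_le hyZ
      (show 3 * (β * r) < 4 * (β * r) by linarith) (by linarith)
    rw [mem_closedBall] at hy hy'
    have h1 := hZ z hz (by
      rw [mem_closedBall]
      have := dist_triangle_left z x y
      nlinarith)
    have h2 := infDist_le_infDist_add_dist (s := (L : Set (ℝ × ℝ))) (x := y₀) (y := z)
    have h3 := dist_triangle_left y₀ z y
    nlinarith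
  refine (measure_mono hsub).trans ?_
  have htop := measure_ne_top_of_subset hball (h.measure_closedBall_ne_top hx hr hr₀)
  rw [measure_sdiff hball measurableSet_closedBall.nullMeasurableSet htop,
    ENNReal.sub_mul fun _ _ => h.measure_closedBall_ne_top hx hr hr₀, one_mul]
  exact tsub_le_tsub_left (h.le_measure_closedBall hC hx hy₀K hr (by positivity) hr₀
    (by nlinarith)) _

end

section
open MeasureTheory ENNReal NNReal Topology Set

/-- An Ahlfors regular set has Hausdorff dimension at most its exponent. -/
lemma AhlforsRegularOn.dimH_le {X : Type*} [MetricSpace X] [ProperSpace X] [MeasurableSpace X]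
    [BorelSpace X] {μ : Measure X} {K : Set X} {α C r₀ : ℝ} (h : AhlforsRegularOn μ K α C r₀)
    (hα : 0 ≤ α) (hC : 1 ≤ C) (hr₀ : 0 < r₀) (hKcl : IsClosed K) (hK : μ Kᶜ = 0) :
    dimH K ≤ ENNReal.ofReal α := by
  rcases K.eq_empty_or_nonempty with rfl | ⟨o, -⟩
  · simp
  have hcov : K ⊆ ⋃ N : ℕ, K ∩ closedBall o N := fun x hx => by
    obtain ⟨N, hN⟩ := exists_nat_ge (dist x o)
    exact mem_iUnion.2 ⟨N, hx, hN⟩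
  refine (dimH_mono hcov).trans ?_
  rw [dimH_iUnion]
  refine iSup_le fun N => ?_
  refine dimH_le_of_hausdorffMeasure_ne_top (d := α.toNNReal) ?_
  rw [Real.coe_toNNReal α hα]
  set B := closedBall o ((N : ℝ) + 1)
  have hB : μ B ≠ ⊤ := by
    have hBc : IsCompact (K ∩ B) := (isCompact_closedBall _ _).inter_left hKcl
    have h1 : μ (K ∩ B) < ⊤ := hBc.measure_lt_top_of_nhdsWithin fun x hx =>
      ⟨closedBall x r₀, mem_nhdsWithin_of_mem_nhds (closedBall_mem_nhds _ hr₀),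
        (h.measure_closedBall_ne_top hx.1 hr₀ le_rfl).lt_top⟩
    refine ((measure_mono (t := K ∩ B ∪ Kᶜ) fun y hy => ?_).trans_lt
      ((measure_union_le _ _).trans_lt (by rw [hK, add_zero]; exact h1))).ne
    by_cases hyK : y ∈ K
    exacts [Or.inl ⟨hyK, hy⟩, Or.inr hyK]
  let r : ℕ → ℝ := fun n => min r₀ 1 / (n + 1)
  have hr : ∀ n, 0 < r n := fun n => by positivity
  have hr1 : ∀ n, r n ≤ min r₀ 1 := fun n =>
    div_le_self (by positivity) (by linarith [(Nat.cast_nonneg n : (0 : ℝ) ≤ n)])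
  have hsub : ∀ n, ∀ x ∈ K ∩ closedBall o N, closedBall x (r n) ⊆ B := fun n x hx =>
    closedBall_subset_closedBall' (by
      have := hx.2
      rw [mem_closedBall] at this
      linarith [hr1 n, min_le_right r₀ 1])
  choose u huK hudisj hucov using fun n =>
    Vitali.exists_disjoint_subfamily_covering_enlargement_closedBall (K ∩ closedBall o N) id
      (fun _ => r n) (r n) (fun _ _ => le_rfl) 5 (by norm_num)
  have hcount : ∀ n, (u n).Countable := fun n =>
    (hudisj n).countable_of_nonempty_interior fun x _ =>
      ⟨x, mem_interior_iff_mem_nhds.2 (closedBall_mem_nhds _ (hr n))⟩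
  have := fun n => (hcount n).to_subtype
  have hdiam : ∀ n (x : X), ediam (closedBall x (5 * r n)) ≤ ENNReal.ofReal (10 * r n) := by
    intro n x
    refine Metric.ediam_le_of_forall_dist_le fun y hy z hz => ?_
    rw [mem_closedBall] at hy hz
    linarith [dist_triangle_right y z x]
  have hlim : Tendsto (fun n => ENNReal.ofReal (10 * r n)) atTop (𝓝 0) := by
    rw [← ENNReal.ofReal_zero]
    refine ENNReal.tendsto_ofReal ?_
    simpa using (tendsto_const_div_atTop_nhds_zero_nat (min r₀ 1)).comp
      (tendsto_add_atTop_nat 1) |>.const_mul 10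
  have hfin : ENNReal.ofReal (10 ^ α * C) * μ B ≠ ⊤ := ENNReal.mul_ne_top ENNReal.ofReal_ne_top hB
  refine ne_top_of_le_ne_top hfin ?_
  refine (Measure.hausdorffMeasure_le_liminf_tsum α (K ∩ closedBall o N) (l := atTop) _ hlim
    (fun n (i : u n) => closedBall (i : X) (5 * r n)) (Eventually.of_forall fun n i => hdiam n i)
    (Eventually.of_forall fun n x hx => ?_)).trans ?_
  · obtain ⟨b, hb, hxb⟩ := hucov n x hx
    exact mem_iUnion.2 ⟨⟨b, hb⟩, hxb (mem_closedBall_self (hr n).le)⟩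
  · refine (liminf_le_liminf (v := fun _ => ENNReal.ofReal (10 ^ α * C) * μ B)
      (Eventually.of_forall fun n => ?_)).trans (by simp)
    calc ∑' i : u n, ediam (closedBall (i : X) (5 * r n)) ^ α
        ≤ ∑' i : u n, ENNReal.ofReal (10 ^ α * C) * μ (closedBall (i : X) (r n)) := by
          refine ENNReal.tsum_le_tsum fun i => ?_
          calc ediam (closedBall (i : X) (5 * r n)) ^ α ≤ ENNReal.ofReal (10 * r n) ^ α := by
                gcongr; exact hdiam n i
            _ = ENNReal.ofReal (10 ^ α * C) * ENNReal.ofReal (C⁻¹ * r n ^ α) := by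
                rw [ENNReal.ofReal_rpow_of_pos (by linarith [hr n]),
                  ← ENNReal.ofReal_mul (by positivity),
                  Real.mul_rpow (by norm_num) (hr n).le]
                congr 1
                field_simp
            _ ≤ _ := by
                gcongr
                exact (h i (huK n i.2).1 _ (hr n) ((hr1 n).trans (min_le_left _ _))).1
      _ = ENNReal.ofReal (10 ^ α * C) * ∑' i : u n, μ (closedBall (i : X) (r n)) :=
          ENNReal.tsum_mul_left
      _ ≤ ENNReal.ofReal (10 ^ α * C) * μ B := by
          gcongr
          refine (tsum_meas_le_meas_iUnion_of_disjoint μ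
            (fun i => measurableSet_closedBall) fun i j hij => ?_).trans
            (measure_mono (iUnion_subset fun i => hsub n i (huK n i.2)))
          exact hudisj n i.2 j.2 fun hc => hij (Subtype.ext hc)

/-- The complement of the support of a measure is null. -/
lemma measure_compl_eq_zero_of_forall_ball {X : Type*} [PseudoMetricSpace X]
    [SecondCountableTopology X] [MeasurableSpace X] {μ : Measure X} {K : Set X}
    (hsupp : ∀ x, (∀ ρ : ℝ, 0 < ρ → 0 < μ (ball x ρ)) → x ∈ K) : μ Kᶜ = 0 := by
  refine measure_null_of_locally_null _ fun x hx => ?_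
  have : ¬ ∀ ρ : ℝ, 0 < ρ → 0 < μ (ball x ρ) := fun hc => hx (hsupp x hc)
  push Not at this
  obtain ⟨ρ, hρ, h0⟩ := this
  exact ⟨ball x ρ, mem_nhdsWithin_of_mem_nhds (ball_mem_nhds _ hρ), le_bot_iff.1 h0⟩

end

section
open Set

/-- Every rational point with denominator `q` lies on a line with integer coefficients
`A`, `B`, `C` such that `|A| ≤ q ^ s` and `|B| ≤ q ^ t`. -/
lemma exists_line_through_ratPoint {s t : ℝ} (hst : s + t = 1) {q : ℕ}
    (hq : 0 < q) (p r : ℤ) : ∃ A B C : ℤ, ¬ (A = 0 ∧ B = 0) ∧ A * p + B * r + C * q = 0 ∧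
      |(A : ℝ)| ≤ (q : ℝ) ^ s ∧ |(B : ℝ)| ≤ (q : ℝ) ^ t := by
  have : NeZero q := ⟨hq.ne'⟩
  have hq' : (0 : ℝ) < q := by exact_mod_cast hq
  set a := ⌊(q : ℝ) ^ s⌋₊
  set b := ⌊(q : ℝ) ^ t⌋₊
  have hcard : (Finset.univ : Finset (ZMod q)).card <
      (Finset.range (a + 1) ×ˢ Finset.range (b + 1)).card := by
    rw [Finset.card_product, Finset.card_range, Finset.card_range, Finset.card_univ, ZMod.card]
    have h1 : (q : ℝ) = (q : ℝ) ^ s * (q : ℝ) ^ t := by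
      rw [← Real.rpow_add hq', hst, Real.rpow_one]
    have h2 : (q : ℝ) < ((a + 1 : ℕ) : ℝ) * ((b + 1 : ℕ) : ℝ) := by
      rw [h1]
      push_cast
      exact mul_lt_mul'' (Nat.lt_floor_add_one _) (Nat.lt_floor_add_one _) (by positivity)
        (by positivity)
    exact_mod_cast h2
  obtain ⟨x, hx, y, hy, hxy, hf⟩ := Finset.exists_ne_map_eq_of_card_lt_of_maps_to hcard
    (f := fun x : ℕ × ℕ => ((x.1 * p + x.2 * r : ℤ) : ZMod q)) (fun _ _ => Finset.mem_univ _)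
  rw [Finset.mem_product, Finset.mem_range, Finset.mem_range] at hx hy
  obtain ⟨C, hC⟩ := (ZMod.intCast_eq_intCast_iff_dvd_sub _ _ q).1 hf
  have key : ∀ (m n k : ℕ) (z : ℝ), 0 ≤ z → k = ⌊z⌋₊ → m < k + 1 → n < k + 1 →
      |(((m : ℤ) - (n : ℤ) : ℤ) : ℝ)| ≤ z := by
    intro m n k z hz hk hm hn
    have hkz : (k : ℝ) ≤ z := hk ▸ Nat.floor_le hz
    have hm' : (m : ℝ) ≤ k := by exact_mod_cast Nat.lt_succ_iff.1 hm
    have hn' : (n : ℝ) ≤ k := by exact_mod_cast Nat.lt_succ_iff.1 hn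
    push_cast
    rw [abs_le]
    constructor <;> linarith [(Nat.cast_nonneg m : (0 : ℝ) ≤ m), (Nat.cast_nonneg n : (0 : ℝ) ≤ n)]
  refine ⟨(x.1 : ℤ) - y.1, (x.2 : ℤ) - y.2, C, fun h => hxy (Prod.ext (by omega) (by omega)), ?_,
    key _ _ a _ (by positivity) rfl hx.1 hy.1, key _ _ b _ (by positivity) rfl hx.2 hy.2⟩
  linear_combination -hC

/-- The point `w` belongs to the `(s,t)`-weighted box of size `c` around `(p / q, r / q)`. -/
def InBox (c s t : ℝ) (q : ℕ) (p r : ℤ) (w : ℝ × ℝ) : Prop :=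
  |q * w.1 - p| * (q : ℝ) ^ s ≤ c ∧ |q * w.2 - r| * (q : ℝ) ^ t ≤ c

/-- A rational point `(p / q, r / q)` together with a line `A x + B y + C = 0` through it whose
coefficients are bounded by `q ^ s` and by `q ^ t / 256 ^ k`, the latter bound being sharp up to a
constant. -/
structure IsLineOfClass (s t : ℝ) (k q : ℕ) (p r A B C : ℤ) : Prop where
  pos : 0 < q
  mem : A * p + B * r + C * q = 0
  abs_le : |(A : ℝ)| ≤ (q : ℝ) ^ s
  max_le : max |(A : ℝ)| |(B : ℝ)| ≤ (q : ℝ) ^ t / 256 ^ k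
  lt_max : (q : ℝ) ^ t / 256 ^ (k + 1) < max |(A : ℝ)| |(B : ℝ)|

lemma exists_isLineOfClass {s t : ℝ} (hst : s ≤ t) (hst1 : s + t = 1) {q : ℕ}
    (hq : 0 < q) (p r : ℤ) : ∃ k : ℕ, ∃ A B C : ℤ, IsLineOfClass s t k q p r A B C := by
  obtain ⟨A, B, C, hAB, hmem, hA, hB⟩ :=
    exists_line_through_ratPoint hst1 hq p r
  have hq1 : (1 : ℝ) ≤ q := by exact_mod_cast hq
  have hM1 : (1 : ℝ) ≤ max |(A : ℝ)| |(B : ℝ)| := by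
    by_cases hA0 : A = 0
    · exact le_max_of_le_right (by exact_mod_cast Int.one_le_abs fun h => hAB ⟨hA0, h⟩)
    · exact le_max_of_le_left (by exact_mod_cast Int.one_le_abs hA0)
  have hMt : max |(A : ℝ)| |(B : ℝ)| ≤ (q : ℝ) ^ t :=
    max_le (hA.trans (Real.rpow_le_rpow_of_exponent_le hq1 hst)) hB
  obtain ⟨k, hk1, hk2⟩ := exists_nat_pow_near (y := (256 : ℝ)) ((one_le_div (by positivity)).2 hMt)
    (by norm_num)
  refine ⟨k, A, B, C, hq, hmem, hA, ?_, ?_⟩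
  · rw [le_div_iff₀ (by positivity)] at hk1 ⊢
    linarith
  · rw [div_lt_iff₀ (by positivity)] at hk2 ⊢
    linarith

lemma abs_linear_le (a b x y : ℝ) : |a * x + b * y| ≤ |a| * |x| + |b| * |y| := by
  rw [← abs_mul, ← abs_mul]
  exact abs_add_le _ _

lemma Int.eq_zero_of_abs_cast_lt_one {n : ℤ} (h : |(n : ℝ)| < 1) : n = 0 :=
  Int.abs_lt_one_iff.1 (by exact_mod_cast h)

lemma rpow_le_mul_rpow {x y R s : ℝ} (hx : 0 ≤ x) (hy : 0 ≤ y) (hR : 1 ≤ R) (hs : 0 ≤ s)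
    (hs1 : s ≤ 1) (hxy : x ≤ R * y) : x ^ s ≤ R * y ^ s := by
  calc x ^ s ≤ (R * y) ^ s := Real.rpow_le_rpow hx hxy hs
    _ = R ^ s * y ^ s := Real.mul_rpow (by linarith) hy
    _ ≤ R * y ^ s := by
      gcongr
      simpa using Real.rpow_le_rpow_of_exponent_le hR hs1

end

section
open Set

namespace IsLineOfClass

variable {s t c R : ℝ} {k q q' : ℕ} {p r p' r' A B C A' B' C' : ℤ} {w : ℝ × ℝ}

lemma abs_le_div (h : IsLineOfClass s t k q p r A B C) : |(B : ℝ)| ≤ (q : ℝ) ^ t / 256 ^ k :=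
  (le_max_right _ _).trans h.max_le

lemma abs_le_rpow (h : IsLineOfClass s t k q p r A B C) : |(B : ℝ)| ≤ (q : ℝ) ^ t :=
  h.abs_le_div.trans (div_le_self (by positivity) (one_le_pow₀ (by norm_num)))

lemma one_le_max (h : IsLineOfClass s t k q p r A B C) : 1 ≤ max |(A : ℝ)| |(B : ℝ)| := by
  have h0 : 0 < max |(A : ℝ)| |(B : ℝ)| := lt_of_le_of_lt (by positivity) h.lt_max
  rcases lt_max_iff.1 h0 with h1 | h1
  · exact le_max_of_le_left (by exact_mod_cast Int.one_le_abs (by simpa using h1))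
  · exact le_max_of_le_right (by exact_mod_cast Int.one_le_abs (by simpa using h1))

lemma max_pos (h : IsLineOfClass s t k q p r A B C) : 0 < max |(A : ℝ)| |(B : ℝ)| :=
  zero_lt_one.trans_le h.one_le_max

lemma pow_le_rpow (h : IsLineOfClass s t k q p r A B C) : (256 : ℝ) ^ k ≤ (q : ℝ) ^ t := by
  have := h.one_le_max.trans h.max_le
  rwa [one_le_div (by positivity)] at this

end IsLineOfClass

lemma InBox.abs_linear_le {s t c R : ℝ} {q : ℕ} {p r : ℤ} {w : ℝ × ℝ} (hq : 0 < q) {a b : ℝ}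
    (hR : 0 ≤ R) (h : InBox c s t q p r w) (ha : |a| ≤ R * (q : ℝ) ^ s)
    (hb : |b| ≤ R * (q : ℝ) ^ t) :
    |a * (q * w.1 - p) + b * (q * w.2 - r)| ≤ 2 * R * c := by
  have hq' : (0 : ℝ) < q := by exact_mod_cast hq
  refine (_root_.abs_linear_le _ _ _ _).trans ?_
  have h1 : |a| * |q * w.1 - p| ≤ R * c := calc
    _ ≤ R * (q : ℝ) ^ s * |q * w.1 - p| := by gcongr
    _ = R * (|q * w.1 - p| * (q : ℝ) ^ s) := by ring
    _ ≤ R * c := by gcongr; exact h.1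
  have h2 : |b| * |q * w.2 - r| ≤ R * c := calc
    _ ≤ R * (q : ℝ) ^ t * |q * w.2 - r| := by gcongr
    _ = R * (|q * w.2 - r| * (q : ℝ) ^ t) := by ring
    _ ≤ R * c := by gcongr; exact h.2
  linarith

/-- The line through a rational point passes close to every point of the box around it. -/
lemma IsLineOfClass.mul_abs_le {s t c : ℝ} {k q : ℕ} {p r A B C : ℤ} {w : ℝ × ℝ}
    (h : IsLineOfClass s t k q p r A B C) (hw : InBox c s t q p r w) :
    q * |A * w.1 + B * w.2 + C| ≤ 2 * c := by
  have h1 := hw.abs_linear_le h.pos zero_le_one (by simpa using h.abs_le)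
    (by simpa using h.abs_le_rpow)
  have hmem : (A : ℝ) * p + B * r + C * q = 0 := by exact_mod_cast h.mem
  have h2 : (A : ℝ) * (q * w.1 - p) + B * (q * w.2 - r) = q * (A * w.1 + B * w.2 + C) := by
    linear_combination -hmem
  rwa [h2, abs_mul, Nat.abs_cast, mul_one] at h1

/-- Two rational points with comparable denominators, one of whose lines passes very close to the
box of the other: that line contains the other point. -/
lemma IsLineOfClass.mul_abs_le_of_near {s t c ε R : ℝ} {k q q' : ℕ} {p r A B C p' r' : ℤ}
    {w : ℝ × ℝ} (hs : 0 ≤ s) (hst : s ≤ t) (hst1 : s + t = 1)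
    (h : IsLineOfClass s t k q p r A B C) (hq' : 0 < q') (hR : 1 ≤ R) (h1 : (q : ℝ) ≤ R * q')
    (h2 : (q' : ℝ) ≤ R * q) (hc : c * (8 * R) ≤ 1) (hε : ε * (8 * R) ≤ 1)
    (hw : InBox c s t q' p' r' w) (he : q * |A * w.1 + B * w.2 + C| ≤ 2 * c + 2 * ε) :
    q' * |A * w.1 + B * w.2 + C| ≤ 2 * R * c := by
  have hb := hw.abs_linear_le hq' (zero_le_one.trans hR)
    (h.abs_le.trans (rpow_le_mul_rpow (by positivity) (by positivity) hR hs (by linarith) h1))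
    (h.abs_le_rpow.trans (rpow_le_mul_rpow (by positivity) (by positivity) hR (by linarith)
      (by linarith) h1))
  have heq : ((A * p' + B * r' + C * q' : ℤ) : ℝ) =
      q' * (A * w.1 + B * w.2 + C) - (A * (q' * w.1 - p') + B * (q' * w.2 - r')) := by
    push_cast; ring
  have he' : |(q' : ℝ) * (A * w.1 + B * w.2 + C)| ≤ R * (2 * c + 2 * ε) := by
    rw [abs_mul, Nat.abs_cast]
    calc (q' : ℝ) * |A * w.1 + B * w.2 + C| ≤ R * q * |A * w.1 + B * w.2 + C| := by gcongr
      _ = R * (q * |A * w.1 + B * w.2 + C|) := by ring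
      _ ≤ _ := by gcongr
  have h0 : A * p' + B * r' + C * q' = 0 := by
    refine Int.eq_zero_of_abs_cast_lt_one ?_
    rw [heq]
    refine (abs_sub _ _).trans_lt ?_
    linarith
  rw [h0, Int.cast_zero, eq_comm, sub_eq_zero] at heq
  rwa [← heq, abs_mul, Nat.abs_cast] at hb

lemma inBox_natAbs {c s t : ℝ} {n P P' : ℤ} {w : ℝ × ℝ} (hn : n ≠ 0)
    (h1 : |n * w.1 - P| * |(n : ℝ)| ^ s ≤ c) (h2 : |n * w.2 - P'| * |(n : ℝ)| ^ t ≤ c) :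
    InBox c s t n.natAbs (n.sign * P) (n.sign * P') w := by
  have key : ∀ (x : ℝ) (P : ℤ), |(n.natAbs : ℝ) * x - ((n.sign * P : ℤ) : ℝ)| = |n * x - P| := by
    intro x P
    rcases lt_or_gt_of_ne hn with h | h
    · rw [Int.sign_eq_neg_one_of_neg h, Nat.cast_natAbs, abs_of_neg h, ← abs_neg]
      congr 1; push_cast; ring
    · rw [Int.sign_eq_one_of_pos h, Nat.cast_natAbs, abs_of_pos h, one_mul]
  have hN : (n.natAbs : ℝ) = |(n : ℝ)| := by rw [Nat.cast_natAbs, Int.cast_abs]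
  constructor
  · rwa [key, hN]
  · rwa [key, hN]

set_option maxHeartbeats 800000 in
/-- Two rational points of the same class whose lines are steep: either the line of the first
passes very close to the second, or the intersection point of the two lines is a good rational
approximation with smaller denominator. -/
lemma IsLineOfClass.mul_abs_le_or_inBox {s t c R : ℝ} {k q q' : ℕ} {p r A B C p' r' A' B' C' : ℤ}
    {w : ℝ × ℝ} (hs : 0 ≤ s) (hst : s ≤ t) (hst1 : s + t = 1)
    (h : IsLineOfClass s t k q p r A B C) (h' : IsLineOfClass s t k q' p' r' A' B' C')
    (hR : 1 ≤ R) (h1 : (q : ℝ) ≤ R * q') (hc0 : 0 < c) (hc : c * (8 * R) ≤ 1)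
    (hk : 4 * R ^ 3 ≤ c * 4 ^ k)
    (hw : InBox c s t q' p' r' w) (he : q' * |A * w.1 + B * w.2 + C| ≤ 4 ^ k) :
    q' * |A * w.1 + B * w.2 + C| ≤ 512 * R * c ∨
      ∃ q₀ : ℕ, 0 < q₀ ∧ q₀ < q' ∧ ∃ p₀ r₀ : ℤ, InBox c s t q₀ p₀ r₀ w := by
  set G : ℝ := 4 ^ k with hG
  have hG256 : (256 : ℝ) ^ k = G ^ 4 := by rw [hG, ← pow_mul, mul_comm, pow_mul]; norm_num
  have hq'0 : (0 : ℝ) < q' := by exact_mod_cast h'.pos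
  have hq'1 : (1 : ℝ) ≤ q' := by exact_mod_cast h'.pos
  have hR3 : R ≤ R ^ 3 := le_self_pow₀ hR (by norm_num)
  have hG32 : 32 * R ^ 4 ≤ G := by
    have h0 : 4 * R ^ 3 * (8 * R) ≤ c * G * (8 * R) := by gcongr
    have h3 : c * (8 * R) * G ≤ 1 * G := by gcongr
    nlinarith
  have hR4 : 1 ≤ R ^ 4 := one_le_pow₀ hR
  have hRR4 : R ≤ R ^ 4 := le_self_pow₀ hR (by norm_num)
  have hG1 : 1 ≤ G := by linarith
  have hG0 : 0 < G := by linarith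
  have hc1 : c ≤ 1 := by nlinarith
  set a : ℝ := (q' : ℝ) ^ s with ha
  set b : ℝ := (q' : ℝ) ^ t with hb
  have ha1 : 1 ≤ a := Real.one_le_rpow hq'1 hs
  have hb1 : 1 ≤ b := Real.one_le_rpow hq'1 (by linarith)
  have ha0 : 0 < a := by linarith
  have hb0 : 0 < b := by linarith
  have hab : a * b = q' := by rw [ha, hb, ← Real.rpow_add hq'0, hst1, Real.rpow_one]
  set e : ℝ := A * w.1 + B * w.2 + C with hedef
  set e' : ℝ := A' * w.1 + B' * w.2 + C' with hedef'
  have hq's : (q : ℝ) ^ s ≤ R * a :=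
    rpow_le_mul_rpow (by positivity) (by positivity) hR hs (by linarith) h1
  have hq't : (q : ℝ) ^ t ≤ R * b :=
    rpow_le_mul_rpow (by positivity) (by positivity) hR (by linarith) (by linarith) h1
  have hA : |(A : ℝ)| ≤ R * a := h.abs_le.trans hq's
  have hA' : |(A' : ℝ)| ≤ R * a := h'.abs_le.trans (le_mul_of_one_le_left ha0.le hR)
  have hM : max |(A : ℝ)| |(B : ℝ)| ≤ R * b / G ^ 4 := by
    refine h.max_le.trans ?_
    rw [hG256]
    gcongr
  have hB : |(B : ℝ)| ≤ R * b / G ^ 4 := (le_max_right _ _).trans hM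
  have hB' : |(B' : ℝ)| ≤ R * b / G ^ 4 := by
    refine h'.abs_le_div.trans ?_
    rw [hG256]
    gcongr
    exact le_mul_of_one_le_left hb0.le hR
  have hE' : (q' : ℝ) * |e'| ≤ 2 * c := h'.mul_abs_le hw
  have hE1 : |e| ≤ G / (a * b) := by rwa [hab, le_div_iff₀' hq'0]
  have hE1' : |e'| ≤ G / (a * b) := by rw [hab, le_div_iff₀' hq'0]; linarith
  have hX : |(B' : ℝ) * e - B * e'| ≤ 2 * R / (G ^ 3 * a) := by
    refine (abs_sub _ _).trans ?_
    rw [abs_mul, abs_mul]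
    calc |(B' : ℝ)| * |e| + |(B : ℝ)| * |e'|
        ≤ R * b / G ^ 4 * (G / (a * b)) + R * b / G ^ 4 * (G / (a * b)) := by gcongr
      _ = _ := by field_simp; ring
  have hY : |(A : ℝ) * e' - A' * e| ≤ 2 * R * G / b := by
    refine (abs_sub _ _).trans ?_
    rw [abs_mul, abs_mul]
    calc |(A : ℝ)| * |e'| + |(A' : ℝ)| * |e|
        ≤ R * a * (G / (a * b)) + R * a * (G / (a * b)) := by gcongr
      _ = _ := by field_simp; ring
  have hdet : |((A * B' - A' * B : ℤ) : ℝ)| ≤ 2 * R ^ 2 * (q' / G ^ 4) := by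
    push_cast
    refine (abs_sub _ _).trans ?_
    rw [abs_mul, abs_mul, ← hab]
    calc |(A : ℝ)| * |(B' : ℝ)| + |(A' : ℝ)| * |(B : ℝ)|
        ≤ R * a * (R * b / G ^ 4) + R * a * (R * b / G ^ 4) := by gcongr
      _ = _ := by field_simp; ring
  have hXeq : ((A * B' - A' * B : ℤ) : ℝ) * w.1 - ((B * C' - B' * C : ℤ) : ℝ) =
      B' * e - B * e' := by
    push_cast; rw [hedef, hedef']; ring
  have hYeq : ((A * B' - A' * B : ℤ) : ℝ) * w.2 - ((A' * C - A * C' : ℤ) : ℝ) =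
      A * e' - A' * e := by
    push_cast; rw [hedef, hedef']; ring
  have hG34 : G ≤ G ^ 3 := le_self_pow₀ hG1 (by norm_num)
  have hG24 : G ≤ G ^ 4 := le_self_pow₀ hG1 (by norm_num)
  by_cases hD : A * B' - A' * B = 0
  · left
    rw [hD, Int.cast_zero, zero_mul, zero_sub] at hXeq hYeq
    have hbG : G ^ 4 ≤ b := hG256 ▸ h'.pow_le_rpow
    have hX0 : B * C' - B' * C = 0 := by
      refine Int.eq_zero_of_abs_cast_lt_one ?_
      rw [← abs_neg, hXeq]
      refine hX.trans_lt ((div_lt_one (by positivity)).2 ?_)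
      have : G ^ 3 * 1 ≤ G ^ 3 * a := by gcongr
      linarith
    have hY0 : A' * C - A * C' = 0 := by
      refine Int.eq_zero_of_abs_cast_lt_one ?_
      rw [← abs_neg, hYeq]
      refine hY.trans_lt ((div_lt_one (by positivity)).2 ?_)
      have : G ^ 4 = G ^ 3 * G := by ring
      have h5 : 32 * R * G ≤ G ^ 3 * G := by gcongr; linarith
      have : 0 < R * G := by positivity
      linarith
    rw [hX0, Int.cast_zero, neg_zero, eq_comm, sub_eq_zero] at hXeq
    rw [hY0, Int.cast_zero, neg_zero, eq_comm, sub_eq_zero] at hYeq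
    have hMe : max |(A' : ℝ)| |(B' : ℝ)| * |e| ≤ max |(A : ℝ)| |(B : ℝ)| * |e'| := by
      rw [max_mul_of_nonneg _ _ (abs_nonneg e), max_mul_of_nonneg _ _ (abs_nonneg e'),
        ← abs_mul, ← abs_mul, ← abs_mul, ← abs_mul, hXeq, hYeq]
    have hMl := h'.lt_max
    rw [pow_succ, hG256] at hMl
    have h3 : b / (G ^ 4 * 256) * |e| ≤ R * b / G ^ 4 * |e'| :=
      (mul_le_mul_of_nonneg_right hMl.le (abs_nonneg e)).trans
        (hMe.trans (mul_le_mul_of_nonneg_right hM (abs_nonneg e')))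
    have h4 : |e| ≤ 256 * R * |e'| := by
      have h6 : R * b / G ^ 4 * |e'| = b / (G ^ 4 * 256) * (256 * R * |e'|) := by field_simp
      rw [h6] at h3
      exact le_of_mul_le_mul_left h3 (by positivity)
    calc (q' : ℝ) * |e| ≤ q' * (256 * R * |e'|) := by gcongr
      _ = 256 * R * (q' * |e'|) := by ring
      _ ≤ 256 * R * (2 * c) := by gcongr
      _ = _ := by ring
  · right
    have hR2 : 1 ≤ 2 * R ^ 2 := by linarith [one_le_pow₀ hR (n := 2)]
    have hGR : 2 * R ^ 2 < G ^ 4 := by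
      have : R ^ 2 ≤ R ^ 4 := pow_le_pow_right₀ hR (by norm_num)
      linarith
    refine ⟨(A * B' - A' * B).natAbs, Int.natAbs_pos.2 hD, ?_, _, _, inBox_natAbs hD
      (P := B * C' - B' * C) (P' := A' * C - A * C') ?_ ?_⟩
    · have : ((A * B' - A' * B).natAbs : ℝ) < q' := by
        rw [Nat.cast_natAbs, Int.cast_abs]
        refine hdet.trans_lt ?_
        rw [← mul_div_assoc, div_lt_iff₀ (by positivity), mul_comm]
        gcongr
      exact_mod_cast this
    · rw [hXeq]
      have h3 : |((A * B' - A' * B : ℤ) : ℝ)| ^ s ≤ 2 * R ^ 2 * a :=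
        rpow_le_mul_rpow (by positivity) (by positivity) hR2 hs (by linarith) (hdet.trans (by
          gcongr
          exact div_le_self hq'0.le (hG1.trans hG24)))
      calc _ ≤ 2 * R / (G ^ 3 * a) * (2 * R ^ 2 * a) := by gcongr
        _ = 4 * R ^ 3 / G ^ 3 := by field_simp; ring
        _ ≤ 4 * R ^ 3 / G := by gcongr
        _ ≤ c := by rwa [div_le_iff₀ hG0]
    · rw [hYeq]
      have h3 : |((A * B' - A' * B : ℤ) : ℝ)| ^ t ≤ 2 * R ^ 2 * (q' / G ^ 4) ^ t :=
        rpow_le_mul_rpow (by positivity) (by positivity) hR2 (by linarith) (by linarith) hdet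
      have h4 : G ^ 2 ≤ (G ^ 4) ^ t := by
        calc G ^ 2 = (G ^ 4) ^ (1 / 2 : ℝ) := by
              rw [← Real.sqrt_eq_rpow, show G ^ 4 = (G ^ 2) ^ 2 by ring,
                Real.sqrt_sq (by positivity)]
          _ ≤ (G ^ 4) ^ t := Real.rpow_le_rpow_of_exponent_le (hG1.trans hG24) (by linarith)
      have h5 : (q' / G ^ 4 : ℝ) ^ t ≤ b / G ^ 2 := by
        rw [Real.div_rpow (by positivity) (by positivity)]
        gcongr
      calc _ ≤ 2 * R * G / b * (2 * R ^ 2 * (b / G ^ 2)) := by gcongr; exact h3.trans (by gcongr)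
        _ = 4 * R ^ 3 / G := by field_simp; ring
        _ ≤ c := by rwa [div_le_iff₀ hG0]

end

section
open Set

lemma abs_linear_le_max (a b : ℝ) {x y d : ℝ} (hx : |x| ≤ d) (hy : |y| ≤ d) :
    |a * x + b * y| ≤ 2 * (d * max |a| |b|) := by
  have hd : 0 ≤ d := (abs_nonneg x).trans hx
  calc |a * x + b * y| ≤ |a| * |x| + |b| * |y| := abs_linear_le _ _ _ _
    _ ≤ max |a| |b| * d + max |a| |b| * d := by gcongr; exacts [le_max_left _ _, le_max_right _ _]
    _ = _ := by ring

/-- The distance from a point to the line `a x + b y + c = 0` in the maximum norm. -/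
lemma exists_dist_le_of_linear {a b c : ℝ} (h : 0 < max |a| |b|) (w : ℝ × ℝ) :
    ∃ v : ℝ × ℝ, a * v.1 + b * v.2 + c = 0 ∧
      dist v w ≤ |a * w.1 + b * w.2 + c| / max |a| |b| := by
  rcases le_total |a| |b| with hab | hab
  · rw [max_eq_right hab] at h ⊢
    have hb : b ≠ 0 := abs_pos.1 h
    refine ⟨(w.1, w.2 - (a * w.1 + b * w.2 + c) / b), by field_simp; ring, ?_⟩
    rw [Prod.dist_eq, dist_self, Real.dist_eq, sub_sub_cancel_left, abs_neg, abs_div]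
    exact max_le (by positivity) le_rfl
  · rw [max_eq_left hab] at h ⊢
    have ha : a ≠ 0 := abs_pos.1 h
    refine ⟨(w.1 - (a * w.1 + b * w.2 + c) / a, w.2), by field_simp; ring, ?_⟩
    rw [Prod.dist_eq, dist_self, Real.dist_eq, sub_sub_cancel_left, abs_neg, abs_div]
    exact max_le le_rfl (by positivity)

lemma le_mul_of_rpow_le {x y R e : ℝ} (hy : 0 ≤ y) (hR : 1 ≤ R) (he : 1 ≤ e)
    (h : x ^ e ≤ R * y ^ e) : x ≤ R * y := by
  by_contra! hlt
  have h1 : (R * y) ^ e < x ^ e := Real.rpow_lt_rpow (by positivity) hlt (by linarith)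
  rw [Real.mul_rpow (by linarith) hy] at h1
  have h2 : R ≤ R ^ e := by simpa using Real.rpow_le_rpow_of_exponent_le hR he
  have h3 : R * y ^ e ≤ R ^ e * y ^ e := by gcongr
  linarith

/-- Two rational points of the same class, with denominators in the same window: either the line of
the first passes close to every point of the box of the second, or that point admits a good rational
approximation of smaller denominator. -/
lemma IsLineOfClass.exists_near_or_inBox {s t c ε ρ d κ β R : ℝ} {k q q' : ℕ}
    {p r A B C p' r' A' B' C' : ℤ} {w w' : ℝ × ℝ} (hs : 0 ≤ s) (hst : s ≤ t) (hst1 : s + t = 1)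
    (h : IsLineOfClass s t k q p r A B C) (h' : IsLineOfClass s t k q' p' r' A' B' C')
    (hβ : β * R = 1) (hR : 1 ≤ R) (hc0 : 0 < c) (hc : c * (8 * R) ≤ 1)
    (hκ : κ = 1 ∨ κ = 4 ^ k ∧ 4 * R ^ 3 ≤ c * 4 ^ k) (hρ : 0 < ρ) (hε : 0 < ε)
    (hd : d * ε * (8 * R) ≤ ρ)
    (hq : β * (ε * 256 ^ k * κ / ρ) < (q : ℝ) ^ (1 + t))
    (hq' : (q : ℝ) ^ (1 + t) ≤ ε * 256 ^ k * κ / ρ)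
    (hq₂ : β * (ε * 256 ^ k * κ / ρ) < (q' : ℝ) ^ (1 + t))
    (hq₂' : (q' : ℝ) ^ (1 + t) ≤ ε * 256 ^ k * κ / ρ)
    (hw : InBox c s t q p r w) (hw' : InBox c s t q' p' r' w') (hww' : dist w' w ≤ d) :
    (∃ v : ℝ × ℝ, A * v.1 + B * v.2 + C = 0 ∧ dist v w' ≤ 2 ^ 17 * R ^ 3 / ε * (c / κ) * ρ) ∨
      ∃ q₀ : ℕ, 0 < q₀ ∧ q₀ < q' ∧ ∃ p₀ r₀ : ℤ, InBox c s t q₀ p₀ r₀ w' := by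
  have hκ1 : 1 ≤ κ := by
    rcases hκ with rfl | ⟨rfl, -⟩
    exacts [le_rfl, one_le_pow₀ (by norm_num)]
  have hκ0 : 0 < κ := by linarith
  have hq0 : (0 : ℝ) < q := by exact_mod_cast h.pos
  have hq'0 : (0 : ℝ) < q' := by exact_mod_cast h'.pos
  have hd0 : 0 ≤ d := dist_nonneg.trans hww'
  have hβ0 : 0 < β := pos_of_mul_pos_left (hβ ▸ zero_lt_one) (by linarith)
  set M : ℝ := max |(A : ℝ)| |(B : ℝ)| with hM
  set X : ℝ := ε * 256 ^ k * κ / ρ with hX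
  have hRβ : ∀ x : ℝ, R * (β * x) = x := fun x => by rw [← mul_assoc, mul_comm R, hβ, one_mul]
  have hle : ∀ {x y : ℝ}, 0 ≤ y → x ^ (1 + t) ≤ X → β * X < y ^ (1 + t) → x ≤ R * y := by
    intro x y hy h1 h2
    refine le_mul_of_rpow_le hy hR (by linarith : (1 : ℝ) ≤ 1 + t) (h1.trans ?_)
    rw [← hRβ X]
    gcongr
  have h1 : (q : ℝ) ≤ R * q' := hle hq'0.le hq' hq₂
  have h2 : (q' : ℝ) ≤ R * q := hle hq0.le hq₂' hq
  have hqt : (q : ℝ) ^ (1 + t) = q * (q : ℝ) ^ t := by rw [Real.rpow_add hq0, Real.rpow_one]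
  have hqM : q * M ≤ ε * κ / ρ := calc
    q * M ≤ q * ((q : ℝ) ^ t / 256 ^ k) := by gcongr; exact h.max_le
    _ = (q : ℝ) ^ (1 + t) / 256 ^ k := by rw [hqt]; ring
    _ ≤ X / 256 ^ k := by gcongr
    _ = ε * κ / ρ := by rw [hX]; field_simp
  have hqM' : β * (ε * κ / ρ) / 256 ≤ q * M := calc
    β * (ε * κ / ρ) / 256 = β * X / 256 ^ (k + 1) := by rw [hX, pow_succ]; field_simp
    _ ≤ (q : ℝ) ^ (1 + t) / 256 ^ (k + 1) := by gcongr
    _ = q * ((q : ℝ) ^ t / 256 ^ (k + 1)) := by rw [hqt]; ring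
    _ ≤ q * M := by gcongr; exact h.lt_max.le
  have hR0 : 0 < R := by linarith
  set δ : ℝ := d * ε / ρ with hδ
  have hδ0 : 0 ≤ δ := by positivity
  have hδR : δ * (8 * R) ≤ 1 := by
    rw [hδ, div_mul_eq_mul_div, div_le_one hρ]
    exact hd
  have hde : d * (q * M) ≤ δ * κ := calc
    d * (q * M) ≤ d * (ε * κ / ρ) := by gcongr
    _ = δ * κ := by rw [hδ]; ring
  have he : q * |A * w'.1 + B * w'.2 + C| ≤ 2 * c + 2 * (δ * κ) := by
    have h3 : (A * w'.1 + B * w'.2 + C : ℝ) =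
      (A * w.1 + B * w.2 + C) + (A * (w'.1 - w.1) + B * (w'.2 - w.2)) := by ring
    have h4 := h.mul_abs_le hw
    rw [Prod.dist_eq, Real.dist_eq, Real.dist_eq, max_le_iff] at hww'
    have h5 := abs_linear_le_max A B hww'.1 hww'.2
    rw [h3]
    calc _ ≤ q * (|A * w.1 + B * w.2 + C| + 2 * (d * M)) := by
          gcongr
          exact (abs_add_le _ _).trans (by gcongr)
      _ = q * |A * w.1 + B * w.2 + C| + 2 * (d * (q * M)) := by ring
      _ ≤ _ := by gcongr
  have hdich : q' * |A * w'.1 + B * w'.2 + C| ≤ 512 * R * c ∨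
      ∃ q₀ : ℕ, 0 < q₀ ∧ q₀ < q' ∧ ∃ p₀ r₀ : ℤ, InBox c s t q₀ p₀ r₀ w' := by
    rcases hκ with rfl | ⟨rfl, hk⟩
    · left
      rw [mul_one] at he
      have := h.mul_abs_le_of_near hs hst hst1 h'.pos hR h1 h2 hc hδR hw' he
      have : 0 < R * c := by positivity
      linarith
    · refine h.mul_abs_le_or_inBox hs hst hst1 h' hR h1 hc0 hc hk hw' ?_
      calc (q' : ℝ) * |A * w'.1 + B * w'.2 + C| ≤ R * q * |A * w'.1 + B * w'.2 + C| := by gcongr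
        _ = R * (q * |A * w'.1 + B * w'.2 + C|) := by ring
        _ ≤ R * (2 * c + 2 * (δ * 4 ^ k)) := by gcongr
        _ = (c * (8 * R)) / 4 + (δ * (8 * R)) / 4 * 4 ^ k := by ring
        _ ≤ 1 / 4 + 1 / 4 * 4 ^ k := by gcongr
        _ ≤ 4 ^ k := by linarith
  refine hdich.imp_left fun h3 => ?_
  obtain ⟨v, hv, hvw⟩ := exists_dist_le_of_linear (c := C) h.max_pos w'
  refine ⟨v, hv, hvw.trans ?_⟩
  rw [← hM] at hvw ⊢
  have hM0 : 0 < M := h.max_pos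
  rw [div_le_iff₀ hM0]
  have h4 : β * (ε * κ / ρ) / 256 ≤ R * (q' * M) := hqM'.trans (by
    rw [← mul_assoc]; gcongr)
  have h5 : 1 ≤ 256 * R ^ 2 * ρ / (ε * κ) * (q' * M) := by
    have h6 : 256 * R * ρ / (ε * κ) * (β * (ε * κ / ρ) / 256) = 1 := by
      have : 256 * R * ρ / (ε * κ) * (β * (ε * κ / ρ) / 256) = β * R := by field_simp
      rw [this, hβ]
    rw [← h6]
    calc _ ≤ 256 * R * ρ / (ε * κ) * (R * (q' * M)) := by gcongr
      _ = _ := by ring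
  refine le_of_mul_le_mul_left (h3.trans ?_) hq'0
  calc 512 * R * c ≤ 512 * R * c * (256 * R ^ 2 * ρ / (ε * κ) * (q' * M)) :=
        le_mul_of_one_le_right (by positivity) h5
    _ = _ := by field_simp; ring

/-- A rational point of large denominator falls in one of the windows. -/
lemma exists_window {t ε κ β G q : ℝ} {ρ : ℕ → ℝ} {n₀ : ℕ} (hq : 0 < q) (hGq : G ^ 4 ≤ q ^ t)
    (hG : 0 < G) (ht : t ≤ 1) (hε : 0 < ε) (hβ : 0 < β) (hεβ : β * ε ≤ 1)
    (hκ : 0 < κ) (hκG : κ ≤ G) (hρ0 : ∀ n, 0 < ρ n) (hρ1 : ρ n₀ ≤ 1)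
    (hρ : ∀ n, ρ (n + 1) = β * ρ n)
    (hlim : Tendsto ρ atTop (nhds 0)) (hqρ : 1 < q * ρ n₀ ^ 2) :
    ∃ n, n₀ ≤ n ∧ β * (ε * G ^ 4 * κ / ρ n) < q ^ (1 + t) ∧
      q ^ (1 + t) ≤ ε * G ^ 4 * κ / ρ n := by
  have hX : 0 < q ^ (1 + t) := by positivity
  have hex : ∃ m, ρ (n₀ + m) ≤ ε * G ^ 4 * κ / q ^ (1 + t) := by
    obtain ⟨n, hn1, hn2⟩ := ((hlim.eventually_le_const
      (show 0 < ε * G ^ 4 * κ / q ^ (1 + t) by positivity)).and (eventually_ge_atTop n₀)).exists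
    exact ⟨n - n₀, by rwa [Nat.add_sub_cancel' hn2]⟩
  classical
  have hm := Nat.find_spec hex
  have hmin := fun m => Nat.find_min hex (m := m)
  set m := Nat.find hex
  refine ⟨n₀ + m, Nat.le_add_right _ _, ?_, ?_⟩
  · rw [← mul_div_assoc, div_lt_iff₀ (hρ0 _)]
    rcases hmeq : m with _ | m'
    · rw [add_zero]
      have hq1 : 1 < q := by
        have : ρ n₀ ^ 2 ≤ 1 := pow_le_one₀ (hρ0 _).le hρ1
        nlinarith
      have hG4 : G ^ 4 ≤ q := hGq.trans (by simpa using Real.rpow_le_rpow_of_exponent_le hq1.le ht)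
      have hlt : G < q * ρ n₀ := by
        have := hρ0 n₀
        refine lt_of_pow_lt_pow_left₀ 4 (by positivity) (hG4.trans_lt ?_)
        calc q < q * (q * (q * ρ n₀ ^ 2) ^ 2) := by
              refine lt_mul_of_one_lt_right hq (one_lt_mul hq1.le (one_lt_pow₀ hqρ two_ne_zero))
          _ = _ := by ring
      rw [Real.rpow_add hq, Real.rpow_one]
      calc β * (ε * G ^ 4 * κ) = (β * ε) * (G ^ 4 * κ) := by ring
        _ ≤ 1 * (G ^ 4 * G) := by gcongr
        _ < 1 * (G ^ 4 * (q * ρ n₀)) := by gcongr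
        _ ≤ 1 * (q ^ t * (q * ρ n₀)) := by have := hρ0 n₀; gcongr
        _ = _ := by ring
    · have := hmin m' (by omega)
      rw [not_le, div_lt_iff₀ hX] at this
      rw [← add_assoc, hρ]
      calc β * (ε * G ^ 4 * κ) < β * (ρ (n₀ + m') * q ^ (1 + t)) := by gcongr
        _ = _ := by ring
  · rw [le_div_iff₀ hX] at hm
    rw [le_div_iff₀ (hρ0 _)]
    linarith

end

section
open Set

/-- Uniform differentiability of a `C¹` map on a compact convex set. -/
lemma exists_norm_sub_sub_fderiv_le_of_contDiff
    {E F : Type*} [NormedAddCommGroup E] [NormedSpace ℝ E]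
    [NormedAddCommGroup F] [NormedSpace ℝ F] {f : E → F} (hf : ContDiff ℝ 1 f) {S : Set E}
    (hS : IsCompact S) (hSc : Convex ℝ S) {η : ℝ} (hη : 0 < η) :
    ∃ δ > 0, ∀ x ∈ S, ∀ y ∈ S, dist y x ≤ δ →
      ‖f y - f x - fderiv ℝ f x (y - x)‖ ≤ η * ‖y - x‖ := by
  have huc : UniformContinuousOn (fderiv ℝ f) S :=
    hS.uniformContinuousOn_of_continuous (hf.continuous_fderiv one_ne_zero).continuousOn
  obtain ⟨δ, hδ, h⟩ := Metric.uniformContinuousOn_iff.1 huc η hη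
  refine ⟨δ / 2, by positivity, fun x hx y hy hxy => ?_⟩
  have hT : Convex ℝ (S ∩ closedBall x (δ / 2)) := hSc.inter (convex_closedBall _ _)
  refine hT.norm_image_sub_le_of_norm_hasFDerivWithin_le' (f' := fderiv ℝ f)
    (fun z _ => ((hf.differentiable one_ne_zero) z).hasFDerivAt.hasFDerivWithinAt)
    (fun z hz => ?_) ⟨hx, mem_closedBall_self (by positivity)⟩ ⟨hy, hxy⟩
  rw [← dist_eq_norm]
  exact (h z hz.1 x hx ((mem_closedBall.1 hz.2).trans_lt (by linarith))).le

/-- The image of a line under a `C¹` diffeomorphism, at small scale, is close to a line. -/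
lemma exists_isLine_infDist_le {f g : ℝ × ℝ → ℝ × ℝ} (hf : ContDiff ℝ 1 f) (hg : ContDiff ℝ 1 g)
    (hgf : Function.LeftInverse g f) (hfg : Function.RightInverse g f) (x₀ : ℝ × ℝ) {ε : ℝ}
    (hε : 0 < ε) :
    ∃ r > 0, ∀ ρ : ℝ, 0 < ρ → ρ ≤ r → ∀ x ∈ closedBall x₀ 2, ∀ A B C : ℝ, 0 < max |A| |B| →
      ∃ L : AffineSubspace ℝ (ℝ × ℝ), IsLine L ∧ ∀ z ∈ closedBall x (2 * ρ),
        A * (g z).1 + B * (g z).2 + C = 0 → infDist z (L : Set (ℝ × ℝ)) ≤ ε * ρ := by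
  obtain ⟨Λ, hΛ⟩ := hg.contDiffOn.exists_lipschitzOnWith (s := closedBall x₀ 3) one_ne_zero
    (convex_closedBall _ _) (isCompact_closedBall _ _)
  have hmaps : ∀ z ∈ closedBall x₀ 3, g z ∈ closedBall (g x₀) (Λ * 3) := fun z hz =>
    (hΛ.dist_le_mul z hz x₀ (mem_closedBall_self (by norm_num))).trans (by
      gcongr; exact hz)
  obtain ⟨δ, hδ, hlin⟩ := exists_norm_sub_sub_fderiv_le_of_contDiff hf
    (isCompact_closedBall (g x₀) (Λ * 3)) (convex_closedBall _ _)
    (show 0 < ε / (4 * (Λ + 1)) by positivity)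
  refine ⟨min (1 / 2) (δ / (4 * (Λ + 1))), by positivity, fun ρ hρ hρr x hx A B C hAB => ?_⟩
  have hρ1 : ρ ≤ 1 / 2 := hρr.trans (min_le_left _ _)
  have hρδ : Λ * (4 * ρ) ≤ δ := by
    have := hρr.trans (min_le_right _ _)
    rw [le_div_iff₀ (by positivity)] at this
    nlinarith
  have hsub : closedBall x (2 * ρ) ⊆ closedBall x₀ 3 :=
    closedBall_subset_closedBall' (by rw [mem_closedBall] at hx; linarith)
  have hv : ((-B, A) : ℝ × ℝ) ≠ 0 := by
    intro h
    rw [Prod.mk_eq_zero, neg_eq_zero] at h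
    simp [h.1, h.2] at hAB
  have hline : ∀ (y u : ℝ × ℝ), u ≠ 0 → IsLine (AffineSubspace.mk' y (Submodule.span ℝ {u})) :=
    fun y u hu => ⟨AffineSubspace.mk'_nonempty _ _, by
      rw [AffineSubspace.direction_mk', finrank_span_singleton hu]⟩
  by_cases hex : ∃ z₁ ∈ closedBall x (2 * ρ), A * (g z₁).1 + B * (g z₁).2 + C = 0
  · obtain ⟨z₁, hz₁, h1⟩ := hex
    have hinj : fderiv ℝ f (g z₁) (-B, A) ≠ 0 := by
      intro h0
      have hd1 := ((hf.differentiable one_ne_zero) (g z₁)).hasFDerivAt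
      have hd2 := ((hg.differentiable one_ne_zero) (f (g z₁))).hasFDerivAt
      have hd3 := hd2.comp _ hd1
      rw [hgf.comp_eq_id] at hd3
      have := congrArg (fun T => T (-B, A)) (hd3.unique (hasFDerivAt_id _))
      simp only [ContinuousLinearMap.comp_apply, h0, map_zero, ContinuousLinearMap.id_apply] at this
      exact hv this.symm
    refine ⟨_, hline z₁ _ hinj, fun z hz h => ?_⟩
    have hdist : dist (g z) (g z₁) ≤ Λ * (4 * ρ) := by
      refine (hΛ.dist_le_mul z (hsub hz) z₁ (hsub hz₁)).trans ?_
      gcongr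
      have := dist_triangle_right z z₁ x
      rw [mem_closedBall] at hz hz₁
      linarith
    have happ := hlin (g z₁) (hmaps _ (hsub hz₁)) (g z) (hmaps _ (hsub hz)) (hdist.trans hρδ)
    rw [hfg z, hfg z₁] at happ
    have hmem : fderiv ℝ f (g z₁) (g z - g z₁) +ᵥ z₁ ∈
        AffineSubspace.mk' z₁ (Submodule.span ℝ {fderiv ℝ f (g z₁) (-B, A)}) := by
      refine AffineSubspace.vadd_mem_mk' _ ?_
      have hAB2 : A ^ 2 + B ^ 2 ≠ 0 := by
        intro h0
        have hA : A = 0 := by nlinarith [sq_nonneg A, sq_nonneg B]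
        have hB : B = 0 := by nlinarith [sq_nonneg A, sq_nonneg B]
        simp [hA, hB] at hAB
      have : g z - g z₁ =
          ((A * ((g z).2 - (g z₁).2) - B * ((g z).1 - (g z₁).1)) / (A ^ 2 + B ^ 2)) •
          ((-B, A) : ℝ × ℝ) := by
        ext
        · simp only [Prod.fst_sub, Prod.smul_fst, smul_eq_mul]
          field_simp
          linear_combination A * h - A * h1
        · simp only [Prod.snd_sub, Prod.smul_snd, smul_eq_mul]
          field_simp
          linear_combination B * h - B * h1
      rw [this, map_smul]
      exact Submodule.smul_mem _ _ (Submodule.mem_span_singleton_self _)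
    refine (infDist_le_dist_of_mem hmem).trans ?_
    rw [dist_eq_norm, vadd_eq_add, show z - (fderiv ℝ f (g z₁) (g z - g z₁) + z₁) =
      z - z₁ - fderiv ℝ f (g z₁) (g z - g z₁) by abel]
    refine happ.trans ?_
    rw [← dist_eq_norm]
    calc ε / (4 * (Λ + 1)) * dist (g z) (g z₁) ≤ ε / (4 * (Λ + 1)) * (Λ * (4 * ρ)) := by gcongr
      _ = ε * ρ * (Λ / (Λ + 1)) := by field_simp
      _ ≤ ε * ρ * 1 := by
        gcongr
        exact (div_le_one (by positivity)).2 (by linarith)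
      _ = ε * ρ := mul_one _
  · exact ⟨_, hline x _ hv, fun z hz h => absurd ⟨z, hz, h⟩ hex⟩

end

section
open Set ENNReal

lemma exists_isLine : ∃ L : AffineSubspace ℝ (ℝ × ℝ), IsLine L := by
  refine ⟨AffineSubspace.mk' 0 (Submodule.span ℝ {((1, 0) : ℝ × ℝ)}),
    AffineSubspace.mk'_nonempty _ _, ?_⟩
  rw [AffineSubspace.direction_mk', finrank_span_singleton (by simp)]

/-- Around `x₀` and at all scales `ρ m` with `m ≥ n`, the set `Z` is close to a line. -/
def IsFlatFrom (ρ : ℕ → ℝ) (β : ℝ) (x₀ : ℝ × ℝ) (n : ℕ) (Z : Set (ℝ × ℝ)) : Prop :=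
  ∀ m, n ≤ m → ∀ x ∈ closedBall x₀ 2, ∃ L : AffineSubspace ℝ (ℝ × ℝ), IsLine L ∧
    ∀ z ∈ Z, z ∈ closedBall x (2 * ρ m) → infDist z (L : Set (ℝ × ℝ)) ≤ β * ρ m

lemma isFlatFrom_empty {ρ : ℕ → ℝ} {β : ℝ} {x₀ : ℝ × ℝ} {n : ℕ} : IsFlatFrom ρ β x₀ n ∅ :=
  fun _ _ _ _ => exists_isLine.imp fun _ hL => ⟨hL, fun _ hz => absurd hz (notMem_empty _)⟩

lemma exists_tsum_rpow_le {D b γ ε : ℝ} (hD : 0 < D) (hb : 0 < b) (hγ : 0 < γ) (hε : 0 < ε) :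
    ∃ η, 0 < η ∧ η ≤ b ∧
      ∑' i : ℕ × Bool, ENNReal.ofReal ((D * η * (1 / 2) ^ i.1) ^ γ) ≤ ENNReal.ofReal ε := by
  set x : ℝ := (1 / 2 : ℝ) ^ γ with hx
  have hx0 : 0 ≤ x := by positivity
  have hx1 : x < 1 := Real.rpow_lt_one (by norm_num) (by norm_num) hγ
  have hsum : Summable fun k : ℕ => x ^ k := summable_geometric_of_lt_one hx0 hx1
  set T : ℝ := ∑' k : ℕ, x ^ k with hT
  have hT0 : 0 < T := hsum.tsum_pos (fun _ => by positivity) 0 (by simp)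
  have key : ∀ y : ℝ, 0 ≤ y →
      ∑' i : ℕ × Bool, ENNReal.ofReal ((y * (1 / 2) ^ i.1) ^ γ) =
        ENNReal.ofReal (2 * (y ^ γ * T)) := by
    intro y hy
    rw [ENNReal.tsum_prod']
    simp only [tsum_bool]
    rw [ENNReal.tsum_add, ← two_mul, ENNReal.ofReal_mul zero_le_two,
      ENNReal.ofReal_mul (by positivity),
      hT, ENNReal.ofReal_tsum_of_nonneg (fun _ => by positivity) hsum, ENNReal.ofReal_ofNat]
    congr 1
    rw [← ENNReal.tsum_mul_left]
    refine tsum_congr fun k => ?_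
    rw [← ENNReal.ofReal_mul (by positivity), Real.mul_rpow hy (by positivity), hx,
      ← Real.rpow_natCast, ← Real.rpow_natCast, ← Real.rpow_mul (by norm_num),
      ← Real.rpow_mul (by norm_num), mul_comm γ]
  refine ⟨min b ((ε / (2 * T)) ^ γ⁻¹ / D), by positivity, min_le_left _ _, ?_⟩
  set η := min b ((ε / (2 * T)) ^ γ⁻¹ / D) with hη
  have hη0 : 0 < η := by positivity
  rw [key _ (by positivity)]
  refine ENNReal.ofReal_le_ofReal ?_
  have h1 : D * η ≤ (ε / (2 * T)) ^ γ⁻¹ := by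
    rw [mul_comm, ← le_div_iff₀ hD]
    exact min_le_right _ _
  calc 2 * ((D * η) ^ γ * T) ≤ 2 * (((ε / (2 * T)) ^ γ⁻¹) ^ γ * T) := by gcongr
    _ = 2 * (ε / (2 * T) * T) := by
      rw [← Real.rpow_mul (by positivity), inv_mul_cancel₀ hγ.ne', Real.rpow_one]
    _ = ε := by field_simp

lemma exists_inBox_of_notMem_badPair {s t : ℝ} {w : ℝ × ℝ} (hw : w ∉ badPair s t) {c : ℝ}
    (hc : 0 < c) : ∃ q : ℕ, 0 < q ∧ ∃ p r : ℤ, InBox c s t q p r w := by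
  by_contra! h
  refine hw ?_
  have : c ≤ ⨅ q : ℕ+, max (((q : ℕ) : ℝ) ^ s * distNearestInt (((q : ℕ) : ℝ) * w.1))
      (((q : ℕ) : ℝ) ^ t * distNearestInt (((q : ℕ) : ℝ) * w.2)) := by
    refine le_ciInf fun q => ?_
    by_contra! hlt
    obtain ⟨h1, h2⟩ := max_lt_iff.1 hlt
    refine h q q.pos (round (((q : ℕ) : ℝ) * w.1)) (round (((q : ℕ) : ℝ) * w.2)) ⟨?_, ?_⟩
    · rw [mul_comm]; exact h1.le
    · rw [mul_comm]; exact h2.le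
  exact hc.trans_le this

lemma swap_mem_badPair {s t : ℝ} {w : ℝ × ℝ} (h : w.swap ∈ badPair t s) : w ∈ badPair s t := by
  simpa only [badPair, mem_ofPred_eq, Prod.fst_swap, Prod.snd_swap, max_comm] using h

/-- A geometric sequence of scales. -/
structure IsScale (ρ : ℕ → ℝ) (β : ℝ) : Prop where
  ratio_pos : 0 < β
  two_mul_ratio_le : 2 * β ≤ 1
  pos : ∀ n, 0 < ρ n
  zero_le_one : ρ 0 ≤ 1
  succ : ∀ n, ρ (n + 1) = β * ρ n

namespace IsScale

variable {ρ : ℕ → ℝ} {β : ℝ}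

lemma eq_pow (h : IsScale ρ β) (n : ℕ) : ρ n = β ^ n * ρ 0 := by
  induction n with
  | zero => simp
  | succ n ih => rw [h.succ, ih, pow_succ]; ring

lemma antitone (h : IsScale ρ β) : Antitone ρ := antitone_nat_of_succ_le fun n => by
  rw [h.succ]
  nlinarith [h.pos n, h.two_mul_ratio_le]

lemma le_one (h : IsScale ρ β) (n : ℕ) : ρ n ≤ 1 := (h.antitone (Nat.zero_le n)).trans h.zero_le_one

lemma tendsto (h : IsScale ρ β) : Tendsto ρ atTop (nhds 0) := by
  have h1 := (tendsto_pow_atTop_nhds_zero_of_lt_one h.ratio_pos.le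
    (by linarith [h.two_mul_ratio_le, h.ratio_pos])).mul_const (ρ 0)
  rw [zero_mul] at h1
  exact h1.congr fun n => (h.eq_pow n).symm

end IsScale

/-- `Z` lists countably many obstacles, of thickness `δ n i`, that a path `x` has to avoid from time
`n` on in order for its limit to belong to `S`. -/
structure IsObstacleFamily (ρ : ℕ → ℝ) (β γ ε : ℝ) (x₀ : ℝ × ℝ) (S : Set (ℝ × ℝ))
    (Z : ℕ → ℝ × ℝ → ℕ × Bool → Set (ℝ × ℝ)) (δ : ℕ → ℕ × Bool → ℝ) : Prop where
  pos : ∀ n i, 0 < δ n i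
  tsum_le : ∀ n, ∑' i, ENNReal.ofReal ((δ n i / ρ n) ^ γ) ≤ ENNReal.ofReal ε
  flat : ∀ n x i, IsFlatFrom ρ β x₀ n (Z n x i)
  mem : ∀ (x : ℕ → ℝ × ℝ) (z : ℝ × ℝ), (∀ n, x n ∈ closedBall x₀ 2) →
    (∀ n, dist z (x n) ≤ 2 * ρ n) → (∀ n i, ∀ y ∈ Z n (x n) i, β * δ n i < dist z y) → z ∈ S

lemma exists_isObstacleFamily_of_le {f g : ℝ × ℝ → ℝ × ℝ} (hf : ContDiff ℝ 1 f)
    (hg : ContDiff ℝ 1 g) (hgf : Function.LeftInverse g f) (hfg : Function.RightInverse g f)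
    {s t : ℝ} (hs : 0 ≤ s) (hst : s ≤ t) (hst1 : s + t = 1) (x₀ : ℝ × ℝ) {ρ : ℕ → ℝ} {β γ ε : ℝ}
    (hρ : IsScale ρ β) (hγ : 0 < γ) (hε : 0 < ε) :
    ∃ Z δ, IsObstacleFamily ρ β γ ε x₀ (g ⁻¹' badPair s t) Z δ := by
  have hβ := hρ.ratio_pos
  obtain ⟨Λ, hΛ⟩ := hg.contDiffOn.exists_lipschitzOnWith (s := closedBall x₀ 4) one_ne_zero
    (convex_closedBall _ _) (isCompact_closedBall _ _)
  obtain ⟨Λ', hΛ'⟩ := hf.contDiffOn.exists_lipschitzOnWith (s := closedBall (g x₀) (Λ * 4 + 1))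
    one_ne_zero (convex_closedBall _ _) (isCompact_closedBall _ _)
  have hmaps : ∀ z ∈ closedBall x₀ 4, g z ∈ closedBall (g x₀) (Λ * 4) := fun z hz =>
    (hΛ.dist_le_mul z hz x₀ (mem_closedBall_self (by norm_num))).trans (by
      gcongr; exact hz)
  have hlift : ∀ z ∈ closedBall x₀ 4, ∀ v e, dist v (g z) ≤ e → e ≤ 1 → dist z (f v) ≤ Λ' * e := by
    intro z hz v e hv he
    have h1 := mem_closedBall.1 (hmaps z hz)
    have h2 := hΛ'.dist_le_mul (g z) (mem_closedBall.2 (by linarith)) v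
      (mem_closedBall.2 ((dist_triangle v (g z) _).trans (by linarith)))
    rw [hfg z, dist_comm (g z)] at h2
    exact h2.trans (by gcongr)
  obtain ⟨r, hr, hflat⟩ := exists_isLine_infDist_le hf hg hgf hfg x₀ hβ
  obtain ⟨n₀, hn₀⟩ := (hρ.tendsto.eventually_le_const hr).exists
  have hflat' : ∀ n, n₀ ≤ n → ∀ A B C : ℝ, 0 < max |A| |B| →
      IsFlatFrom ρ β x₀ n {y | A * (g y).1 + B * (g y).2 + C = 0} := by
    intro n hn A B C hAB m hm x hx
    obtain ⟨L, hL, h⟩ := hflat (ρ m) (hρ.pos m) ((hρ.antitone (hn.trans hm)).trans hn₀) x hx A B C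
      hAB
    exact ⟨L, hL, fun z hz hzx => h z hzx hz⟩
  obtain ⟨R, hβR⟩ : ∃ R, β * R = 1 := ⟨β⁻¹, mul_inv_cancel₀ hβ.ne'⟩
  have hβ1 : β ≤ 1 := by linarith [hρ.two_mul_ratio_le]
  have hR : 1 ≤ R := by
    by_contra! h
    nlinarith
  set ε₀ : ℝ := β / (32 * (Λ + 1)) with hε₀
  have hε₀0 : 0 < ε₀ := by positivity
  have hε₀1 : ε₀ ≤ 1 := by
    rw [hε₀, div_le_one (by positivity)]
    linarith [Λ.2, (Λ.2 : (0 : ℝ) ≤ (Λ : ℝ))]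
  obtain ⟨H, hH⟩ : ∃ H, H = 2 ^ 17 * R ^ 3 / ε₀ * (4 * R ^ 3) := ⟨_, rfl⟩
  have hR3 : 1 ≤ R ^ 3 := one_le_pow₀ hR
  have hH0 : 4 * R ^ 3 ≤ H := by
    rw [hH]
    refine le_mul_of_one_le_left (by positivity) ?_
    rw [le_div_iff₀ hε₀0]
    linarith
  have hH1 : 0 < H := by linarith
  obtain ⟨D, hD⟩ : ∃ D, D = R * (Λ' + 1) * H := ⟨_, rfl⟩
  have hβD : β * D = (Λ' + 1) * H := by rw [hD, ← mul_assoc, ← mul_assoc, hβR, one_mul]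
  have hD0 : 0 < D := by rw [hD]; positivity
  set Q : ℕ := ⌊1 / ρ n₀ ^ 2⌋₊ with hQ
  obtain ⟨n₁, hn₁, hn₁'⟩ := ((hρ.tendsto.eventually_le_const
    (show 0 < 1 / (8 * ((Q + 1) * (Λ + 1)) : ℝ) by positivity)).and (eventually_ge_atTop n₀)).exists
  obtain ⟨η, hη0, hηb, hηsum⟩ := exists_tsum_rpow_le hD0
    (show 0 < min (min (1 / H) (1 / (32 * R ^ 4))) (ρ n₁ * (1 / 2) ^ Q) by
      have := hρ.pos n₁; positivity) hγ hε
  rw [le_min_iff, le_min_iff] at hηb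
  obtain ⟨⟨hηH, hηR⟩, hηQ⟩ := hηb
  rw [le_div_iff₀ hH1] at hηH
  rw [le_div_iff₀ (by positivity)] at hηR
  have hη1 : η ≤ 1 := by nlinarith
  set c : ℝ := 4 * R ^ 3 * η ^ 2 with hc
  have hc0 : 0 < c := by positivity
  have hcR : c * (8 * R) ≤ 1 := by
    calc c * (8 * R) = η * (η * (32 * R ^ 4)) := by rw [hc]; ring
      _ ≤ 1 * 1 := by gcongr
      _ = 1 := one_mul 1
  have hc8 : c * 8 ≤ 1 := le_trans (by gcongr; linarith) hcR
  set δ : ℕ → ℕ × Bool → ℝ := fun n i => ρ n * (D * η * (1 / 2) ^ i.1) with hδ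
  have hβδ : ∀ n i, β * δ n i = (Λ' + 1) * (H * η * (1 / 2) ^ i.1 * ρ n) := fun n i => by
    calc β * δ n i = β * D * (η * (1 / 2) ^ i.1 * ρ n) := by rw [hδ]; ring
      _ = _ := by rw [hβD]; ring
  classical
  set κ : ℕ → ℝ := fun k => if (1 / 2) ^ k ≤ η then 4 ^ k else 1 with hκ
  have hκ1 : ∀ k, κ k = 1 ∨ κ k = 4 ^ k ∧ 4 * R ^ 3 ≤ c * 4 ^ k := by
    intro k
    by_cases hk : (1 / 2) ^ k ≤ η
    · refine Or.inr ⟨if_pos hk, ?_⟩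
      have h1 : 1 ≤ η * 2 ^ k := by
        rwa [one_div, inv_pow, inv_le_iff_one_le_mul₀ (by positivity)] at hk
      calc 4 * R ^ 3 ≤ 4 * R ^ 3 * (η * 2 ^ k) ^ 2 := le_mul_of_one_le_right (by positivity)
            (one_le_pow₀ h1)
        _ = c * (2 ^ 2) ^ k := by rw [hc, ← pow_mul, mul_comm 2 k, pow_mul]; ring
        _ = _ := by norm_num
    · exact Or.inl (if_neg hk)
  have hκpos : ∀ k, 0 < κ k := fun k => by
    rcases hκ1 k with h | ⟨h, -⟩ <;> rw [h] <;> positivity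
  have hκ4 : ∀ k, κ k ≤ 4 ^ k := fun k => by
    rcases hκ1 k with h | ⟨h, -⟩ <;> rw [h]
    exact one_le_pow₀ (by norm_num)
  have hcκ : ∀ k, c / κ k ≤ 4 * R ^ 3 * (η * (1 / 2) ^ k) := by
    intro k
    by_cases hk : (1 / 2) ^ k ≤ η
    · have h0 : κ k = 4 ^ k := if_pos hk
      have h1 : η * (1 / 2) ^ k ≤ 1 := mul_le_one₀ hη1 (by positivity)
        (pow_le_one₀ (by norm_num) (by norm_num))
      calc c / κ k = 4 * R ^ 3 * ((η * (1 / 2) ^ k) * (η * (1 / 2) ^ k)) := by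
            rw [h0, hc, show (4 : ℝ) = 2 ^ 2 by norm_num, ← pow_mul, mul_comm 2 k, pow_mul]
            rw [one_div, inv_pow]
            field_simp
        _ ≤ 4 * R ^ 3 * ((η * (1 / 2) ^ k) * 1) := by gcongr
        _ = _ := by rw [mul_one]
    · have h0 : κ k = 1 := if_neg hk
      push Not at hk
      rw [h0, div_one, hc, sq]
      gcongr
  have hsub : ∀ n, ∀ x ∈ closedBall x₀ 2, ∀ z, dist z x ≤ 2 * ρ n → z ∈ closedBall x₀ 4 := by
    intro n x hx z hz
    have := hρ.le_one n
    have := dist_triangle z x x₀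
    rw [mem_closedBall] at hx ⊢
    linarith
  have hlarge : ∀ n x k, ∃ Z, IsFlatFrom ρ β x₀ n Z ∧ (n₀ ≤ n → x ∈ closedBall x₀ 2 →
      ∀ z, dist z x ≤ 2 * ρ n → ∀ (q : ℕ) (p r' A B C : ℤ), IsLineOfClass s t k q p r' A B C →
      β * (ε₀ * 256 ^ k * κ k / ρ n) < (q : ℝ) ^ (1 + t) →
      (q : ℝ) ^ (1 + t) ≤ ε₀ * 256 ^ k * κ k / ρ n → InBox c s t q p r' (g z) →
      (∃ y ∈ Z, dist z y ≤ β * δ n (k, false)) ∨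
        ∃ q₀ : ℕ, 0 < q₀ ∧ q₀ < q ∧ ∃ p₀ r₀ : ℤ, InBox c s t q₀ p₀ r₀ (g z)) := by
    intro n x k
    by_cases hex : n₀ ≤ n ∧ x ∈ closedBall x₀ 2 ∧ ∃ z, dist z x ≤ 2 * ρ n ∧
      ∃ (q : ℕ) (p r' A B C : ℤ), IsLineOfClass s t k q p r' A B C ∧
      β * (ε₀ * 256 ^ k * κ k / ρ n) < (q : ℝ) ^ (1 + t) ∧
      (q : ℝ) ^ (1 + t) ≤ ε₀ * 256 ^ k * κ k / ρ n ∧ InBox c s t q p r' (g z)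
    · obtain ⟨hn, hx, z₁, hz₁, q₁, p₁, r₁, A, B, C, hL, hq1, hq2, hbox⟩ := hex
      refine ⟨_, hflat' n hn A B C hL.max_pos,
          fun _ _ z hz q p r' A' B' C' hL' hq1' hq2' hbox' => ?_⟩
      have hz4 := hsub n x hx z hz
      have hz₁4 := hsub n x hx z₁ hz₁
      have hww : dist (g z) (g z₁) ≤ Λ * (4 * ρ n) := by
        refine (hΛ.dist_le_mul z hz4 z₁ hz₁4).trans ?_
        gcongr
        have := dist_triangle_right z z₁ x
        linarith
      have hd : Λ * (4 * ρ n) * ε₀ * (8 * R) ≤ ρ n := by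
        have h0 := hρ.pos n
        calc Λ * (4 * ρ n) * ε₀ * (8 * R) = ρ n * (β * R) * (Λ / (Λ + 1)) := by
              rw [hε₀]; field_simp; ring
          _ ≤ ρ n * (β * R) * 1 := by
              rw [hβR]
              gcongr
              exact (div_le_one (by positivity)).2 (by linarith)
          _ = ρ n := by rw [hβR]; ring
      refine (hL.exists_near_or_inBox hs hst hst1 hL' hβR hR hc0 hcR (hκ1 k) (hρ.pos n) hε₀0 hd hq1
        hq2 hq1' hq2' hbox hbox' hww).imp_left ?_
      rintro ⟨v, hv, hvz⟩
      have h0 := hρ.pos n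
      have hvz' : dist v (g z) ≤ H * η * (1 / 2) ^ k * ρ n := by
        refine hvz.trans ?_
        calc _ ≤ 2 ^ 17 * R ^ 3 / ε₀ * (4 * R ^ 3 * (η * (1 / 2) ^ k)) * ρ n := by
              gcongr; exact hcκ k
          _ = _ := by rw [hH]; ring
      refine ⟨f v, by simpa only [mem_ofPred_eq, hgf v] using hv, ?_⟩
      refine (hlift z hz4 v _ hvz' ?_).trans ?_
      · refine mul_le_one₀ (mul_le_one₀ (by linarith) (by positivity)
          (pow_le_one₀ (by norm_num) (by norm_num))) h0.le (hρ.le_one n)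
      · rw [hβδ]
        gcongr
        linarith
    · refine ⟨∅, isFlatFrom_empty, fun hn hx z hz q p r' A B C h1 h2 h3 h4 => ?_⟩
      exact absurd ⟨hn, hx, z, hz, q, p, r', A, B, C, h1, h2, h3, h4⟩ hex
  have hsmall : ∀ n x q, ∃ Z, IsFlatFrom ρ β x₀ n Z ∧ (n = n₁ → x ∈ closedBall x₀ 2 →
      ∀ z, dist z x ≤ 2 * ρ n → 0 < q → q ≤ Q → ∀ p r' : ℤ, InBox c s t q p r' (g z) →
      ∃ y ∈ Z, dist z y ≤ β * δ n (q, true)) := by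
    intro n x q
    by_cases hex : n = n₁ ∧ 0 < q
    · obtain ⟨rfl, hq⟩ := hex
      have hq0 : (1 : ℝ) ≤ q := by exact_mod_cast hq
      refine ⟨_, hflat' n hn₁' q 0 (-round (q * (g x).1)) (by simpa using hq),
        fun _ hx z hz _ hqQ p r' hbox => ?_⟩
      have hz4 := hsub n x hx z hz
      have hx4 := hsub n x hx x (by rw [dist_self]; linarith [hρ.pos n])
      have hqQ' : (q : ℝ) ≤ Q := by exact_mod_cast hqQ
      have hw : |q * (g z).1 - p| ≤ c := by
        refine le_trans (le_mul_of_one_le_right (abs_nonneg _) ?_) hbox.1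
        exact Real.one_le_rpow hq0 hs
      have hgx : |(g x).1 - (g z).1| ≤ Λ * (2 * ρ n) := by
        have h1 := hΛ.dist_le_mul z hz4 x hx4
        rw [dist_comm, Prod.dist_eq, Real.dist_eq] at h1
        exact (le_max_left _ _).trans (h1.trans (by gcongr))
      have hqgx : |q * (g x).1 - q * (g z).1| ≤ 1 / 4 := by
        rw [← mul_sub, abs_mul, Nat.abs_cast]
        rw [le_div_iff₀ (by positivity)] at hn₁
        calc (q : ℝ) * |(g x).1 - (g z).1| ≤ (Q + 1) * ((Λ + 1) * (2 * ρ n)) := by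
              have := hρ.pos n
              gcongr
              · linarith
              · exact hgx.trans (by gcongr; linarith)
          _ = ρ n * (8 * ((Q + 1) * (Λ + 1))) / 4 := by ring
          _ ≤ _ := by linarith
      have hp : p = round (q * (g x).1) := by
        refine sub_eq_zero.1 (Int.eq_zero_of_abs_cast_lt_one ?_)
        have h1 := abs_sub_round (q * (g x).1 : ℝ)
        rw [abs_le] at hw hqgx h1
        push_cast
        rw [abs_lt]
        constructor <;> linarith
      have hq0' : (q : ℝ) ≠ 0 := by positivity
      have hv : dist ((p / q : ℝ), (g z).2) (g z) ≤ c := by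
        rw [Prod.dist_eq, dist_self, Real.dist_eq]
        refine max_le ?_ hc0.le
        have h2 : (q : ℝ) * |p / q - (g z).1| ≤ c := by
          have h3 : (q : ℝ) * (p / q - (g z).1) = p - q * (g z).1 := by field_simp
          have h4 := abs_mul (q : ℝ) (p / q - (g z).1)
          rw [Nat.abs_cast, h3, abs_sub_comm] at h4
          rwa [← h4]
        exact (le_mul_of_one_le_left (abs_nonneg _) hq0).trans h2
      refine ⟨f (p / q, (g z).2), ?_, (hlift z hz4 _ _ hv (by linarith)).trans ?_⟩
      · simp only [mem_ofPred_eq, hgf _, hp]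
        field_simp
        ring
      · have h0 := hρ.pos n
        rw [hβδ]
        calc Λ' * c ≤ (Λ' + 1) * c := by gcongr; linarith
          _ = (Λ' + 1) * (4 * R ^ 3 * η * η) := by rw [hc]; ring
          _ ≤ (Λ' + 1) * (H * η * (ρ n * (1 / 2) ^ Q)) := by gcongr
          _ ≤ (Λ' + 1) * (H * η * (ρ n * (1 / 2) ^ q)) := by
            have : (1 / 2 : ℝ) ^ Q ≤ (1 / 2) ^ q :=
              pow_le_pow_of_le_one (by norm_num) (by norm_num) hqQ
            gcongr
          _ = _ := by ring
    · exact ⟨∅, isFlatFrom_empty, fun hn _ _ _ hq => absurd ⟨hn, hq⟩ hex⟩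
  choose Z₁ hZ₁ hZ₁' using hlarge
  choose Z₂ hZ₂ hZ₂' using hsmall
  refine ⟨fun n x i => if i.2 then Z₂ n x i.1 else Z₁ n x i.1, δ, fun n i => ?_, fun n => ?_,
    ?_, ?_⟩
  · have := hρ.pos n
    positivity
  · refine le_of_eq_of_le (tsum_congr fun i => ?_) hηsum
    rw [hδ]
    simp only []
    rw [mul_div_cancel_left₀ _ (hρ.pos n).ne']
  · rintro n x ⟨k, b⟩
    cases b
    exacts [hZ₁ n x k, hZ₂ n x k]
  · intro x z hx hz hZ
    by_contra hbad
    have hex := exists_inBox_of_notMem_badPair hbad hc0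
    obtain ⟨hq, p, r', hbox⟩ := Nat.find_spec hex
    have hmin := fun m => Nat.find_min hex (m := m)
    set q := Nat.find hex
    rcases le_or_gt q Q with hqQ | hqQ
    · obtain ⟨y, hy, hzy⟩ := hZ₂' n₁ (x n₁) q rfl (hx n₁) z (hz n₁) hq hqQ p r' hbox
      exact (hZ n₁ (q, true) y hy).not_ge hzy
    · obtain ⟨k, A, B, C, hL⟩ := exists_isLineOfClass hst hst1 hq p r'
      have hq' : (0 : ℝ) < q := by exact_mod_cast hq
      have h256 : (256 : ℝ) ^ k = (4 ^ k) ^ 4 := by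
        rw [← pow_mul, mul_comm, pow_mul]; norm_num
      obtain ⟨n, hn, h1, h2⟩ := exists_window (ρ := ρ) (n₀ := n₀) (G := 4 ^ k) hq'
        (h256 ▸ hL.pow_le_rpow) (by positivity) (by linarith) hε₀0 hβ
        (mul_le_one₀ hβ1 hε₀0.le hε₀1) (hκpos k) (hκ4 k) hρ.pos (hρ.le_one n₀) hρ.succ
        hρ.tendsto (by
          have := hρ.pos n₀
          rw [← div_lt_iff₀ (by positivity)]
          exact Nat.lt_of_floor_lt hqQ)
      rw [← h256] at h1 h2
      rcases hZ₁' n (x n) k hn (hx n) z (hz n) q p r' A B C hL h1 h2 hbox with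
        ⟨y, hy, hzy⟩ | ⟨q₀, hq₀, hlt, hbox₀⟩
      · exact (hZ n (k, false) y hy).not_ge hzy
      · exact hmin q₀ hlt ⟨hq₀, hbox₀⟩

lemma exists_isObstacleFamily {f g : ℝ × ℝ → ℝ × ℝ} (hf : ContDiff ℝ 1 f)
    (hg : ContDiff ℝ 1 g) (hgf : Function.LeftInverse g f) (hfg : Function.RightInverse g f)
    {s t : ℝ} (hs : 0 ≤ s) (ht : 0 ≤ t) (hst : s + t = 1) (x₀ : ℝ × ℝ) {ρ : ℕ → ℝ} {β γ ε : ℝ}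
    (hρ : IsScale ρ β) (hγ : 0 < γ) (hε : 0 < ε) :
    ∃ Z δ, IsObstacleFamily ρ β γ ε x₀ (g ⁻¹' badPair s t) Z δ := by
  rcases le_total s t with h | h
  · exact exists_isObstacleFamily_of_le hf hg hgf hfg hs h hst x₀ hρ hγ hε
  · have hswap : ContDiff ℝ 1 (Prod.swap : ℝ × ℝ → ℝ × ℝ) := contDiff_snd.prodMk contDiff_fst
    obtain ⟨Z, δ, hZ⟩ := exists_isObstacleFamily_of_le (hf.comp hswap) (hswap.comp hg)
      (fun x => by simp [hgf x.swap]) (fun x => by simp [hfg x]) ht h (by linarith) x₀ hρ hγ hε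
    exact ⟨Z, δ, hZ.pos, hZ.tsum_le, hZ.flat, fun x z h1 h2 h3 =>
      swap_mem_badPair (hZ.mem x z h1 h2 h3)⟩

end

section
open MeasureTheory ENNReal NNReal Topology Set

lemma exists_cover_of_hausdorffMeasure_eq_zero {X : Type*} [MetricSpace X] [MeasurableSpace X]
    [BorelSpace X] {T : Set X} {e r : ℝ} (he : 0 < e) (hr : 0 < r) (hT : μH[e] T = 0)
    {ε : ℝ≥0∞} (hε : ε ≠ 0) :
    ∃ (U : ℕ → Set X) (d : ℕ → ℝ), T ⊆ ⋃ i, U i ∧ (∀ i, 0 < d i) ∧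
      (∀ i, ∀ u ∈ U i, ∀ v ∈ U i, dist u v ≤ d i) ∧
      ∑' i, ENNReal.ofReal ((d i / r) ^ e) ≤ ε := by
  set a : ℝ≥0∞ := ENNReal.ofReal (r ^ e) with ha
  have ha0 : a ≠ 0 := by simp only [ha, ne_eq, ofReal_eq_zero, not_le]; positivity
  have hb : ε * a / 2 ≠ 0 := by
    refine (ENNReal.div_pos (mul_ne_zero hε ha0) (by simp)).ne'
  obtain ⟨η, hη, hηsum⟩ := ENNReal.exists_pos_sum_of_countable hb ℕ
  have h1 := Measure.hausdorffMeasure_apply e T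
  rw [hT] at h1
  have h2 : (⨅ (t : ℕ → Set X) (_ : T ⊆ ⋃ n, t n) (_ : ∀ n, ediam (t n) ≤ 1),
      ∑' n, ⨆ _ : (t n).Nonempty, ediam (t n) ^ e) < ε * a / 2 := by
    refine lt_of_le_of_lt ?_ (pos_iff_ne_zero.2 hb)
    rw [h1]
    exact le_iSup₂ (f := fun (r : ℝ≥0∞) (_ : 0 < r) => ⨅ (t : ℕ → Set X) (_ : T ⊆ ⋃ n, t n)
      (_ : ∀ n, ediam (t n) ≤ r), ∑' n, ⨆ _ : (t n).Nonempty, ediam (t n) ^ e) 1 zero_lt_one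
  simp only [iInf_lt_iff] at h2
  obtain ⟨U, hTU, hU1, hUsum⟩ := h2
  have hUtop : ∀ i, ediam (U i) ≠ ⊤ := fun i => ((hU1 i).trans_lt one_lt_top).ne
  have hpos : ∀ i, 0 < (ediam (U i)).toReal ^ e + η i := fun i =>
    add_pos_of_nonneg_of_pos (by positivity) (hη i)
  refine ⟨U, fun i => ((ediam (U i)).toReal ^ e + η i) ^ e⁻¹, hTU, fun i => by
    have := hpos i; positivity, fun i u hu v hv => ?_, ?_⟩
  · calc dist u v ≤ (ediam (U i)).toReal := by
          rw [dist_edist]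
          exact ENNReal.toReal_mono (hUtop i) (edist_le_ediam_of_mem hu hv)
      _ = ((ediam (U i)).toReal ^ e) ^ e⁻¹ := by
          rw [Real.rpow_rpow_inv toReal_nonneg he.ne']
      _ ≤ _ := by
          refine Real.rpow_le_rpow (by positivity) ?_ (by positivity)
          linarith [hη i, show (0 : ℝ) < η i from hη i]
  · have hterm : ∀ i, ENNReal.ofReal ((((ediam (U i)).toReal ^ e + η i) ^ e⁻¹ / r) ^ e) ≤
        ((⨆ _ : (U i).Nonempty, ediam (U i) ^ e) + η i) * a⁻¹ := by
      intro i
      rw [Real.div_rpow (by have := hpos i; positivity) hr.le,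
        Real.rpow_inv_rpow (hpos i).le he.ne',
        ENNReal.ofReal_div_of_pos (by positivity), div_eq_mul_inv,
        ENNReal.ofReal_add (by positivity) (by positivity), ofReal_coe_nnreal]
      gcongr
      rw [← ENNReal.ofReal_rpow_of_nonneg toReal_nonneg he.le, ENNReal.ofReal_toReal (hUtop i)]
      rcases (U i).eq_empty_or_nonempty with h | h
      · simp [h, he]
      · exact le_iSup (fun _ : (U i).Nonempty => ediam (U i) ^ e) h
    calc _ ≤ ∑' i, ((⨆ _ : (U i).Nonempty, ediam (U i) ^ e) + η i) * a⁻¹ :=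
          ENNReal.tsum_le_tsum hterm
      _ = (∑' i, (⨆ _ : (U i).Nonempty, ediam (U i) ^ e) + ∑' i, (η i : ℝ≥0∞)) * a⁻¹ := by
          rw [ENNReal.tsum_mul_right, ENNReal.tsum_add]
      _ ≤ (ε * a / 2 + ε * a / 2) * a⁻¹ := by gcongr
      _ = ε := by
          rw [ENNReal.add_halves, mul_assoc, ENNReal.mul_inv_cancel ha0 ofReal_ne_top, mul_one]

/-- A limit of points at which the potential of an obstacle is at most one avoids the obstacle. -/
lemma lt_dist_of_obstaclePotential_le {X : Type*} [PseudoMetricSpace X] {ρ : ℕ → ℝ} {β e δ : ℝ}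
    {τ : ℝ≥0∞} {Z : Set X} {x : ℕ → X} {z : X} {m : ℕ} (hρ : IsScale ρ β) (he : 0 < e)
    (hδ : 0 < δ) (hδm : δ ≤ ρ m) (hτ : τ ≤ 1) (hz : ∀ n, dist z (x n) ≤ 2 * ρ n)
    (h : ∀ n, m ≤ n → obstaclePotential ρ e Z δ n (x n) ≤ τ) :
    ∀ y ∈ Z, β * δ < dist z y := by
  classical
  intro y hy
  have hex : ∃ n, ρ n < δ := (hρ.tendsto.eventually (gt_mem_nhds hδ)).exists
  have hspec := Nat.find_spec hex
  have hmn : m < Nat.find hex := by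
    by_contra hc
    push Not at hc
    linarith [hρ.antitone hc]
  obtain ⟨n, hn⟩ : ∃ n, Nat.find hex = n + 1 := ⟨Nat.find hex - 1, by omega⟩
  have hmin : δ ≤ ρ n := not_lt.1 (Nat.find_min hex (m := n) (by omega))
  rw [hn] at hspec hmn
  have hβ := hρ.ratio_pos
  have hle : β * δ ≤ ρ (n + 1) := by rw [hρ.succ]; gcongr
  have hnot : ¬ infEDist (x (n + 1)) Z ≤ ENNReal.ofReal (3 * ρ (n + 1)) := by
    intro hc
    have h1 := h (n + 1) hmn.le
    rw [obstaclePotential, indicator_of_mem (by exact hc)] at h1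
    have h2 := h1.trans hτ
    rw [ENNReal.ofReal_le_one] at h2
    exact absurd h2 (not_le.2 (Real.one_lt_rpow ((one_lt_div (hρ.pos _)).2 hspec) he))
  rw [not_le] at hnot
  have h3 := hnot.trans_le (infEDist_le_edist_of_mem hy)
  rw [edist_dist, ENNReal.ofReal_lt_ofReal_iff_of_nonneg (by linarith [hρ.pos (n + 1)])] at h3
  have := dist_triangle_left (x (n + 1)) y z
  linarith [hz (n + 1)]

lemma IsScale.exists_tendsto {X : Type*} [MetricSpace X] [CompleteSpace X] {ρ : ℕ → ℝ} {β : ℝ}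
    (hρ : IsScale ρ β) {x : ℕ → X} (h : ∀ n, dist (x (n + 1)) (x n) ≤ ρ n) :
    ∃ z, Tendsto x atTop (𝓝 z) ∧ ∀ n, dist z (x n) ≤ 2 * ρ n := by
  have hβ : β ≤ 1 / 2 := by linarith [hρ.two_mul_ratio_le]
  have hu : ∀ n, dist (x n) (x (n + 1)) ≤ ρ 0 * β ^ n := fun n => by
    rw [dist_comm, mul_comm, ← hρ.eq_pow]
    exact h n
  obtain ⟨z, hz⟩ := cauchySeq_tendsto_of_complete
    (cauchySeq_of_le_geometric β (ρ 0) (by linarith) hu)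
  refine ⟨z, hz, fun n => ?_⟩
  have h1 := dist_le_of_le_geometric_of_tendsto β (ρ 0) (by linarith) hu hz n
  rw [dist_comm]
  refine h1.trans ?_
  rw [mul_comm (ρ 0), ← hρ.eq_pow, div_le_iff₀ (by linarith)]
  nlinarith [hρ.pos n]

end

section
open MeasureTheory ENNReal NNReal Topology Set

/-- Winning strategy: a regular hyperplane diffuse set contains a point that avoids a given null set
and belongs to countably many sets whose complements are described by obstacles. -/
lemma AhlforsRegularOn.exists_mem_of_isObstacleFamily {μ : Measure (ℝ × ℝ)} {K T : Set (ℝ × ℝ)}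
    {α C r₀ β₀ β γ e : ℝ} {θ : ℝ≥0∞} (h : AhlforsRegularOn μ K α C r₀) (hC : 1 ≤ C)
    (hKcl : IsClosed K) (hK : μ Kᶜ = 0) (hβ₀ : 0 < β₀) (hβ₀' : β₀ ≤ 1)
    (hdiff : ∀ x ∈ K, ∀ ρ : ℝ, 0 < ρ → ρ ≤ r₀ → ∀ L : AffineSubspace ℝ (ℝ × ℝ), IsLine L →
      ∃ y ∈ K, y ∈ closedBall x ρ ∧ β₀ * ρ < Metric.infDist y (L : Set (ℝ × ℝ)))
    {ρ : ℕ → ℝ} (hρ : IsScale ρ β) (hρr : ρ 0 ≤ r₀) (hβ : 20 * β ≤ β₀) (he : 0 < e) (hγ : 0 < γ)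
    (hθ : θ < 1) (hθe : ENNReal.ofReal (C ^ 2 * (9 * β) ^ α) * ENNReal.ofReal (β ^ (-e)) ≤ θ)
    (hθγ : (1 - ENNReal.ofReal ((C ^ 2)⁻¹ * (β₀ / 4) ^ α)) * ENNReal.ofReal (β ^ (-γ)) ≤ θ)
    (hT : μH[e] T = 0) {x₀ : ℝ × ℝ} (hx₀ : x₀ ∈ K) {S : ℕ → Set (ℝ × ℝ)}
    (hS : ∀ j, ∀ ε : ℝ, 0 < ε → ∃ Z δ, IsObstacleFamily ρ β γ ε x₀ (S j) Z δ) :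
    ∃ z ∈ K, z ∉ T ∧ ∀ j, z ∈ S j := by
  have hβ0 := hρ.ratio_pos
  have hβ1 : β ≤ 1 := by linarith
  set τ : ℝ≥0∞ := ENNReal.ofReal (β ^ e) with hτdef
  have hτ0 : τ ≠ 0 := by
    simp only [hτdef, ne_eq, ofReal_eq_zero, not_le]
    positivity
  have hτ1 : τ ≤ 1 := by
    rw [hτdef, ENNReal.ofReal_le_one]
    exact Real.rpow_le_one hβ0.le hβ1 he.le
  set b : ℝ≥0∞ := (1 - θ) * τ / 2 with hbdef
  have hb0 : b ≠ 0 := (ENNReal.div_pos (mul_ne_zero (tsub_pos_of_lt hθ).ne' hτ0) (by simp)).ne'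
  have hb1 : b ≤ 1 := by
    calc b ≤ (1 - θ) * τ := ENNReal.half_le_self
      _ ≤ 1 * 1 := mul_le_mul' tsub_le_self hτ1
      _ = 1 := one_mul 1
  obtain ⟨ε, hε, hεsum⟩ := ENNReal.exists_pos_sum_of_countable hb0 ℕ
  obtain ⟨U, d, hTU, hd, hUd, hUsum⟩ :=
    exists_cover_of_hausdorffMeasure_eq_zero he (hρ.pos 0) hT hb0
  choose Z δ hZ using fun j => hS j (ε j) (hε j)
  have le_of_ofReal_le : ∀ {a r c : ℝ}, 0 < r → 0 < c → ENNReal.ofReal ((a / r) ^ c) ≤ 1 →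
      a ≤ r := by
    intro a r c hr hc hle
    by_contra hlt
    push Not at hlt
    rw [ENNReal.ofReal_le_one] at hle
    exact absurd hle (not_le.2 (Real.one_lt_rpow ((one_lt_div hr).2 hlt) hc))
  have hδle : ∀ j n i, δ j n i ≤ ρ n := fun j n i => by
    refine le_of_ofReal_le (hρ.pos n) hγ ?_
    calc _ ≤ ENNReal.ofReal (ε j) := (ENNReal.le_tsum i).trans ((hZ j).tsum_le n)
      _ = ε j := ofReal_coe_nnreal
      _ ≤ 1 := (ENNReal.le_tsum j).trans (hεsum.le.trans hb1)
  have hdle : ∀ i, d i ≤ ρ 0 := fun i =>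
    le_of_ofReal_le (hρ.pos 0) he ((ENNReal.le_tsum i).trans (hUsum.trans hb1))
  set A : ℕ → Set (ℝ × ℝ) := fun m => K ∩ closedBall x₀ (2 * ρ 0 - 2 * ρ m) with hAdef
  have hA2 : ∀ m, A m ⊆ closedBall x₀ 2 := fun m x hx =>
    closedBall_subset_closedBall (by linarith [hρ.pos m, hρ.zero_le_one]) hx.2
  have hρr' : ∀ m, ρ m ≤ r₀ := fun m => (hρ.antitone (Nat.zero_le m)).trans hρr
  let φ : ℕ → ℝ × ℝ → ℕ → ℝ × ℝ → ℝ≥0∞ := fun m x n y =>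
    (∑' j, ∑' i, obstaclePotential ρ γ (Z j m x i) (δ j m i) n y) +
      ∑' i, obstaclePotential ρ e (if m = 0 then U i else ∅) (d i) n y
  obtain ⟨x, hxA, hxdist, hxφ⟩ := IsContracting.exists_path (μ := μ) (A := A) (ρ := ρ) (τ := τ)
    (θ := θ) (x₀ := x₀) (fun m x hx => h.measure_closedBall_ne_zero hC hx.1 (hρ.pos m) (hρr' m))
    (fun m x hx => h.measure_closedBall_ne_top hx.1 (hρ.pos m) (hρr' m))
    (fun m x hx => by
      have hKae : ∀ᵐ y ∂μ, y ∈ K := hK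
      filter_upwards [hKae] with y hyK hy
      refine ⟨hyK, ?_⟩
      have h1 := hx.2
      rw [mem_closedBall] at h1 hy ⊢
      have := dist_triangle y x x₀
      rw [hρ.succ]
      nlinarith [hρ.two_mul_ratio_le, hρ.pos m]) hθ.le φ
    (fun m x _ => by
      refine .add (.tsum fun j => .tsum fun i => ?_) (.tsum fun i => ?_)
      · refine obstaclePotential_isContracting hβ0 (by linarith) hρ.pos hρ.succ ((hZ j).pos m i)
          hθγ fun k hk y hy _ => ?_
        obtain ⟨L, hL, hLZ⟩ := (hZ j).flat m x i k hk y (hA2 k hy)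
        exact measure_near_line_le h hC hβ₀ hβ₀' hdiff hy.1 (hρ.pos k) (hρr' k) hβ0 hβ hL hLZ
      · refine obstaclePotential_isContracting hβ0 (by linarith) hρ.pos hρ.succ (hd i)
          hθe fun k hk y hy hτk => ?_
        refine h.measure_near_small_le hC hK hy.1 (hρ.pos k) (hρr' k) hβ0 (by linarith)
          fun u hu v hv => ?_
        have hdk : d i ≤ β * ρ k := by
          rw [hτdef, ENNReal.ofReal_le_ofReal_iff (by positivity),
            Real.rpow_le_rpow_iff (div_pos (hd i) (hρ.pos k)).le hβ0.le he,
            div_le_iff₀ (hρ.pos k)] at hτk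
          exact hτk
        split_ifs at hu hv
        · exact (hUd i u hu v hv).trans hdk
        · exact hu.elim)
    (fun m x _ => by
      calc φ m x m x ≤ (∑' j, (ε j : ℝ≥0∞)) + b := by
            refine add_le_add (ENNReal.tsum_le_tsum fun j => ?_) ?_
            · rw [← ofReal_coe_nnreal]
              exact (ENNReal.tsum_le_tsum fun i => obstaclePotential_le _ _ _ _ _ _).trans
                ((hZ j).tsum_le m)
            · by_cases hm : m = 0
              · subst hm
                exact (ENNReal.tsum_le_tsum fun i => obstaclePotential_le _ _ _ _ _ _).trans hUsum
              · simp [hm, obstaclePotential, ENNReal.mul_eq_top]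
        _ ≤ b + b := by gcongr
        _ = (1 - θ) * τ := ENNReal.add_halves _)
    (show x₀ ∈ A 0 from ⟨hx₀, by simp⟩)
  obtain ⟨z, hz, hzd⟩ := hρ.exists_tendsto hxdist
  refine ⟨z, hKcl.mem_of_tendsto hz (Eventually.of_forall fun n => (hxA n).1), fun hzT => ?_,
    fun j => (hZ j).mem x z (fun n => hA2 n (hxA n)) hzd fun n i => ?_⟩
  · obtain ⟨i, hi⟩ := mem_iUnion.1 (hTU hzT)
    have := lt_dist_of_obstaclePotential_le (m := 0) hρ he (hd i) (hdle i) hτ1 hzd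
      (fun n hn => (ENNReal.le_tsum (f := fun i => obstaclePotential ρ e
        (if 0 = 0 then U i else ∅) (d i) n (x n)) i).trans (le_add_self.trans (hxφ 0 n hn))) z
      (by simpa using hi)
    rw [dist_self] at this
    exact absurd this (not_lt.2 (mul_pos hβ0 (hd i)).le)
  · exact lt_dist_of_obstaclePotential_le hρ hγ ((hZ j).pos n i) (hδle j n i) hτ1 hzd
      fun k hk => (ENNReal.le_tsum (f := fun i => obstaclePotential ρ γ (Z j n (x n) i) (δ j n i) k
        (x k)) i).trans ((ENNReal.le_tsum (f := fun j => ∑' i, obstaclePotential ρ γ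
        (Z j n (x n) i) (δ j n i) k (x k)) j).trans (le_self_add.trans (hxφ n k hk)))

/-- Suitable parameters for `AhlforsRegularOn.exists_mem_of_isObstacleFamily`. -/
lemma exists_ratio_and_exponent {α e C β₀ : ℝ} (hα : 0 < α) (he : e < α) (hC : 1 ≤ C) (hβ₀ : 0 < β₀)
    (hβ₀' : β₀ ≤ 1) :
    ∃ β γ : ℝ, ∃ θ : ℝ≥0∞, 0 < β ∧ 20 * β ≤ β₀ ∧ 0 < γ ∧ θ < 1 ∧
      ENNReal.ofReal (C ^ 2 * (9 * β) ^ α) * ENNReal.ofReal (β ^ (-e)) ≤ θ ∧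
      (1 - ENNReal.ofReal ((C ^ 2)⁻¹ * (β₀ / 4) ^ α)) * ENNReal.ofReal (β ^ (-γ)) ≤ θ := by
  set p : ℝ := (C ^ 2)⁻¹ * (β₀ / 4) ^ α with hp
  have hp0 : 0 < p := by positivity
  have hp1 : p < 1 := by
    have h1 : (C ^ 2)⁻¹ ≤ 1 := inv_le_one_of_one_le₀ (by nlinarith)
    have h2 : (β₀ / 4) ^ α < 1 := Real.rpow_lt_one (by positivity) (by linarith) hα
    have h3 : (0 : ℝ) ≤ (β₀ / 4) ^ α := by positivity
    nlinarith
  obtain ⟨β, ⟨hβ1, hβ2⟩, hβ0⟩ : ∃ β : ℝ,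
      (20 * β ≤ β₀ ∧ C ^ 2 * 9 ^ α * β ^ (α - e) ≤ 1 / 2) ∧ 0 < β := by
    have h1 : Tendsto (fun β : ℝ => C ^ 2 * 9 ^ α * β ^ (α - e)) (𝓝[>] 0) (𝓝 0) := by
      have h2 : Tendsto (fun β : ℝ => β ^ (α - e)) (𝓝[>] 0) (𝓝 0) := by
        have := (Real.continuousAt_rpow_const 0 (α - e) (Or.inr (by linarith))).tendsto
        rw [Real.zero_rpow (by linarith)] at this
        exact this.mono_left nhdsWithin_le_nhds
      simpa using h2.const_mul (C ^ 2 * 9 ^ α)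
    have h3 : ∀ᶠ β : ℝ in 𝓝[>] 0, β < β₀ / 20 :=
      nhdsWithin_le_nhds (gt_mem_nhds (by positivity))
    obtain ⟨β, hβ⟩ := ((h3.and (h1.eventually (ge_mem_nhds (show (0 : ℝ) < 1 / 2 by norm_num)))).and
      self_mem_nhdsWithin).exists
    exact ⟨β, ⟨by linarith [hβ.1.1], hβ.1.2⟩, hβ.2⟩
  obtain ⟨γ, hγ, hγ0⟩ : ∃ γ : ℝ, (1 - p) * β ^ (-γ) ≤ 1 - p / 2 ∧ 0 < γ := by
    have h1 : Tendsto (fun γ : ℝ => (1 - p) * β ^ (-γ)) (𝓝[>] 0) (𝓝 (1 - p)) := by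
      have h2 : Continuous fun γ : ℝ => (1 - p) * β ^ (-γ) :=
        continuous_const.mul (continuous_const.rpow continuous_neg fun _ => Or.inl hβ0.ne')
      simpa using (h2.tendsto 0).mono_left nhdsWithin_le_nhds
    obtain ⟨γ, hγ⟩ := ((h1.eventually (ge_mem_nhds (show 1 - p < 1 - p / 2 by linarith))).and
      self_mem_nhdsWithin).exists
    exact ⟨γ, hγ.1, hγ.2⟩
  refine ⟨β, γ, ENNReal.ofReal (1 - p / 2), hβ0, hβ1, hγ0, ?_, ?_, ?_⟩
  · rw [ENNReal.ofReal_lt_one]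
    linarith
  · rw [← ENNReal.ofReal_mul (by positivity)]
    refine ENNReal.ofReal_le_ofReal ?_
    rw [Real.mul_rpow (by norm_num) hβ0.le]
    calc _ = C ^ 2 * 9 ^ α * (β ^ α * β ^ (-e)) := by ring
      _ = C ^ 2 * 9 ^ α * β ^ (α - e) := by rw [← Real.rpow_add hβ0, sub_eq_add_neg]
      _ ≤ _ := by linarith
  · rw [← ENNReal.ofReal_one, ← ENNReal.ofReal_sub _ hp0.le, ← ENNReal.ofReal_mul (by linarith)]
    exact ENNReal.ofReal_le_ofReal hγ

/-- The radii below which a set as in `dimH_inter_fractal` is regular and diffuse. -/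
lemma HyperplaneDiffuse.exists_ahlforsRegularOn {K : Set (ℝ × ℝ)} (hKdiff : HyperplaneDiffuse K)
    (hne : K.Nonempty) {μ : Measure (ℝ × ℝ)} {α C : ℝ}
    (hreg : ∀ x ∈ K, ∀ r : ℝ, 0 < r →
      ((Bornology.IsBounded K ∧ r ≤ Metric.diam K) ∨ (¬ Bornology.IsBounded K ∧ r ≤ 1)) →
      ENNReal.ofReal (C⁻¹ * r ^ α) ≤ μ (closedBall x r) ∧
        μ (closedBall x r) ≤ ENNReal.ofReal (C * r ^ α)) :
    ∃ β₀ r₀ : ℝ, 0 < β₀ ∧ β₀ ≤ 1 ∧ 0 < r₀ ∧ r₀ ≤ 1 ∧ AhlforsRegularOn μ K α C r₀ ∧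
      ∀ x ∈ K, ∀ ρ : ℝ, 0 < ρ → ρ ≤ r₀ → ∀ L : AffineSubspace ℝ (ℝ × ℝ), IsLine L →
        ∃ y ∈ K, y ∈ closedBall x ρ ∧ β₀ * ρ < Metric.infDist y (L : Set (ℝ × ℝ)) := by
  obtain ⟨β₁, hβ₁, r₁, hr₁, hdiff⟩ := hKdiff
  have hdiff' : ∀ x ∈ K, ∀ ρ : ℝ, 0 < ρ → ρ ≤ r₁ → ∀ L : AffineSubspace ℝ (ℝ × ℝ), IsLine L →
      ∃ y ∈ K, y ∈ closedBall x ρ ∧ min β₁ 1 * ρ < Metric.infDist y (L : Set (ℝ × ℝ)) := by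
    intro x hx ρ hρ hρr L hL
    obtain ⟨y, hy, hyx, hyL⟩ := hdiff x hx ρ hρ hρr L hL
    exact ⟨y, hy, hyx, (mul_le_mul_of_nonneg_right (min_le_left _ _) hρ.le).trans_lt hyL⟩
  by_cases hbd : Bornology.IsBounded K
  · have hdiam : 0 < diam K := by
      obtain ⟨x, hx⟩ := hne
      obtain ⟨L₀, -, hL₀⟩ := exists_isLine
      have hxL : x ∈ AffineSubspace.mk' x L₀.direction := AffineSubspace.self_mem_mk' _ _
      obtain ⟨y, hy, -, hyL⟩ := hdiff x hx r₁ hr₁ le_rfl (AffineSubspace.mk' x L₀.direction)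
        ⟨⟨x, hxL⟩, by rwa [AffineSubspace.direction_mk']⟩
      calc 0 < β₁ * r₁ := mul_pos hβ₁ hr₁
        _ < _ := hyL
        _ ≤ dist y x := infDist_le_dist_of_mem hxL
        _ ≤ diam K := dist_le_diam_of_mem hbd hy hx
    refine ⟨min β₁ 1, min (min r₁ 1) (diam K), by positivity, min_le_right _ _, by positivity,
      (min_le_left _ _).trans (min_le_right _ _), fun x hx r hr hr₀ => hreg x hx r hr
      (Or.inl ⟨hbd, hr₀.trans (min_le_right _ _)⟩), fun x hx ρ hρ hρr => hdiff' x hx ρ hρ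
      (hρr.trans ((min_le_left _ _).trans (min_le_left _ _)))⟩
  · exact ⟨min β₁ 1, min r₁ 1, by positivity, min_le_right _ _, by positivity,
      min_le_right _ _, fun x hx r hr hr₀ => hreg x hx r hr
      (Or.inr ⟨hbd, hr₀.trans (min_le_right _ _)⟩), fun x hx ρ hρ hρr => hdiff' x hx ρ hρ
      (hρr.trans (min_le_left _ _))⟩

end

/-- Let `K ⊆ ℝ²` be a closed, hyperplane diffuse set which is the support of an Ahlfors
regular Borel measure `μ` (of some dimension `α > 0`, with regularity constant `C ≥ 1`, the
regularity bounds holding for all `x ∈ K` and all `0 < r ≤ diam K` if `K` is bounded, resp.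
all `0 < r ≤ 1` if `K` is unbounded; `K = supp μ` is expressed by the condition that `x ∈ K`
iff every ball around `x` has positive measure).  Let `(sₙ, tₙ)` be a countable collection
of pairs with `sₙ, tₙ ≥ 0` and `sₙ + tₙ = 1`, and let `fₙ` be C¹ diffeomorphisms of ℝ²
(with C¹ inverses `gₙ`).  Then `K ∩ ⋂ₙ fₙ(Bad(sₙ,tₙ))` has full Hausdorff dimension in `K`. -/
theorem dimH_inter_fractal (K : Set (ℝ × ℝ)) (hKcl : IsClosed K)
    (hKdiff : HyperplaneDiffuse K)
    (μ : MeasureTheory.Measure (ℝ × ℝ)) (α C : ℝ) (hα : 0 < α) (hC : 1 ≤ C)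
    (hsupp : ∀ x : ℝ × ℝ, x ∈ K ↔ ∀ ρ : ℝ, 0 < ρ → 0 < μ (ball x ρ))
    (hreg : ∀ x ∈ K, ∀ r : ℝ, 0 < r →
      ((Bornology.IsBounded K ∧ r ≤ Metric.diam K) ∨ (¬ Bornology.IsBounded K ∧ r ≤ 1)) →
      ENNReal.ofReal (C⁻¹ * r ^ α) ≤ μ (closedBall x r) ∧
        μ (closedBall x r) ≤ ENNReal.ofReal (C * r ^ α))
    (st : ℕ → ℝ × ℝ)
    (hst : ∀ n : ℕ, 0 ≤ (st n).1 ∧ 0 ≤ (st n).2 ∧ (st n).1 + (st n).2 = 1)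
    (f g : ℕ → (ℝ × ℝ) → (ℝ × ℝ))
    (hf : ∀ n : ℕ, ContDiff ℝ 1 (f n)) (hg : ∀ n : ℕ, ContDiff ℝ 1 (g n))
    (hgf : ∀ n : ℕ, Function.LeftInverse (g n) (f n))
    (hfg : ∀ n : ℕ, Function.RightInverse (g n) (f n)) :
    dimH (K ∩ ⋂ n : ℕ, f n '' badPair (st n).1 (st n).2) = dimH K := by
  refine le_antisymm (dimH_mono Set.inter_subset_left) (le_of_not_gt fun hlt => ?_)
  have hne : K.Nonempty := by
    by_contra hc
    simp [Set.not_nonempty_iff_eq_empty.1 hc] at hlt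
  obtain ⟨x₀, hx₀⟩ := hne
  have hK : μ Kᶜ = 0 := measure_compl_eq_zero_of_forall_ball fun x => (hsupp x).2
  obtain ⟨β₀, r₀, hβ₀, hβ₀', hr₀, hr₀', h, hdiff⟩ :=
    hKdiff.exists_ahlforsRegularOn ⟨x₀, hx₀⟩ hreg
  obtain ⟨e, he, heα⟩ := ENNReal.lt_iff_exists_nnreal_btwn.1
    (hlt.trans_le (h.dimH_le hα.le hC hr₀ hKcl hK))
  have he0 : (0 : ℝ) < e := by exact_mod_cast pos_of_gt he
  have heα' : (e : ℝ) < α := by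
    rwa [← ENNReal.ofReal_coe_nnreal, ENNReal.ofReal_lt_ofReal_iff hα] at heα
  obtain ⟨β, γ, θ, hβ, hβ', hγ, hθ, hθe, hθγ⟩ :=
    exists_ratio_and_exponent hα heα' hC hβ₀ hβ₀'
  have hρ : IsScale (fun n => β ^ n * r₀) β :=
    ⟨hβ, by linarith, fun n => by positivity, by simpa using hr₀', fun n => by ring⟩
  obtain ⟨z, hzK, hzT, hz⟩ := h.exists_mem_of_isObstacleFamily hC hKcl hK hβ₀ hβ₀' hdiff hρ
    (by simp) hβ' he0 hγ hθ hθe hθγ (hausdorffMeasure_of_dimH_lt he) hx₀ fun j ε hε =>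
    exists_isObstacleFamily (hf j) (hg j) (hgf j) (hfg j) (hst j).1 (hst j).2.1 (hst j).2.2 x₀ hρ
      hγ hε
  exact hzT ⟨hzK, Set.mem_iInter.2 fun j => ⟨g j z, hz j, hfg j z⟩⟩
end

section
/- For all real numbers s, t ≥ 0 with s + t = 1 and every α with 0 < α < 1/2, the set Bad(s,t) ⊆ ℝ² is α-winning for Schmidt's game: for every β with 0 < β < 1, Alice has a winning strategy for Schmidt's (α,β)-game played on ℝ² with target set Bad(s,t). -/
open Metric Filter

/-- Alice has a winning strategy for Schmidt's `(α,β)`-game on ℝ² with target `S`.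
A strategy for Alice assigns to each history of Bob's balls (represented as
(center, radius) pairs `h 0, …, h n`) the center `wₙ` of her ball `Aₙ = B(wₙ, α ρₙ)`,
where `ρₙ` is the radius of Bob's last ball.  The strategy must be legal:
`Aₙ ⊆ Bₙ` for every history.  It is winning if for every sequence of Bob's moves obeying
the rules (`B₀ = B(z₀, r₀)` with `r₀ > 0`, and `B_{n+1} = B(z_{n+1}, β α ρₙ) ⊆ Aₙ`), every
point of `⋂ₙ Bₙ` (i.e. the outcome of the game) belongs to `S`. -/
def SchmidtWinning (α β : ℝ) (S : Set (ℝ × ℝ)) : Prop :=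
  ∃ σ : (n : ℕ) → (Fin (n + 1) → (ℝ × ℝ) × ℝ) → ℝ × ℝ,
    (∀ (n : ℕ) (h : Fin (n + 1) → (ℝ × ℝ) × ℝ),
      closedBall (σ n h) (α * (h (Fin.last n)).2) ⊆
        closedBall (h (Fin.last n)).1 (h (Fin.last n)).2) ∧
    ∀ B : ℕ → (ℝ × ℝ) × ℝ, 0 < (B 0).2 →
      (∀ n : ℕ, (B (n + 1)).2 = β * (α * (B n).2) ∧
        closedBall (B (n + 1)).1 (B (n + 1)).2 ⊆
          closedBall (σ n (fun i => B i.1)) (α * (B n).2)) →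
      ∀ x : ℝ × ℝ, (∀ n : ℕ, x ∈ closedBall (B n).1 (B n).2) → x ∈ S

open scoped ENNReal

/-- The open neighbourhood of the line `a x + b y + d = 0` consisting of the points whose
distance to the line, for the supremum norm, is less than `τ`.
It is empty if `a = b = 0`. -/
def lineNhd (f : (ℝ × ℝ) × ℝ) (τ : ℝ) : Set (ℝ × ℝ) :=
  {w | |f.1.1 * w.1 + f.1.2 * w.2 + f.2| < τ * (|f.1.1| + |f.1.2|)}

/-- The sign attached to a Boolean. -/
def boolSign (e : Bool) : ℝ := if e then 1 else -1

/-- The centers of the four balls of radius `α r` sitting in the corners of the ball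
`closedBall z r` of `ℝ × ℝ`. -/
def cornerCenter (α : ℝ) (z : ℝ × ℝ) (r : ℝ) (e : Bool × Bool) : ℝ × ℝ :=
  (z.1 + boolSign e.1 * ((1 - α) * r), z.2 + boolSign e.2 * ((1 - α) * r))

lemma abs_boolSign (e : Bool) : |boolSign e| = 1 := by
  cases e <;> simp [boolSign]

lemma exists_boolSign_mul (a : ℝ) : ∃ e, boolSign e * a = |a| := by
  rcases le_total 0 a with h | h
  · exact ⟨true, by simp [boolSign, abs_of_nonneg h]⟩
  · exact ⟨false, by simp [boolSign, abs_of_nonpos h]⟩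

lemma exists_boolSign_mul_neg (a : ℝ) : ∃ e, boolSign e * a = -|a| := by
  rcases le_total 0 a with h | h
  · exact ⟨false, by simp [boolSign, abs_of_nonneg h]⟩
  · exact ⟨true, by simp [boolSign, abs_of_nonpos h]⟩

lemma mem_closedBall_prod_iff (w z : ℝ × ℝ) (r : ℝ) :
    w ∈ closedBall z r ↔ |w.1 - z.1| ≤ r ∧ |w.2 - z.2| ≤ r := by
  rw [mem_closedBall, Prod.dist_eq, Real.dist_eq, Real.dist_eq, max_le_iff]

lemma closedBall_cornerCenter_subset {α : ℝ} (hα1 : α < 1) (z : ℝ × ℝ) (r : ℝ)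
    (hα0 : 0 < α) (e : Bool × Bool) :
    closedBall (cornerCenter α z r e) (α * r) ⊆ closedBall z r := by
  rcases lt_or_ge r 0 with hr | hr
  · rw [closedBall_eq_empty.2 (mul_neg_of_pos_of_neg hα0 hr)]
    exact Set.empty_subset _
  have key : ∀ x y : ℝ, ∀ e, |x - (y + boolSign e * ((1 - α) * r))| ≤ α * r → |x - y| ≤ r := by
    intro x y e h
    have h1 : |boolSign e * ((1 - α) * r)| = (1 - α) * r := by
      rw [abs_mul, abs_boolSign, one_mul, abs_of_nonneg (mul_nonneg (by linarith) hr)]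
    calc |x - y| = |(x - (y + boolSign e * ((1 - α) * r))) + boolSign e * ((1 - α) * r)| := by
          congr 1; ring
      _ ≤ _ := abs_add_le _ _
      _ ≤ r := by rw [h1]; linarith
  intro w hw
  rw [mem_closedBall_prod_iff] at hw ⊢
  exact ⟨key _ _ _ hw.1, key _ _ _ hw.2⟩

/-- A thin neighbourhood of a line misses one of the four corner balls. -/
lemma exists_corner_disjoint_lineNhd {α r τ : ℝ} (hτ : τ ≤ (1 - 2 * α) * r) (z : ℝ × ℝ)
    (f : (ℝ × ℝ) × ℝ) :
    ∃ e, ¬ (lineNhd f τ ∩ closedBall (cornerCenter α z r e) (α * r)).Nonempty := by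
  obtain ⟨⟨a, b⟩, d⟩ := f
  have key : ∀ e : Bool × Bool, ∀ w ∈ closedBall (cornerCenter α z r e) (α * r),
      |a * w.1 + b * w.2 + d - (a * z.1 + b * z.2 + d)
        - (boolSign e.1 * a + boolSign e.2 * b) * ((1 - α) * r)| ≤ α * r * (|a| + |b|) := by
    intro e w hw
    rw [mem_closedBall_prod_iff] at hw
    calc _ = |a * (w.1 - (cornerCenter α z r e).1) + b * (w.2 - (cornerCenter α z r e).2)| := by
          simp only [cornerCenter]; congr 1; ring
      _ ≤ |a| * |w.1 - (cornerCenter α z r e).1| + |b| * |w.2 - (cornerCenter α z r e).2| := by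
          rw [← abs_mul, ← abs_mul]; exact abs_add_le _ _
      _ ≤ |a| * (α * r) + |b| * (α * r) := by gcongr; exacts [hw.1, hw.2]
      _ = _ := by ring
  have hτ' : τ * (|a| + |b|) ≤ (1 - 2 * α) * r * (|a| + |b|) := by gcongr
  rcases le_total 0 (a * z.1 + b * z.2 + d) with h | h
  · obtain ⟨e₁, h₁⟩ := exists_boolSign_mul a
    obtain ⟨e₂, h₂⟩ := exists_boolSign_mul b
    refine ⟨(e₁, e₂), ?_⟩
    rintro ⟨w, hw, hwb⟩
    have := (abs_le.1 (key _ w hwb)).1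
    have hw' := (abs_lt.1 (id hw : |a * w.1 + b * w.2 + d| < τ * (|a| + |b|))).2
    simp only [h₁, h₂] at this hw'
    linarith
  · obtain ⟨e₁, h₁⟩ := exists_boolSign_mul_neg a
    obtain ⟨e₂, h₂⟩ := exists_boolSign_mul_neg b
    refine ⟨(e₁, e₂), ?_⟩
    rintro ⟨w, hw, hwb⟩
    have := (abs_le.1 (key _ w hwb)).2
    have hw' := (abs_lt.1 (id hw : |a * w.1 + b * w.2 + d| < τ * (|a| + |b|))).1
    simp only [h₁, h₂] at this hw'
    linarith

/-- The potential of a set `U` after Bob's balls with centers `z 0, …, z n` have been played.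
The set `T i (z i) j`, announced at turn `i`, must be avoided by turn `i + 40 + j`, and
contributes to the potential, until that turn, with a weight that increases with time. -/
noncomputable def gamePotential (T : ℕ → ℝ × ℝ → ℕ → Set (ℝ × ℝ)) (n : ℕ)
    (z : Fin (n + 1) → ℝ × ℝ) (U : Set (ℝ × ℝ)) : ℝ≥0∞ :=
  open Classical in
  ∑ i : Fin (n + 1), ∑' j : ℕ, if n ≤ i + 40 + j ∧ (T i (z i) j ∩ U).Nonempty
    then ENNReal.ofReal ((7 / 8) ^ (i + 40 + j - n)) else 0

lemma sum_gamePotential_le {ι : Type*} [Fintype ι] {k : ℕ} (hk : Fintype.card ι = k + 1)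
    {T : ℕ → ℝ × ℝ → ℕ → Set (ℝ × ℝ)} {n : ℕ} {z : Fin (n + 1) → ℝ × ℝ} {U : Set (ℝ × ℝ)}
    {V : ι → Set (ℝ × ℝ)} (hV : ∀ e, V e ⊆ U)
    (hT : ∀ i : Fin (n + 1), ∀ j, n ≤ i + 40 + j → ∃ e, ¬ (T i (z i) j ∩ V e).Nonempty) :
    ∑ e, gamePotential T n z (V e) ≤ k * gamePotential T n z U := by
  classical
  unfold gamePotential
  rw [Finset.sum_comm, Finset.mul_sum]
  refine Finset.sum_le_sum fun i _ => ?_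
  rw [← Summable.tsum_finsetSum fun _ _ => ENNReal.summable, ← ENNReal.tsum_mul_left]
  refine ENNReal.tsum_le_tsum fun j => ?_
  by_cases hj : n ≤ i + 40 + j
  swap
  · simp [hj]
  by_cases hU : (T i (z i) j ∩ U).Nonempty
  · obtain ⟨e₀, he₀⟩ := hT i j hj
    rw [← Finset.sum_erase_add _ _ (Finset.mem_univ e₀)]
    simp only [hj, hU, he₀, and_self, and_false, if_true, if_false, true_and, add_zero]
    calc _ ≤ ∑ e ∈ Finset.univ.erase e₀, ENNReal.ofReal ((7 / 8) ^ (i + 40 + j - n)) := by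
          refine Finset.sum_le_sum fun e _ => ?_
          split_ifs <;> simp
      _ = _ := by
          rw [Finset.sum_const, Finset.card_erase_of_mem (Finset.mem_univ _), Finset.card_univ,
            hk, nsmul_eq_mul, Nat.add_sub_cancel]
  · have : ∀ e, ¬ (T i (z i) j ∩ V e).Nonempty := fun e h =>
      hU (h.mono (Set.inter_subset_inter_right _ (hV e)))
    simp [this, hU]

lemma tsum_ofReal_weight :
    ∑' j : ℕ, ENNReal.ofReal ((7 / 8) ^ (40 + j)) = ENNReal.ofReal (8 * (7 / 8) ^ 40) := by
  rw [← ENNReal.ofReal_tsum_of_nonneg (fun _ => by positivity)]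
  · simp_rw [pow_add]
    rw [tsum_mul_left, tsum_geometric_of_lt_one (by norm_num) (by norm_num)]
    norm_num
  · simp_rw [pow_add]
    exact (summable_geometric_of_lt_one (by norm_num) (by norm_num)).mul_left _

lemma gamePotential_succ_le (T : ℕ → ℝ × ℝ → ℕ → Set (ℝ × ℝ)) (n : ℕ) (z : ℕ → ℝ × ℝ)
    {U V : Set (ℝ × ℝ)} (hUV : U ⊆ V) :
    gamePotential T (n + 1) (fun i => z i) U ≤
      ENNReal.ofReal (8 / 7) * gamePotential T n (fun i => z i) V
        + ENNReal.ofReal (8 * (7 / 8) ^ 40) := by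
  classical
  unfold gamePotential
  rw [Fin.sum_univ_castSucc, Finset.mul_sum]
  refine add_le_add (Finset.sum_le_sum fun i _ => ?_) ?_
  · rw [← ENNReal.tsum_mul_left]
    refine ENNReal.tsum_le_tsum fun j => ?_
    split_ifs with h₁ h₂ h₂
    · rw [← ENNReal.ofReal_mul (by norm_num)]
      refine ENNReal.ofReal_le_ofReal (le_of_eq ?_)
      have := h₁.1
      simp only [Fin.val_castSucc] at this ⊢
      obtain ⟨k, hk⟩ : ∃ k, (i : ℕ) + 40 + j = n + 1 + k := ⟨_, (Nat.add_sub_cancel' this).symm⟩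
      rw [hk, show n + 1 + k - (n + 1) = k by omega, show n + 1 + k - n = k + 1 by omega, pow_succ]
      ring
    · exact absurd ⟨(Nat.le_succ n).trans h₁.1,
        h₁.2.mono (Set.inter_subset_inter_right _ hUV)⟩ h₂
    · exact zero_le
    · exact zero_le
  · rw [← tsum_ofReal_weight]
    refine ENNReal.tsum_le_tsum fun j => ?_
    split_ifs
    · refine ENNReal.ofReal_le_ofReal (le_of_eq ?_)
      congr 1
      simp only [Fin.val_last]
      omega
    · exact zero_le

lemma gamePotential_zero_le (T : ℕ → ℝ × ℝ → ℕ → Set (ℝ × ℝ)) (z : Fin 1 → ℝ × ℝ)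
    (U : Set (ℝ × ℝ)) : gamePotential T 0 z U ≤ ENNReal.ofReal (8 * (7 / 8) ^ 40) := by
  classical
  unfold gamePotential
  rw [Fin.sum_univ_one, ← tsum_ofReal_weight]
  refine ENNReal.tsum_le_tsum fun j => ?_
  split_ifs
  · simp
  · exact zero_le

lemma one_le_gamePotential {T : ℕ → ℝ × ℝ → ℕ → Set (ℝ × ℝ)} {i j : ℕ} {z : ℕ → ℝ × ℝ}
    {U : Set (ℝ × ℝ)} (h : (T i (z i) j ∩ U).Nonempty) :
    1 ≤ gamePotential T (i + 40 + j) (fun i => z i) U := by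
  classical
  unfold gamePotential
  calc (1 : ℝ≥0∞) = if i + 40 + j ≤ i + 40 + j ∧ (T i (z i) j ∩ U).Nonempty
        then ENNReal.ofReal ((7 / 8) ^ (i + 40 + j - (i + 40 + j))) else 0 := by simp [h]
    _ ≤ ∑' k, if i + 40 + j ≤ i + 40 + k ∧ (T i (z i) k ∩ U).Nonempty
        then ENNReal.ofReal ((7 / 8) ^ (i + 40 + k - (i + 40 + j))) else 0 :=
        ENNReal.le_tsum (f := fun k => if i + 40 + j ≤ i + 40 + k ∧ (T i (z i) k ∩ U).Nonempty
        then ENNReal.ofReal ((7 / 8) ^ (i + 40 + k - (i + 40 + j))) else 0) j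
    _ ≤ _ := Finset.single_le_sum (f := fun l : Fin (i + 40 + j + 1) =>
        ∑' k, if i + 40 + j ≤ l + 40 + k ∧ (T l (z l) k ∩ U).Nonempty
        then ENNReal.ofReal ((7 / 8) ^ (l + 40 + k - (i + 40 + j))) else 0)
        (fun _ _ => zero_le) (Finset.mem_univ ⟨i, by omega⟩)

/-- Suppose that, as soon as Bob has chosen his ball of radius `ρ` and center `z` at turn `m`,
a line `F ρ₀ m z j` is announced for every `j`, where `ρ₀` is the initial radius.
If every point that avoids, for all `m` and `j`, the neighbourhood of the corresponding line whose
width is proportional to the radius of Bob's ball at turn `m + 40 + j` lies in `S`,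
then Alice wins. -/
theorem schmidtWinning_of_lineNhd {α β : ℝ} (hα0 : 0 < α) (hα : α < 1 / 2) (hβ0 : 0 < β)
    (hβ1 : β < 1) {S : Set (ℝ × ℝ)} (F : ℝ → ℕ → ℝ × ℝ → ℕ → (ℝ × ℝ) × ℝ)
    (hF : ∀ ρ, 0 < ρ → ∀ (z : ℕ → ℝ × ℝ) (x : ℝ × ℝ),
      (∀ m, x ∈ closedBall (z m) (ρ * (β * α) ^ m)) →
      (∀ m j, x ∉ lineNhd (F ρ m (z m) j) ((1 - 2 * α) * (ρ * (β * α) ^ (m + 40 + j)))) →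
      x ∈ S) :
    SchmidtWinning α β S := by
  set T : ℝ → ℕ → ℝ × ℝ → ℕ → Set (ℝ × ℝ) := fun ρ m z j =>
    lineNhd (F ρ m z j) ((1 - 2 * α) * (ρ * (β * α) ^ (m + 40 + j))) with hT
  set ball : (n : ℕ) → (Fin (n + 1) → (ℝ × ℝ) × ℝ) → Bool × Bool → Set (ℝ × ℝ) := fun n h e =>
    closedBall (cornerCenter α (h (Fin.last n)).1 (h (Fin.last n)).2 e)
      (α * (h (Fin.last n)).2) with hball
  have hmin : ∀ (n : ℕ) (h : Fin (n + 1) → (ℝ × ℝ) × ℝ), ∃ e, ∀ e',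
      gamePotential (T (h 0).2) n (fun i => (h i).1) (ball n h e) ≤
        gamePotential (T (h 0).2) n (fun i => (h i).1) (ball n h e') :=
    fun n h => Finite.exists_min _
  choose e he using hmin
  refine ⟨fun n h => cornerCenter α (h (Fin.last n)).1 (h (Fin.last n)).2 (e n h),
    fun n h => closedBall_cornerCenter_subset (by linarith) _ _ hα0 _, ?_⟩
  intro B hB0 hB x hx
  have hμ0 : 0 < β * α := mul_pos hβ0 hα0
  have hμ1 : β * α < 1 := by nlinarith
  have hr : ∀ n, (B n).2 = (B 0).2 * (β * α) ^ n := by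
    intro n
    induction n with
    | zero => simp
    | succ n ih => rw [(hB n).1, ih]; ring
  have hcorner : ∀ n, 4 * gamePotential (T (B 0).2) n (fun i => (B i).1)
      (ball n (fun i => B i) (e n fun i => B i)) ≤
      3 * gamePotential (T (B 0).2) n (fun i => (B i).1) (closedBall (B n).1 (B n).2) := by
    intro n
    calc _ = ∑ _e' : Bool × Bool, gamePotential (T (B 0).2) n (fun i => (B i).1)
          (ball n (fun i => B i) (e n fun i => B i)) := by
          rw [Finset.sum_const, nsmul_eq_mul]; rfl
      _ ≤ ∑ e', gamePotential (T (B 0).2) n (fun i => (B i).1) (ball n (fun i => B i) e') :=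
          Finset.sum_le_sum fun e' _ => he n (fun i => B i) e'
      _ ≤ _ := by
          refine sum_gamePotential_le (k := 3) (by decide)
            (fun e' => closedBall_cornerCenter_subset (by linarith) _ _ hα0 e') ?_
          intro i j hij
          refine exists_corner_disjoint_lineNhd ?_ _ _
          simp only [Fin.val_last]
          rw [hr n]
          have : (β * α) ^ ((i : ℕ) + 40 + j) ≤ (β * α) ^ n :=
            pow_le_pow_of_le_one hμ0.le hμ1.le hij
          have h2 : 0 ≤ 1 - 2 * α := by linarith
          gcongr
  have hpot : ∀ n, gamePotential (T (B 0).2) n (fun i => (B i).1) (closedBall (B n).1 (B n).2) ≤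
      ENNReal.ofReal (56 * (7 / 8) ^ 40) := by
    intro n
    induction n with
    | zero =>
      exact (gamePotential_zero_le _ _ _).trans (ENNReal.ofReal_le_ofReal (by norm_num))
    | succ n ih =>
      refine (gamePotential_succ_le (T (B 0).2) n (fun i => (B i).1) (hB n).2).trans ?_
      have h1 := (hcorner n).trans (mul_le_mul_right ih 3)
      set a := gamePotential (T (B 0).2) n (fun i => (B i).1)
        (ball n (fun i => B i) (e n fun i => B i)) with ha
      have h2 : a ≤ ENNReal.ofReal (42 * (7 / 8) ^ 40) := by
        have h3 : (4 : ℝ≥0∞) * a ≤ 4 * ENNReal.ofReal (42 * (7 / 8) ^ 40) := by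
          refine h1.trans (le_of_eq ?_)
          rw [← ENNReal.ofReal_ofNat 3, ← ENNReal.ofReal_ofNat 4,
            ← ENNReal.ofReal_mul (by norm_num), ← ENNReal.ofReal_mul (by norm_num)]
          congr 1
          norm_num
        exact (ENNReal.mul_le_mul_iff_right (by norm_num) (by norm_num)).1 h3
      calc _ ≤ ENNReal.ofReal (8 / 7) * ENNReal.ofReal (42 * (7 / 8) ^ 40)
            + ENNReal.ofReal (8 * (7 / 8) ^ 40) := by gcongr; exact h2
        _ = _ := by
          rw [← ENNReal.ofReal_mul (by norm_num), ← ENNReal.ofReal_add (by norm_num) (by norm_num)]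
          congr 1
          norm_num
  refine hF (B 0).2 hB0 (fun m => (B m).1) x (fun m => hr m ▸ hx m) fun m j hxT => ?_
  have h1 := (one_le_gamePotential (T := T (B 0).2) (z := fun i => (B i).1)
    ⟨x, hxT, hx (m + 40 + j)⟩).trans (hpot _)
  rw [ENNReal.one_le_ofReal] at h1
  norm_num at h1

/-- The point `w` lies in the box, centered at the rational point `(p / q, r / q)`,
that has to be avoided in order to show that `w ∈ badPair s t`. -/
def IsNear (s t c : ℝ) (p r : ℤ) (q : ℕ) (w : ℝ × ℝ) : Prop :=
  (q : ℝ) ^ s * |q * w.1 - p| < c ∧ (q : ℝ) ^ t * |q * w.2 - r| < c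

/-- The rational line `A x + B y + C = 0` passes through `(p / q, r / q)`, and its coefficients
satisfy the bounds provided by Minkowski's theorem. -/
structure IsAttachedLine (s t : ℝ) (p r : ℤ) (q : ℕ) (A B C : ℤ) : Prop where
  abs_fst_le : |(A : ℝ)| ≤ (q : ℝ) ^ s
  abs_snd_le : |(B : ℝ)| ≤ (q : ℝ) ^ t
  ne_zero : A ≠ 0 ∨ B ≠ 0
  mem : A * p + B * r + C * q = 0

lemma exists_isAttachedLine {s t : ℝ} (hst : s + t = 1) (p r : ℤ) {q : ℕ} (hq : 0 < q) :
    ∃ A B C, IsAttachedLine s t p r q A B C := by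
  have hq' : (0 : ℝ) < q := by exact_mod_cast hq
  have : NeZero q := ⟨hq.ne'⟩
  set a := ⌊(q : ℝ) ^ s⌋₊ with ha
  set b := ⌊(q : ℝ) ^ t⌋₊ with hb
  have hcard : (Finset.univ : Finset (ZMod q)).card <
      (Finset.range (a + 1) ×ˢ Finset.range (b + 1)).card := by
    rw [Finset.card_univ, ZMod.card, Finset.card_product, Finset.card_range, Finset.card_range]
    have : (q : ℝ) < (a + 1) * (b + 1) := by
      calc (q : ℝ) = (q : ℝ) ^ s * (q : ℝ) ^ t := by
            rw [← Real.rpow_add hq', hst, Real.rpow_one]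
        _ < (a + 1) * (b + 1) :=
            mul_lt_mul'' (Nat.lt_floor_add_one _) (Nat.lt_floor_add_one _)
              (by positivity) (by positivity)
    exact_mod_cast this
  obtain ⟨⟨i, j⟩, hij, ⟨k, l⟩, hkl, hne, heq⟩ := Finset.exists_ne_map_eq_of_card_lt_of_maps_to hcard
    (f := fun u : ℕ × ℕ => (u.1 : ZMod q) * p + u.2 * r) (fun _ _ => Finset.mem_univ _)
  simp only [Finset.mem_product, Finset.mem_range, Nat.lt_succ_iff] at hij hkl
  have hdvd : (q : ℤ) ∣ ((i : ℤ) - k) * p + ((j : ℤ) - l) * r := by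
    rw [← ZMod.intCast_zmod_eq_zero_iff_dvd]
    push_cast
    linear_combination heq
  obtain ⟨C, hC⟩ := hdvd
  have bound : ∀ (u v w : ℕ) (y : ℝ), 0 ≤ y → w = ⌊y⌋₊ → u ≤ w → v ≤ w →
      |(((u : ℤ) - v : ℤ) : ℝ)| ≤ y := by
    intro u v w y hy hw hu hv
    have hw' : (w : ℝ) ≤ y := hw ▸ Nat.floor_le hy
    have hu' : (u : ℝ) ≤ w := by exact_mod_cast hu
    have hv' : (v : ℝ) ≤ w := by exact_mod_cast hv
    have := Nat.cast_nonneg (α := ℝ) u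
    have := Nat.cast_nonneg (α := ℝ) v
    push_cast
    rw [abs_le]
    constructor <;> linarith
  refine ⟨i - k, j - l, -C, bound _ _ _ _ (by positivity) ha hij.1 hkl.1,
    bound _ _ _ _ (by positivity) hb hij.2 hkl.2, ?_, by linear_combination hC⟩
  by_contra! h
  exact hne (by ext <;> simp <;> omega)

lemma IsAttachedLine.mul_abs_eval_le {s t c : ℝ} {p r : ℤ} {q : ℕ} {A B C : ℤ}
    (hL : IsAttachedLine s t p r q A B C) {w : ℝ × ℝ} (hw : IsNear s t c p r q w) :
    q * |A * w.1 + B * w.2 + C| ≤ 2 * c := by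
  have hmem : (A * p + B * r + C * q : ℝ) = 0 := by exact_mod_cast hL.mem
  calc q * |A * w.1 + B * w.2 + C| = |A * (q * w.1 - p) + B * (q * w.2 - r)| := by
        rw [← Nat.abs_cast q, ← abs_mul, Nat.abs_cast]
        congr 1
        linear_combination hmem
    _ ≤ |(A : ℝ)| * |q * w.1 - p| + |(B : ℝ)| * |q * w.2 - r| := by
        rw [← abs_mul, ← abs_mul]; exact abs_add_le _ _
    _ ≤ (q : ℝ) ^ s * |q * w.1 - p| + (q : ℝ) ^ t * |q * w.2 - r| := by
        gcongr; exacts [hL.abs_fst_le, hL.abs_snd_le]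
    _ ≤ 2 * c := by linarith [hw.1, hw.2]

lemma IsAttachedLine.mul_abs_eval_le_of_close {s t c d : ℝ} {p r : ℤ} {q : ℕ} {A B C : ℤ}
    (hL : IsAttachedLine s t p r q A B C) {w v : ℝ × ℝ} (hw : IsNear s t c p r q w)
    (h₁ : |v.1 - w.1| ≤ d) (h₂ : |v.2 - w.2| ≤ d) :
    q * |A * v.1 + B * v.2 + C| ≤ 2 * c + 2 * d * (q * max |(A : ℝ)| |(B : ℝ)|) := by
  have hd : 0 ≤ d := (abs_nonneg _).trans h₁
  have h : |A * v.1 + B * v.2 + C| ≤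
      |A * w.1 + B * w.2 + C| + 2 * d * max |(A : ℝ)| |(B : ℝ)| := by
    calc _ = |(A * w.1 + B * w.2 + C) + (A * (v.1 - w.1) + B * (v.2 - w.2))| := by
          congr 1; ring
      _ ≤ |A * w.1 + B * w.2 + C| + (|(A : ℝ)| * |v.1 - w.1| + |(B : ℝ)| * |v.2 - w.2|) := by
          rw [← abs_mul, ← abs_mul]
          exact (abs_add_le _ _).trans (add_le_add_right (abs_add_le _ _) _)
      _ ≤ |A * w.1 + B * w.2 + C| + (max |(A : ℝ)| |(B : ℝ)| * d + max |(A : ℝ)| |(B : ℝ)| * d) := by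
          gcongr
          exacts [le_max_left _ _, le_max_right _ _]
      _ = _ := by ring
  have h' := mul_le_mul_of_nonneg_left h (Nat.cast_nonneg (α := ℝ) q)
  linarith [hL.mul_abs_eval_le hw]

/-- If `x ≤ W y` then `x ^ u ≤ W y ^ u` for `0 ≤ u ≤ 1`. -/
lemma rpow_le_mul_rpow_of_le_mul {x y W u : ℝ} (hx : 0 ≤ x) (hy : 0 ≤ y) (hW : 1 ≤ W)
    (hu₀ : 0 ≤ u) (hu₁ : u ≤ 1) (h : x ≤ W * y) : x ^ u ≤ W * y ^ u := by
  calc x ^ u ≤ (W * y) ^ u := Real.rpow_le_rpow hx h hu₀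
    _ = W ^ u * y ^ u := Real.mul_rpow (by linarith) hy
    _ ≤ W ^ (1 : ℝ) * y ^ u := by gcongr
    _ = W * y ^ u := by rw [Real.rpow_one]

/-- A rational point of comparable denominator that is close to the line lies on the line. -/
lemma IsAttachedLine.mem_of_close {s t c E W : ℝ} (hs : 0 ≤ s) (ht : 0 ≤ t) (hst : s + t = 1)
    {p₁ r₁ p₂ r₂ : ℤ} {q₁ q₂ : ℕ} {A B C : ℤ} (hL : IsAttachedLine s t p₁ r₁ q₁ A B C)
    {w : ℝ × ℝ} (hw : IsNear s t c p₂ r₂ q₂ w) (hW : 1 ≤ W) (h₁₂ : (q₁ : ℝ) ≤ W * q₂)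
    (h₂₁ : (q₂ : ℝ) ≤ W * q₁) (hE : q₁ * |A * w.1 + B * w.2 + C| ≤ E)
    (hsmall : W * (2 * c + E) < 1) : A * p₂ + B * r₂ + C * q₂ = 0 := by
  have key : |((A * p₂ + B * r₂ + C * q₂ : ℤ) : ℝ)| < 1 := by
    push_cast
    calc |(A * p₂ + B * r₂ + C * q₂ : ℝ)| = |q₂ * (A * w.1 + B * w.2 + C) -
          (A * (q₂ * w.1 - p₂) + B * (q₂ * w.2 - r₂))| := by congr 1; ring
      _ ≤ q₂ * |A * w.1 + B * w.2 + C| +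
          (|(A : ℝ)| * |q₂ * w.1 - p₂| + |(B : ℝ)| * |q₂ * w.2 - r₂|) := by
          refine (abs_sub _ _).trans ?_
          rw [← abs_mul, ← abs_mul, abs_mul (q₂ : ℝ), Nat.abs_cast]
          gcongr
          exact abs_add_le _ _
      _ ≤ (W * q₁) * |A * w.1 + B * w.2 + C| +
          ((W * (q₂ : ℝ) ^ s) * |q₂ * w.1 - p₂| + (W * (q₂ : ℝ) ^ t) * |q₂ * w.2 - r₂|) := by
          gcongr
          · exact hL.abs_fst_le.trans (rpow_le_mul_rpow_of_le_mul (by positivity) (by positivity)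
              hW hs (by linarith) h₁₂)
          · exact hL.abs_snd_le.trans (rpow_le_mul_rpow_of_le_mul (by positivity) (by positivity)
              hW ht (by linarith) h₁₂)
      _ = W * (q₁ * |A * w.1 + B * w.2 + C| + ((q₂ : ℝ) ^ s * |q₂ * w.1 - p₂| +
          (q₂ : ℝ) ^ t * |q₂ * w.2 - r₂|)) := by ring
      _ ≤ W * (2 * c + E) :=
          mul_le_mul_of_nonneg_left (by linarith [hw.1, hw.2]) (by linarith)
      _ < 1 := hsmall
  have : |A * p₂ + B * r₂ + C * q₂| < 1 := by exact_mod_cast key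
  exact Int.abs_lt_one_iff.1 this

/-- The integer lines `A₁ x + B₁ y + C₁ = 0` and `A₂ x + B₂ y + C₂ = 0` coincide. -/
def SameLine (A₁ B₁ C₁ A₂ B₂ C₂ : ℤ) : Prop :=
  A₁ * B₂ = A₂ * B₁ ∧ A₁ * C₂ = A₂ * C₁ ∧ B₁ * C₂ = B₂ * C₁

lemma sameLine_of_parallel {x y : ℝ} {N E W : ℝ} (hN : 0 < N) (hW : 0 ≤ W) {q₁ q₂ : ℝ}
    {A₁ B₁ C₁ A₂ B₂ C₂ : ℤ} (h₁₂ : q₁ ≤ W * q₂) (h₂₁ : q₂ ≤ W * q₁)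
    (h₁ : max |(A₁ : ℝ)| |(B₁ : ℝ)| * N ≤ q₁) (h₂ : max |(A₂ : ℝ)| |(B₂ : ℝ)| * N ≤ q₂)
    (hE₁ : q₁ * |A₁ * x + B₁ * y + C₁| ≤ E) (hE₂ : q₂ * |A₂ * x + B₂ * y + C₂| ≤ E)
    (hsmall : 2 * W * E < N) (hD : A₁ * B₂ = A₂ * B₁) : SameLine A₁ B₁ C₁ A₂ B₂ C₂ := by
  have hD' : (A₁ * B₂ : ℝ) = A₂ * B₁ := by exact_mod_cast hD
  have key : ∀ a₁ a₂ : ℤ, |(a₁ : ℝ)| ≤ max |(A₁ : ℝ)| |(B₁ : ℝ)| →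
      |(a₂ : ℝ)| ≤ max |(A₂ : ℝ)| |(B₂ : ℝ)| →
      (a₁ * C₂ - a₂ * C₁ : ℝ) = a₁ * (A₂ * x + B₂ * y + C₂) - a₂ * (A₁ * x + B₁ * y + C₁) →
      a₁ * C₂ = a₂ * C₁ := by
    intro a₁ a₂ ha₁ ha₂ h
    have hlt : |((a₁ * C₂ - a₂ * C₁ : ℤ) : ℝ)| * N < 1 * N := by
      push_cast
      rw [h]
      calc _ ≤ (|(a₁ : ℝ)| * |A₂ * x + B₂ * y + C₂| + |(a₂ : ℝ)| * |A₁ * x + B₁ * y + C₁|) * N := by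
            rw [← abs_mul, ← abs_mul]; gcongr; exact abs_sub _ _
        _ ≤ (max |(A₁ : ℝ)| |(B₁ : ℝ)| * |A₂ * x + B₂ * y + C₂| +
            max |(A₂ : ℝ)| |(B₂ : ℝ)| * |A₁ * x + B₁ * y + C₁|) * N := by gcongr
        _ = (max |(A₁ : ℝ)| |(B₁ : ℝ)| * N) * |A₂ * x + B₂ * y + C₂| +
            (max |(A₂ : ℝ)| |(B₂ : ℝ)| * N) * |A₁ * x + B₁ * y + C₁| := by ring
        _ ≤ (W * q₂) * |A₂ * x + B₂ * y + C₂| + (W * q₁) * |A₁ * x + B₁ * y + C₁| := by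
            gcongr ?_ * _ + ?_ * _; exacts [h₁.trans h₁₂, h₂.trans h₂₁]
        _ = W * (q₂ * |A₂ * x + B₂ * y + C₂| + q₁ * |A₁ * x + B₁ * y + C₁|) := by ring
        _ ≤ W * (E + E) := by gcongr
        _ < 1 * N := by linarith
    have hlt' : |a₁ * C₂ - a₂ * C₁| < 1 := by exact_mod_cast lt_of_mul_lt_mul_right hlt hN.le
    exact sub_eq_zero.1 (Int.abs_lt_one_iff.1 hlt')
  refine ⟨hD, key A₁ A₂ (le_max_left _ _) (le_max_left _ _) ?_,
    key B₁ B₂ (le_max_right _ _) (le_max_right _ _) ?_⟩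
  · linear_combination (-y) * hD'
  · linear_combination x * hD'

/-- The estimates behind Cramer's rule for two lines with coefficients of absolute values `aᵢ`
and `bᵢ`, and determinant `Q`, whose equations take values of sizes `eᵢ` at a given point. -/
lemma cramer_estimates {s t c N E W δ : ℝ} (hs : 0 ≤ s) (hst : s + t = 1)
    (ht : 1 / 2 ≤ t) {q₁ q₂ a₁ a₂ b₁ b₂ e₁ e₂ Q : ℝ} (hq₁ : 0 < q₁) (hq₂ : 0 < q₂)
    (ha₁ : 0 ≤ a₁) (ha₂ : 0 ≤ a₂) (hb₁ : 0 ≤ b₁) (hb₂ : 0 ≤ b₂) (he₁ : 0 ≤ e₁) (he₂ : 0 ≤ e₂)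
    (hA₁ : a₁ ≤ q₁ ^ s) (hA₂ : a₂ ≤ q₂ ^ s) (hB₁ : b₁ * N ≤ q₁ ^ t) (hB₂ : b₂ * N ≤ q₂ ^ t)
    (hN : 0 < N) (hW : 1 ≤ W) (h₁₂ : q₁ ≤ W * q₂) (h₂₁ : q₂ ≤ W * q₁)
    (hE₁ : q₁ * e₁ ≤ E) (hE₂ : q₂ * e₂ ≤ E)
    (hδ₀ : 0 < δ) (hδ₁ : δ < 1) (hδ : 2 * W ≤ N * δ ^ 2)
    (hfst : 2 * W * E < c * N) (hsnd : 2 * δ * W * E < c)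
    (hQ0 : 0 ≤ Q) (hQ : Q ≤ a₁ * b₂ + a₂ * b₁) :
    Q < q₁ ∧ Q ^ s * (e₁ * b₂ + e₂ * b₁) < c ∧ Q ^ t * (a₁ * e₂ + a₂ * e₁) < c := by
  have hW0 : 0 ≤ W := by linarith
  have ht₀ : 0 ≤ t := by linarith
  have hsplit : ∀ q : ℝ, 0 < q → q ^ s * q ^ t = q := fun q hq => by
    rw [← Real.rpow_add hq, hst, Real.rpow_one]
  have hA₁' : a₁ ≤ W * q₂ ^ s :=
    hA₁.trans (rpow_le_mul_rpow_of_le_mul hq₁.le hq₂.le hW hs (by linarith) h₁₂)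
  have hA₂' : a₂ ≤ W * q₁ ^ s :=
    hA₂.trans (rpow_le_mul_rpow_of_le_mul hq₂.le hq₁.le hW hs (by linarith) h₂₁)
  have hB₁' : b₁ * N ≤ W * q₂ ^ t :=
    hB₁.trans (rpow_le_mul_rpow_of_le_mul hq₁.le hq₂.le hW ht₀ (by linarith) h₁₂)
  have hB₂' : b₂ * N ≤ W * q₁ ^ t :=
    hB₂.trans (rpow_le_mul_rpow_of_le_mul hq₂.le hq₁.le hW ht₀ (by linarith) h₂₁)
  have hQq : ∀ q : ℝ, 0 < q → Q * N ≤ 2 * (W * q) → Q ≤ δ ^ 2 * q := by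
    intro q hq h
    refine le_of_mul_le_mul_right (a := N) ?_ hN
    calc Q * N ≤ (2 * W) * q := by linarith
      _ ≤ (N * δ ^ 2) * q := by gcongr
      _ = _ := by ring
  have hQN : Q * N ≤ a₁ * (b₂ * N) + a₂ * (b₁ * N) := by
    calc Q * N ≤ (a₁ * b₂ + a₂ * b₁) * N := by gcongr
      _ = _ := by ring
  have hQ₁ : Q ≤ δ ^ 2 * q₁ := by
    refine hQq _ hq₁ (hQN.trans ?_)
    calc a₁ * (b₂ * N) + a₂ * (b₁ * N) ≤ q₁ ^ s * (W * q₁ ^ t) + (W * q₁ ^ s) * q₁ ^ t :=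
          add_le_add (mul_le_mul hA₁ hB₂' (by positivity) (by positivity))
            (mul_le_mul hA₂' hB₁ (by positivity) (by positivity))
      _ = 2 * (W * (q₁ ^ s * q₁ ^ t)) := by ring
      _ = _ := by rw [hsplit _ hq₁]
  have hQ₂ : Q ≤ δ ^ 2 * q₂ := by
    refine hQq _ hq₂ (hQN.trans ?_)
    calc a₁ * (b₂ * N) + a₂ * (b₁ * N) ≤ (W * q₂ ^ s) * q₂ ^ t + q₂ ^ s * (W * q₂ ^ t) :=
          add_le_add (mul_le_mul hA₁' hB₂ (by positivity) (by positivity))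
            (mul_le_mul hA₂ hB₁' (by positivity) (by positivity))
      _ = 2 * (W * (q₂ ^ s * q₂ ^ t)) := by ring
      _ = _ := by rw [hsplit _ hq₂]
  have hδ2 : δ ^ 2 < 1 := pow_lt_one₀ hδ₀.le hδ₁ (by norm_num)
  have hQs : ∀ q : ℝ, 0 < q → Q ≤ δ ^ 2 * q → Q ^ s ≤ q ^ s := fun q hq h =>
    Real.rpow_le_rpow hQ0 (h.trans (mul_le_of_le_one_left hq.le hδ2.le)) hs
  have hQt : ∀ q : ℝ, 0 < q → Q ≤ δ ^ 2 * q → Q ^ t ≤ δ * q ^ t := by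
    intro q hq h
    calc Q ^ t ≤ (δ ^ 2 * q) ^ t := Real.rpow_le_rpow hQ0 h ht₀
      _ = δ ^ (2 * t) * q ^ t := by
          rw [Real.mul_rpow (by positivity) hq.le, ← Real.rpow_natCast δ 2, ← Real.rpow_mul hδ₀.le]
          norm_num
      _ ≤ δ ^ (1 : ℝ) * q ^ t := by
          gcongr ?_ * _
          exact Real.rpow_le_rpow_of_exponent_ge hδ₀ hδ₁.le (by linarith)
      _ = _ := by rw [Real.rpow_one]
  have hE₁' : q₁ ^ s * q₁ ^ t * e₁ ≤ E := by rwa [hsplit q₁ hq₁]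
  have hE₂' : q₂ ^ s * q₂ ^ t * e₂ ≤ E := by rwa [hsplit q₂ hq₂]
  refine ⟨hQ₁.trans_lt (mul_lt_of_lt_one_left hq₁ hδ2), ?_, ?_⟩
  · refine lt_of_mul_lt_mul_right (a := N) ?_ hN.le
    calc Q ^ s * (e₁ * b₂ + e₂ * b₁) * N
        = Q ^ s * (b₂ * N) * e₁ + Q ^ s * (b₁ * N) * e₂ := by ring
      _ ≤ q₁ ^ s * (W * q₁ ^ t) * e₁ + q₂ ^ s * (W * q₂ ^ t) * e₂ :=
          add_le_add
            (mul_le_mul_of_nonneg_right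
              (mul_le_mul (hQs _ hq₁ hQ₁) hB₂' (by positivity) (by positivity)) he₁)
            (mul_le_mul_of_nonneg_right
              (mul_le_mul (hQs _ hq₂ hQ₂) hB₁' (by positivity) (by positivity)) he₂)
      _ = W * (q₁ ^ s * q₁ ^ t * e₁ + q₂ ^ s * q₂ ^ t * e₂) := by ring
      _ ≤ W * (E + E) := mul_le_mul_of_nonneg_left (add_le_add hE₁' hE₂') hW0
      _ < c * N := by linarith
  · calc Q ^ t * (a₁ * e₂ + a₂ * e₁) = Q ^ t * a₁ * e₂ + Q ^ t * a₂ * e₁ := by ring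
      _ ≤ (δ * q₂ ^ t) * (W * q₂ ^ s) * e₂ + (δ * q₁ ^ t) * (W * q₁ ^ s) * e₁ :=
          add_le_add
            (mul_le_mul_of_nonneg_right
              (mul_le_mul (hQt _ hq₂ hQ₂) hA₁' (by positivity) (by positivity)) he₂)
            (mul_le_mul_of_nonneg_right
              (mul_le_mul (hQt _ hq₁ hQ₁) hA₂' (by positivity) (by positivity)) he₁)
      _ = δ * W * (q₂ ^ s * q₂ ^ t * e₂ + q₁ ^ s * q₁ ^ t * e₁) := by ring
      _ ≤ δ * W * (E + E) := mul_le_mul_of_nonneg_left (add_le_add hE₂' hE₁') (by positivity)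
      _ < c := by linarith

/-- If a point is close to two distinct nonparallel lines, then it is also close to their
intersection, and the latter is a rational point of smaller denominator. -/
lemma exists_isNear_of_transverse {s t c N E W δ : ℝ} (hs : 0 ≤ s) (hst : s + t = 1)
    (ht : 1 / 2 ≤ t) {p₁ r₁ p₂ r₂ : ℤ} {q₁ q₂ : ℕ} (hq₁ : 0 < q₁) (hq₂ : 0 < q₂)
    {A₁ B₁ C₁ A₂ B₂ C₂ : ℤ} (hL₁ : IsAttachedLine s t p₁ r₁ q₁ A₁ B₁ C₁)
    (hL₂ : IsAttachedLine s t p₂ r₂ q₂ A₂ B₂ C₂) {w : ℝ × ℝ} (hN : 0 < N) (hW : 1 ≤ W)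
    (h₁₂ : (q₁ : ℝ) ≤ W * q₂) (h₂₁ : (q₂ : ℝ) ≤ W * q₁)
    (h₁ : max |(A₁ : ℝ)| |(B₁ : ℝ)| * N ≤ (q₁ : ℝ) ^ t)
    (h₂ : max |(A₂ : ℝ)| |(B₂ : ℝ)| * N ≤ (q₂ : ℝ) ^ t)
    (hE₁ : q₁ * |A₁ * w.1 + B₁ * w.2 + C₁| ≤ E) (hE₂ : q₂ * |A₂ * w.1 + B₂ * w.2 + C₂| ≤ E)
    (hδ₀ : 0 < δ) (hδ₁ : δ < 1) (hδ : 2 * W ≤ N * δ ^ 2)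
    (hfst : 2 * W * E < c * N) (hsnd : 2 * δ * W * E < c) (hD : A₁ * B₂ ≠ A₂ * B₁) :
    ∃ p r : ℤ, ∃ q : ℕ, 0 < q ∧ q < q₁ ∧ IsNear s t c p r q w := by
  set D := A₁ * B₂ - A₂ * B₁ with hDdef
  have hD0 : D ≠ 0 := sub_ne_zero.2 hD
  set e₁ := A₁ * w.1 + B₁ * w.2 + C₁ with he₁
  set e₂ := A₂ * w.1 + B₂ * w.2 + C₂ with he₂
  have hQcast : ((D.natAbs : ℕ) : ℝ) = |(D : ℝ)| := by rw [Nat.cast_natAbs, Int.cast_abs]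
  have hDc : (D : ℝ) = A₁ * B₂ - A₂ * B₁ := by rw [hDdef]; push_cast; ring
  have hB₁ : |(B₁ : ℝ)| * N ≤ (q₁ : ℝ) ^ t :=
    (mul_le_mul_of_nonneg_right (le_max_right _ _) hN.le).trans h₁
  have hB₂ : |(B₂ : ℝ)| * N ≤ (q₂ : ℝ) ^ t :=
    (mul_le_mul_of_nonneg_right (le_max_right _ _) hN.le).trans h₂
  obtain ⟨hlt, hX, hY⟩ := cramer_estimates hs hst ht (Nat.cast_pos.2 hq₁) (Nat.cast_pos.2 hq₂)
    (abs_nonneg (A₁ : ℝ)) (abs_nonneg (A₂ : ℝ)) (abs_nonneg (B₁ : ℝ)) (abs_nonneg (B₂ : ℝ))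
    (abs_nonneg e₁) (abs_nonneg e₂) hL₁.abs_fst_le hL₂.abs_fst_le hB₁ hB₂ hN hW h₁₂ h₂₁
    hE₁ hE₂ hδ₀ hδ₁ hδ hfst hsnd (abs_nonneg (D : ℝ))
    (by rw [hDc, ← abs_mul, ← abs_mul]; exact abs_sub _ _)
  have hsign : |((D.sign : ℤ) : ℝ)| = 1 := by
    have := Int.abs_sign_of_ne_zero hD0
    exact_mod_cast this
  have hDs : |(D : ℝ)| = (D.sign : ℝ) * D := by
    rw [← Int.cast_abs, ← Int.sign_mul_self_eq_abs]; push_cast; ring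
  refine ⟨D.sign * (B₁ * C₂ - B₂ * C₁), D.sign * (C₁ * A₂ - C₂ * A₁), D.natAbs,
    Int.natAbs_pos.2 hD0, by exact_mod_cast hQcast.trans_lt hlt, ?_, ?_⟩
  · rw [hQcast]
    refine lt_of_le_of_lt (mul_le_mul_of_nonneg_left ?_ (by positivity)) hX
    calc _ = |(D.sign : ℝ) * (e₁ * B₂ - e₂ * B₁)| := by
          rw [hDs, hDc, he₁, he₂]; push_cast; congr 1; ring
      _ ≤ _ := by
          rw [abs_mul, hsign, one_mul, ← abs_mul, ← abs_mul]; exact abs_sub _ _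
  · rw [hQcast]
    refine lt_of_le_of_lt (mul_le_mul_of_nonneg_left ?_ (by positivity)) hY
    calc _ = |(D.sign : ℝ) * (A₁ * e₂ - A₂ * e₁)| := by
          rw [hDs, hDc, he₁, he₂]; push_cast; congr 1; ring
      _ ≤ _ := by
          rw [abs_mul, hsign, one_mul, ← abs_mul, ← abs_mul]; exact abs_sub _ _

lemma sameLine_or_of_mem {p₁ r₁ p₂ r₂ : ℤ} {q₁ q₂ : ℕ} (hq₁ : 0 < q₁) {A₁ B₁ C₁ A₂ B₂ C₂ : ℤ}
    (h₁₁ : A₁ * p₁ + B₁ * r₁ + C₁ * q₁ = 0) (h₁₂ : A₁ * p₂ + B₁ * r₂ + C₁ * q₂ = 0)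
    (h₂₁ : A₂ * p₁ + B₂ * r₁ + C₂ * q₁ = 0) (h₂₂ : A₂ * p₂ + B₂ * r₂ + C₂ * q₂ = 0) :
    SameLine A₁ B₁ C₁ A₂ B₂ C₂ ∨ (p₁ * q₂ = p₂ * q₁ ∧ r₁ * q₂ = r₂ * q₁) := by
  by_cases hD : A₁ * B₂ = A₂ * B₁
  · left
    have hq : (q₁ : ℤ) ≠ 0 := by exact_mod_cast hq₁.ne'
    exact ⟨hD, mul_right_cancel₀ hq (by linear_combination A₁ * h₂₁ - A₂ * h₁₁ - r₁ * hD),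
      mul_right_cancel₀ hq (by linear_combination B₁ * h₂₁ - B₂ * h₁₁ + p₁ * hD)⟩
  · right
    have hD' : A₁ * B₂ - A₂ * B₁ ≠ 0 := sub_ne_zero.2 hD
    refine ⟨mul_left_cancel₀ hD' ?_, mul_left_cancel₀ hD' ?_⟩
    · linear_combination B₂ * (q₂ * h₁₁ - q₁ * h₁₂) - B₁ * (q₂ * h₂₁ - q₁ * h₂₂)
    · linear_combination A₁ * (q₂ * h₂₁ - q₁ * h₂₂) - A₂ * (q₂ * h₁₁ - q₁ * h₁₂)

lemma IsNear.of_proportional {s t c : ℝ} (hs : 0 ≤ s) (ht : 0 ≤ t) {p₁ r₁ p₂ r₂ : ℤ} {q₁ q₂ : ℕ}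
    (hp : p₁ * q₂ = p₂ * q₁) (hr : r₁ * q₂ = r₂ * q₁) (hq₁ : 0 < q₁) (hq : q₁ ≤ q₂) {w : ℝ × ℝ}
    (h : IsNear s t c p₂ r₂ q₂ w) : IsNear s t c p₁ r₁ q₁ w := by
  have hq' : (q₁ : ℝ) ≤ q₂ := by exact_mod_cast hq
  have hq₁' : (0 : ℝ) < q₁ := by exact_mod_cast hq₁
  have key : ∀ (u x : ℝ) (a₁ a₂ : ℤ), 0 ≤ u → a₁ * q₂ = a₂ * q₁ →
      (q₁ : ℝ) ^ u * |q₁ * x - a₁| ≤ (q₂ : ℝ) ^ u * |q₂ * x - a₂| := by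
    intro u x a₁ a₂ hu ha
    have ha' : (a₁ * q₂ : ℝ) = a₂ * q₁ := by exact_mod_cast ha
    have h0 : |q₁ * x - a₁| ≤ |q₂ * x - a₂| := by
      refine le_of_mul_le_mul_left (a := (q₂ : ℝ)) ?_ (hq₁'.trans_le hq')
      calc q₂ * |q₁ * x - a₁| = |(q₂ : ℝ)| * |q₁ * x - a₁| := by rw [Nat.abs_cast]
        _ = |(q₁ : ℝ)| * |q₂ * x - a₂| := by
            rw [← abs_mul, ← abs_mul]; congr 1; linear_combination -ha'
        _ ≤ q₂ * |q₂ * x - a₂| := by rw [Nat.abs_cast]; gcongr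
    exact mul_le_mul (Real.rpow_le_rpow hq₁'.le hq' hu) h0 (abs_nonneg _) (by positivity)
  exact ⟨(key _ _ _ _ hs hp).trans_lt h.1, (key _ _ _ _ ht hr).trans_lt h.2⟩

/-- `p / q` is the rational point of least denominator that is close to `w`. -/
structure IsFirstNear (s t c : ℝ) (p r : ℤ) (q : ℕ) (w : ℝ × ℝ) : Prop where
  pos : 0 < q
  isNear : IsNear s t c p r q w
  not_isNear : ∀ p' r' q', 0 < q' → q' < q → ¬ IsNear s t c p' r' q' w

/-- Localisation, between consecutive powers of `R`, of `q * max |A| |B|` and of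
`q ^ t / max |A| |B|`. -/
structure InScale (t R b : ℝ) (q : ℕ) (A B : ℤ) (n j : ℕ) : Prop where
  le_mul : b * R ^ n ≤ q * max |(A : ℝ)| |(B : ℝ)|
  mul_lt : q * max |(A : ℝ)| |(B : ℝ)| < b * R ^ (n + 1)
  le_rpow : max |(A : ℝ)| |(B : ℝ)| * R ^ (4 * j) ≤ (q : ℝ) ^ t
  rpow_lt : (q : ℝ) ^ t < max |(A : ℝ)| |(B : ℝ)| * R ^ (4 * j + 4)

lemma one_le_max_abs {A B : ℤ} (h : A ≠ 0 ∨ B ≠ 0) : 1 ≤ max |(A : ℝ)| |(B : ℝ)| := by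
  rcases h with h | h
  · exact le_max_of_le_left (by exact_mod_cast Int.one_le_abs h)
  · exact le_max_of_le_right (by exact_mod_cast Int.one_le_abs h)

lemma InScale.le_pow_mul {t R b : ℝ} (ht : 0 ≤ t) (hR : 1 < R) (hb : 0 < b) {n j : ℕ}
    {q₁ q₂ : ℕ} (hq₁ : 0 < q₁) (hq₂ : 0 < q₂) {A₁ B₁ A₂ B₂ : ℤ} (h₁ : InScale t R b q₁ A₁ B₁ n j)
    (h₂ : InScale t R b q₂ A₂ B₂ n j) : (q₁ : ℝ) ≤ R ^ 5 * q₂ := by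
  have hR0 : 0 < R := by linarith
  have hq₁' : (0 : ℝ) < q₁ := by exact_mod_cast hq₁
  have hq₂' : (0 : ℝ) < q₂ := by exact_mod_cast hq₂
  obtain ⟨-, h₁₂, -, h₁₄⟩ := h₁
  obtain ⟨h₂₁, -, h₂₃, -⟩ := h₂
  set m₁ := max |(A₁ : ℝ)| |(B₁ : ℝ)|
  set m₂ := max |(A₂ : ℝ)| |(B₂ : ℝ)|
  have hm₁ : 0 < m₁ := by
    have : 0 < m₁ * R ^ (4 * j + 4) := (Real.rpow_pos_of_pos hq₁' t).trans h₁₄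
    exact pos_of_mul_pos_left this (by positivity)
  have hm₂ : 0 < m₂ := by
    have : 0 < q₂ * m₂ := lt_of_lt_of_le (by positivity) h₂₁
    exact pos_of_mul_pos_right this hq₂'.le
  by_contra! hlt
  have hle : (q₂ : ℝ) ≤ q₁ := by
    refine le_trans ?_ hlt.le
    exact le_mul_of_one_le_left hq₂'.le (one_le_pow₀ hR.le)
  have hle' : (q₂ : ℝ) ^ t ≤ (q₁ : ℝ) ^ t := Real.rpow_le_rpow hq₂'.le hle ht
  have hup : q₁ * (q₁ : ℝ) ^ t < b * R ^ (n + 1) * R ^ (4 * j + 4) := by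
    calc q₁ * (q₁ : ℝ) ^ t < q₁ * (m₁ * R ^ (4 * j + 4)) := by gcongr
      _ = q₁ * m₁ * R ^ (4 * j + 4) := by ring
      _ ≤ _ := by gcongr
  have hlow : b * R ^ n * R ^ (4 * j) ≤ q₂ * (q₂ : ℝ) ^ t := by
    calc b * R ^ n * R ^ (4 * j) ≤ q₂ * m₂ * R ^ (4 * j) := by gcongr
      _ = q₂ * (m₂ * R ^ (4 * j)) := by ring
      _ ≤ _ := by gcongr
  have : R ^ 5 * (q₂ * (q₂ : ℝ) ^ t) ≤ q₁ * (q₁ : ℝ) ^ t := by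
    calc R ^ 5 * (q₂ * (q₂ : ℝ) ^ t) = R ^ 5 * q₂ * (q₂ : ℝ) ^ t := by ring
      _ ≤ _ := by gcongr
  have h5 : R ^ 5 * (b * R ^ n * R ^ (4 * j)) = b * R ^ (n + 1) * R ^ (4 * j + 4) := by ring
  have h6 := mul_le_mul_of_nonneg_left hlow (by positivity : 0 ≤ R ^ 5)
  linarith

/-- Two attached lines with large denominators relative to their heights coincide if they pass
close to a point whose first close rational point has one of these denominators. -/
lemma sameLine_of_isFirstNear {s t c G W X : ℝ} (hs : 0 ≤ s) (hst : s + t = 1) (ht : 1 / 2 ≤ t)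
    (hc : 0 < c) (hc1 : c ≤ 1) (hW : 1 ≤ W) (hG : 2 ≤ G) (hX : 4 * W ^ 2 * G < X)
    {w : ℝ × ℝ} {p₁ r₁ p₂ r₂ : ℤ} {q₁ q₂ : ℕ} {A₁ B₁ C₁ A₂ B₂ C₂ : ℤ}
    (hL₁ : IsAttachedLine s t p₁ r₁ q₁ A₁ B₁ C₁) (hL₂ : IsAttachedLine s t p₂ r₂ q₂ A₂ B₂ C₂)
    (hq₂ : 0 < q₂) (hF : IsFirstNear s t c p₁ r₁ q₁ w)
    (h₁₂ : (q₁ : ℝ) ≤ W * q₂) (h₂₁ : (q₂ : ℝ) ≤ W * q₁)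
    (h₁ : max |(A₁ : ℝ)| |(B₁ : ℝ)| * X ^ 4 ≤ (q₁ : ℝ) ^ t)
    (h₂ : max |(A₂ : ℝ)| |(B₂ : ℝ)| * X ^ 4 ≤ (q₂ : ℝ) ^ t)
    (hE₁ : q₁ * |A₁ * w.1 + B₁ * w.2 + C₁| ≤ c * G * X)
    (hE₂ : q₂ * |A₂ * w.1 + B₂ * w.2 + C₂| ≤ c * G * X) : SameLine A₁ B₁ C₁ A₂ B₂ C₂ := by
  have hWW : W ≤ W ^ 2 := le_self_pow₀ hW two_ne_zero
  have hWG : 2 * W * G < X := by nlinarith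
  have hWX : 2 * W < X := by nlinarith
  have hX1 : 1 ≤ X := by linarith
  have hX0 : 0 < X := by linarith
  have hfst : 2 * W * (c * G * X) < c * X ^ 4 := by
    calc 2 * W * (c * G * X) = c * (2 * W * G) * X := by ring
      _ < c * X * X := by gcongr
      _ ≤ c * X * X * X ^ 2 := le_mul_of_one_le_right (by positivity) (one_le_pow₀ hX1)
      _ = c * X ^ 4 := by ring
  have hrpow : ∀ q : ℕ, 0 < q → (q : ℝ) ^ t ≤ q := fun q hq =>
    (Real.rpow_le_rpow_of_exponent_le (by exact_mod_cast hq) (by linarith)).trans_eq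
      (Real.rpow_one _)
  by_cases hD : A₁ * B₂ = A₂ * B₁
  · exact sameLine_of_parallel (by positivity) (by positivity) h₁₂ h₂₁ (h₁.trans (hrpow _ hF.pos)) (h₂.trans (hrpow _ hq₂)) hE₁ hE₂
      (hfst.trans_le (mul_le_of_le_one_left (by positivity) hc1)) hD
  · have hδ₁ : 2 * W / X ^ 2 < 1 := by
      rw [div_lt_one (by positivity)]
      nlinarith
    have hδ : 2 * W ≤ X ^ 4 * (2 * W / X ^ 2) ^ 2 := by
      have : X ^ 4 * (2 * W / X ^ 2) ^ 2 = 4 * W ^ 2 := by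
        field_simp
        norm_num
      linarith
    have hsnd : 2 * (2 * W / X ^ 2) * W * (c * G * X) < c := by
      have : 2 * (2 * W / X ^ 2) * W * (c * G * X) = c * (4 * W ^ 2 * G) / X := by
        field_simp
        norm_num
      rw [this, div_lt_iff₀ hX0]
      gcongr
    obtain ⟨p, r, q, hq, hlt, hnear⟩ := exists_isNear_of_transverse hs hst ht hF.pos hq₂ hL₁ hL₂
      (by positivity) hW h₁₂ h₂₁ h₁ h₂ hE₁ hE₂ (by positivity) hδ₁ hδ hfst hsnd hD
    exact (hF.not_isNear _ _ _ hq hlt hnear).elim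

/-- Two rational points of the same scale, both first close to points of a common small ball,
have the same attached line or coincide. -/
lemma sameLine_or_eq {s t c b R G ρ : ℝ} {I : ℕ} (hs : 0 ≤ s) (hst : s + t = 1)
    (ht : 1 / 2 ≤ t) (hc : 0 < c) (hb : 0 < b) (hR : 1 < R) (hG : 2 ≤ G) (hρ : 0 < ρ)
    (hI : 4 * (R ^ 5) ^ 2 * G < R ^ I) (hcG : R ^ 5 * (2 * c + c * G * R ^ I) < 1)
    (hbG : 2 * c + 4 * ρ * b * R ^ 41 ≤ c * G) {m j : ℕ} {z w₁ w₂ : ℝ × ℝ}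
    (hw₁ : w₁ ∈ closedBall z (ρ / R ^ m)) (hw₂ : w₂ ∈ closedBall z (ρ / R ^ m))
    {p₁ r₁ p₂ r₂ : ℤ} {q₁ q₂ : ℕ} {A₁ B₁ C₁ A₂ B₂ C₂ : ℤ}
    (hL₁ : IsAttachedLine s t p₁ r₁ q₁ A₁ B₁ C₁) (hL₂ : IsAttachedLine s t p₂ r₂ q₂ A₂ B₂ C₂)
    (hS₁ : InScale t R b q₁ A₁ B₁ (m + 40 + j) j) (hS₂ : InScale t R b q₂ A₂ B₂ (m + 40 + j) j)
    (hF₁ : IsFirstNear s t c p₁ r₁ q₁ w₁) (hF₂ : IsFirstNear s t c p₂ r₂ q₂ w₂) :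
    SameLine A₁ B₁ C₁ A₂ B₂ C₂ ∨ (p₁ = p₂ ∧ r₁ = r₂ ∧ q₁ = q₂) := by
  have hR0 : 0 < R := by linarith
  have hW : 1 ≤ R ^ 5 := one_le_pow₀ hR.le
  have ht0 : 0 ≤ t := by linarith
  have hq₁ : (0 : ℝ) < q₁ := by exact_mod_cast hF₁.pos
  have hq₂ : (0 : ℝ) < q₂ := by exact_mod_cast hF₂.pos
  have h₁₂ := hS₁.le_pow_mul ht0 hR hb hF₁.pos hF₂.pos hS₂
  have h₂₁ := hS₂.le_pow_mul ht0 hR hb hF₂.pos hF₁.pos hS₁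
  have hRj : 1 ≤ R ^ j := one_le_pow₀ hR.le
  rw [mem_closedBall_prod_iff, abs_le, abs_le] at hw₁ hw₂
  have hd₁ : |w₁.1 - w₂.1| ≤ 2 * (ρ / R ^ m) := by
    rw [abs_le]; constructor <;> linarith [hw₁.1.1, hw₁.1.2, hw₂.1.1, hw₂.1.2]
  have hd₂ : |w₁.2 - w₂.2| ≤ 2 * (ρ / R ^ m) := by
    rw [abs_le]; constructor <;> linarith [hw₁.2.1, hw₁.2.2, hw₂.2.1, hw₂.2.2]
  have hbound : ∀ (q : ℕ) (A B : ℤ), InScale t R b q A B (m + 40 + j) j →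
      2 * c + 2 * (2 * (ρ / R ^ m)) * (q * max |(A : ℝ)| |(B : ℝ)|) ≤ c * G * R ^ j := by
    intro q A B hS
    calc 2 * c + 2 * (2 * (ρ / R ^ m)) * (q * max |(A : ℝ)| |(B : ℝ)|)
        ≤ 2 * c * R ^ j + 2 * (2 * (ρ / R ^ m)) * (b * R ^ (m + 40 + j + 1)) := by
          refine add_le_add (le_mul_of_one_le_right (by positivity) hRj) ?_
          exact mul_le_mul_of_nonneg_left hS.mul_lt.le (by positivity)
      _ = (2 * c + 4 * ρ * b * R ^ 41) * R ^ j := by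
          field_simp
          ring
      _ ≤ _ := by gcongr
  have hloc : ∀ {p r : ℤ} {q : ℕ} {A B C : ℤ} {w v : ℝ × ℝ}, IsAttachedLine s t p r q A B C →
      InScale t R b q A B (m + 40 + j) j → IsNear s t c p r q w →
      |v.1 - w.1| ≤ 2 * (ρ / R ^ m) → |v.2 - w.2| ≤ 2 * (ρ / R ^ m) →
      q * |A * v.1 + B * v.2 + C| ≤ c * G * R ^ j := fun hL hS hw h h' =>
    (hL.mul_abs_eval_le_of_close hw h h').trans (hbound _ _ _ hS)
  have hself : ∀ x : ℝ, |x - x| ≤ 2 * (ρ / R ^ m) := fun x => by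
    rw [sub_self, abs_zero]; positivity
  rcases le_total j I with hj | hj
  · have hsmall : R ^ 5 * (2 * c + c * G * R ^ j) < 1 := by
      refine lt_of_le_of_lt ?_ hcG
      gcongr
      exact hR.le
    have hm₁₂ := hL₁.mem_of_close hs ht0 hst hF₂.isNear hW h₁₂ h₂₁
      (hloc hL₁ hS₁ hF₁.isNear (by rwa [abs_sub_comm]) (by rwa [abs_sub_comm])) hsmall
    have hm₂₁ := hL₂.mem_of_close hs ht0 hst hF₁.isNear hW h₂₁ h₁₂
      (hloc hL₂ hS₂ hF₂.isNear hd₁ hd₂) hsmall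
    refine (sameLine_or_of_mem hF₁.pos hL₁.mem hm₁₂ hm₂₁ hL₂.mem).imp_right ?_
    rintro ⟨hp, hr⟩
    rcases lt_trichotomy q₁ q₂ with h | h | h
    · exact (hF₂.not_isNear _ _ _ hF₁.pos h
        (IsNear.of_proportional hs ht0 hp hr hF₁.pos h.le hF₂.isNear)).elim
    · subst h
      have hq : (q₁ : ℤ) ≠ 0 := by exact_mod_cast hF₁.pos.ne'
      exact ⟨mul_right_cancel₀ hq hp, mul_right_cancel₀ hq hr, rfl⟩
    · exact (hF₁.not_isNear _ _ _ hF₂.pos h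
        (IsNear.of_proportional hs ht0 hp.symm hr.symm hF₂.pos h.le hF₁.isNear)).elim
  · left
    have hRI : R ^ I ≤ R ^ j := pow_le_pow_right₀ hR.le hj
    have hc1 : c ≤ 1 := by
      have : 0 ≤ R ^ 5 * (c * G * R ^ I) := by positivity
      nlinarith
    have hX : R ^ (4 * j) = (R ^ j) ^ 4 := by rw [mul_comm, pow_mul]
    exact sameLine_of_isFirstNear hs hst ht hc hc1 hW hG (hI.trans_le hRI) hL₁ hL₂ hF₂.pos hF₁
      h₁₂ h₂₁ (hX ▸ hS₁.le_rpow) (hX ▸ hS₂.le_rpow)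
      (hloc hL₁ hS₁ hF₁.isNear (hself w₁.1) (hself w₁.2)) (hloc hL₂ hS₂ hF₂.isNear hd₁ hd₂)

lemma exists_inScale {s t b R : ℝ} (hst : s + t = 1) (hle : s ≤ t) (hs : 0 ≤ s) (hb : 0 < b)
    (hR : 1 < R) (hbR : b * R ^ 81 ≤ 1) {p r : ℤ} {q : ℕ} (hq : 0 < q) {A B C : ℤ}
    (hL : IsAttachedLine s t p r q A B C) : ∃ m j, InScale t R b q A B (m + 40 + j) j := by
  have hR0 : 0 < R := by linarith
  have hq1 : (1 : ℝ) ≤ q := by exact_mod_cast hq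
  have hm := one_le_max_abs hL.ne_zero
  have hm' : max |(A : ℝ)| |(B : ℝ)| ≤ (q : ℝ) ^ t := max_le
    (hL.abs_fst_le.trans (Real.rpow_le_rpow_of_exponent_le hq1 hle)) hL.abs_snd_le
  have hqt : (q : ℝ) ^ t ≤ q :=
    (Real.rpow_le_rpow_of_exponent_le hq1 (by linarith)).trans_eq (Real.rpow_one _)
  obtain ⟨n, hn, hn'⟩ := exists_nat_pow_near (x := q * max |(A : ℝ)| |(B : ℝ)| / b) (by
    rw [le_div_iff₀ hb, one_mul]
    have : b ≤ b * R ^ 81 := le_mul_of_one_le_right hb.le (one_le_pow₀ hR.le)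
    nlinarith) hR
  obtain ⟨j, hj, hj'⟩ := exists_nat_pow_near (x := (q : ℝ) ^ t / max |(A : ℝ)| |(B : ℝ)|)
    (by rwa [one_le_div (by linarith)]) (one_lt_pow₀ hR four_ne_zero)
  rw [le_div_iff₀ hb, mul_comm] at hn
  rw [div_lt_iff₀ hb, mul_comm _ b] at hn'
  rw [le_div_iff₀ (by linarith), mul_comm, ← pow_mul] at hj
  rw [div_lt_iff₀ (by linarith), mul_comm, ← pow_mul, mul_add, mul_one] at hj'
  have hlt : R ^ (4 * j + 81) < R ^ (n + 1) := by
    have h1 : R ^ (4 * j) ≤ q * max |(A : ℝ)| |(B : ℝ)| := by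
      have : R ^ (4 * j) ≤ max |(A : ℝ)| |(B : ℝ)| * R ^ (4 * j) :=
        le_mul_of_one_le_left (by positivity) hm
      nlinarith
    calc R ^ (4 * j + 81) = R ^ (4 * j) * R ^ 81 := pow_add _ _ _
      _ < b * R ^ (n + 1) * R ^ 81 := by gcongr; exact h1.trans_lt hn'
      _ = b * R ^ 81 * R ^ (n + 1) := by ring
      _ ≤ R ^ (n + 1) := mul_le_of_le_one_left (by positivity) hbR
  have hnj := (pow_lt_pow_iff_right₀ hR).1 hlt
  obtain ⟨m, rfl⟩ : ∃ m, n = m + 40 + j := ⟨n - 40 - j, by omega⟩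
  exact ⟨m, j, hn, hn', hj, hj'⟩

lemma SameLine.mem_lineNhd {A₁ B₁ C₁ A₂ B₂ C₂ : ℤ} (h : SameLine A₁ B₁ C₁ A₂ B₂ C₂)
    (h₁ : A₁ ≠ 0 ∨ B₁ ≠ 0) (h₂ : A₂ ≠ 0 ∨ B₂ ≠ 0) {τ : ℝ} {w : ℝ × ℝ}
    (hw : w ∈ lineNhd ((A₁, B₁), C₁) τ) : w ∈ lineNhd ((A₂, B₂), C₂) τ := by
  have hpos : ∀ {A B : ℤ}, A ≠ 0 ∨ B ≠ 0 → 0 < |(A : ℝ)| + |(B : ℝ)| := by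
    rintro A B (h | h)
    · exact add_pos_of_pos_of_nonneg (abs_pos.2 (by exact_mod_cast h)) (abs_nonneg _)
    · exact add_pos_of_nonneg_of_pos (abs_nonneg _) (abs_pos.2 (by exact_mod_cast h))
  obtain ⟨hAB, hAC, hBC⟩ := h
  have hAB' : (A₁ * B₂ : ℝ) = A₂ * B₁ := by exact_mod_cast hAB
  have hAC' : (A₁ * C₂ : ℝ) = A₂ * C₁ := by exact_mod_cast hAC
  have hBC' : (B₁ * C₂ : ℝ) = B₂ * C₁ := by exact_mod_cast hBC
  have hw' : |A₁ * w.1 + B₁ * w.2 + C₁| < τ * (|(A₁ : ℝ)| + |(B₁ : ℝ)|) := hw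
  change |A₂ * w.1 + B₂ * w.2 + C₂| < τ * (|(A₂ : ℝ)| + |(B₂ : ℝ)|)
  refine lt_of_mul_lt_mul_left (a := |(A₁ : ℝ)| + |(B₁ : ℝ)|) ?_ (hpos h₁).le
  calc (|(A₁ : ℝ)| + |(B₁ : ℝ)|) * |A₂ * w.1 + B₂ * w.2 + C₂|
      = (|(A₂ : ℝ)| + |(B₂ : ℝ)|) * |A₁ * w.1 + B₁ * w.2 + C₁| := by
        rw [add_mul, add_mul, ← abs_mul, ← abs_mul, ← abs_mul, ← abs_mul]
        congr 2
        · linear_combination w.2 * hAB' + hAC'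
        · linear_combination -w.1 * hAB' + hBC'
    _ < (|(A₂ : ℝ)| + |(B₂ : ℝ)|) * (τ * (|(A₁ : ℝ)| + |(B₁ : ℝ)|)) :=
        mul_lt_mul_of_pos_left hw' (hpos h₂)
    _ = _ := by ring

/-- A pair with no close rational points is badly approximable. -/
lemma mem_badPair_of_not_isNear {s t c : ℝ} (hc : 0 < c) {x : ℝ × ℝ}
    (h : ∀ (p r : ℤ) (q : ℕ), 0 < q → ¬ IsNear s t c p r q x) : x ∈ badPair s t := by
  refine hc.trans_le (le_ciInf fun q => ?_)
  by_contra! hlt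
  exact h (round (q * x.1)) (round (q * x.2)) q q.pos
    ⟨(le_max_left _ _).trans_lt hlt, (le_max_right _ _).trans_lt hlt⟩

lemma mem_badPair_swap {s t : ℝ} {x : ℝ × ℝ} : x.swap ∈ badPair t s ↔ x ∈ badPair s t := by
  simp only [badPair, Set.mem_ofPred_eq, Prod.fst_swap, Prod.snd_swap]
  simp_rw [max_comm]

/-- The family of lines to be avoided when `s ≤ t`. -/
lemma exists_lines_of_le {s t κ R ρ : ℝ} (hs : 0 ≤ s) (hst : s + t = 1) (hle : s ≤ t)
    (hκ : 0 < κ) (hR : 1 < R) (hρ : 0 < ρ) :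
    ∃ F : ℕ → ℝ × ℝ → ℕ → (ℝ × ℝ) × ℝ, ∀ (z : ℕ → ℝ × ℝ) (x : ℝ × ℝ),
      (∀ m, x ∈ closedBall (z m) (ρ / R ^ m)) →
      (∀ m j, x ∉ lineNhd (F m (z m) j) (κ * (ρ / R ^ (m + 40 + j)))) → x ∈ badPair s t := by
  classical
  have hR0 : 0 < R := by linarith
  have ht : 1 / 2 ≤ t := by linarith
  set G : ℝ := 2 + 16 * R ^ 41 / κ with hG
  have hG2 : 2 ≤ G := by rw [hG]; linarith [(by positivity : 0 ≤ 16 * R ^ 41 / κ)]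
  obtain ⟨I, hI⟩ := pow_unbounded_of_one_lt (4 * (R ^ 5) ^ 2 * G) hR
  set M : ℝ := 2 * R ^ 5 * (2 + G * R ^ I) with hM
  have hM0 : 0 < M := by positivity
  obtain ⟨c, hc, hcM, hcR⟩ : ∃ c : ℝ, 0 < c ∧ c * M ≤ 1 ∧ 4 * c / (κ * ρ) * R ^ 81 ≤ 1 := by
    refine ⟨min (1 / M) (κ * ρ / (4 * R ^ 81)), by positivity, ?_, ?_⟩
    · exact (le_div_iff₀ hM0).1 (min_le_left _ _)
    · have := (le_div_iff₀ (by positivity)).1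
        (min_le_right (1 / M) (κ * ρ / (4 * R ^ 81)))
      rw [div_mul_eq_mul_div, div_le_one (by positivity)]
      linarith
  set b : ℝ := 4 * c / (κ * ρ) with hb
  have hb0 : 0 < b := by positivity
  have hcG : R ^ 5 * (2 * c + c * G * R ^ I) < 1 := by
    have h1 : R ^ 5 * (2 * c + c * G * R ^ I) = c * M / 2 := by rw [hM]; ring
    rw [h1]; linarith
  have hbG : 2 * c + 4 * ρ * b * R ^ 41 ≤ c * G := by
    refine le_of_eq ?_
    rw [hb, hG]; field_simp; ring
  choose A B C hL using fun (P : ℤ × ℤ × {q : ℕ // 0 < q}) =>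
    exists_isAttachedLine hst P.1 P.2.1 P.2.2.2
  let Q (m : ℕ) (z : ℝ × ℝ) (j : ℕ) (P : ℤ × ℤ × {q : ℕ // 0 < q}) : Prop :=
    InScale t R b P.2.2 (A P) (B P) (m + 40 + j) j ∧
      ∃ w ∈ closedBall z (ρ / R ^ m), IsFirstNear s t c P.1 P.2.1 P.2.2 w
  let F (m : ℕ) (z : ℝ × ℝ) (j : ℕ) : (ℝ × ℝ) × ℝ :=
    if h : ∃ P, Q m z j P then ((A h.choose, B h.choose), C h.choose) else 0
  refine ⟨F, fun z x hx hF => mem_badPair_of_not_isNear hc fun p₀ r₀ q₀ hq₀ hnear₀ => ?_⟩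
  have hex : ∃ q : ℕ, 0 < q ∧ ∃ p r, IsNear s t c p r q x := ⟨q₀, hq₀, p₀, r₀, hnear₀⟩
  obtain ⟨hq, p, r, hnear⟩ := Nat.find_spec hex
  set q := Nat.find hex with hqdef
  have hfirst : IsFirstNear s t c p r q x := ⟨hq, hnear, fun p' r' q' hq' hlt h =>
    Nat.find_min hex hlt ⟨hq', p', r', h⟩⟩
  set P : ℤ × ℤ × {q : ℕ // 0 < q} := (p, r, ⟨q, hq⟩) with hP
  obtain ⟨m, j, hS⟩ := exists_inScale hst hle hs hb0 hR hcR hq (hL P)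
  have hQ : ∃ P, Q m (z m) j P := ⟨P, hS, x, hx m, hfirst⟩
  have hxP : x ∈ lineNhd ((A P, B P), C P) (κ * (ρ / R ^ (m + 40 + j))) := by
    have hq' : (0 : ℝ) < q := by exact_mod_cast hq
    have h1 := (hL P).mul_abs_eval_le hnear
    refine lt_of_mul_lt_mul_left (a := (q : ℝ)) ?_ hq'.le
    calc (q : ℝ) * |A P * x.1 + B P * x.2 + C P| ≤ 2 * c := h1
      _ < 4 * c := by linarith
      _ = κ * (ρ / R ^ (m + 40 + j)) * (b * R ^ (m + 40 + j)) := by rw [hb]; field_simp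
      _ ≤ κ * (ρ / R ^ (m + 40 + j)) * (q * max |(A P : ℝ)| |(B P : ℝ)|) :=
          mul_le_mul_of_nonneg_left hS.le_mul (by positivity)
      _ ≤ κ * (ρ / R ^ (m + 40 + j)) * (q * (|(A P : ℝ)| + |(B P : ℝ)|)) := by
          gcongr
          exact max_le_add_of_nonneg (abs_nonneg _) (abs_nonneg _)
      _ = q * (κ * (ρ / R ^ (m + 40 + j)) * (|(A P : ℝ)| + |(B P : ℝ)|)) := by ring
  refine hF m j ?_
  obtain ⟨hS', w, hw, hfirst'⟩ := hQ.choose_spec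
  simp only [F, dif_pos hQ]
  generalize hQ.choose = P' at *
  rcases sameLine_or_eq hs hst ht hc hb0 hR hG2 hρ hI hcG hbG (hx m) hw (hL P) (hL P') hS hS'
    hfirst hfirst' with h | ⟨h₁, h₂, h₃⟩
  · exact h.mem_lineNhd (hL P).ne_zero (hL P').ne_zero hxP
  · have : P = P' := Prod.ext h₁ (Prod.ext h₂ (Subtype.ext h₃))
    rwa [← this]

lemma swap_mem_lineNhd {f : (ℝ × ℝ) × ℝ} {τ : ℝ} {w : ℝ × ℝ} :
    w.swap ∈ lineNhd f τ ↔ w ∈ lineNhd (f.1.swap, f.2) τ := by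
  simp only [lineNhd, Set.mem_ofPred_eq, Prod.fst_swap, Prod.snd_swap]
  rw [add_comm (f.1.1 * w.2), add_comm |f.1.1|]

lemma exists_lines {s t κ R ρ : ℝ} (hs : 0 ≤ s) (ht : 0 ≤ t) (hst : s + t = 1)
    (hκ : 0 < κ) (hR : 1 < R) (hρ : 0 < ρ) :
    ∃ F : ℕ → ℝ × ℝ → ℕ → (ℝ × ℝ) × ℝ, ∀ (z : ℕ → ℝ × ℝ) (x : ℝ × ℝ),
      (∀ m, x ∈ closedBall (z m) (ρ / R ^ m)) →
      (∀ m j, x ∉ lineNhd (F m (z m) j) (κ * (ρ / R ^ (m + 40 + j)))) → x ∈ badPair s t := by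
  rcases le_total s t with hle | hle
  · exact exists_lines_of_le hs hst hle hκ hR hρ
  · obtain ⟨F, hF⟩ := exists_lines_of_le ht (by linarith) hle hκ hR hρ
    refine ⟨fun m z j => ((F m z.swap j).1.swap, (F m z.swap j).2), fun z x hx hxF =>
      mem_badPair_swap.1 (hF (fun m => (z m).swap) x.swap (fun m => ?_) fun m j h =>
        hxF m j (swap_mem_lineNhd.1 h))⟩
    have := hx m
    rw [mem_closedBall_prod_iff] at this ⊢
    exact this.symm

/-- **Bad(s,t) is `α`-winning for Schmidt's game for every `0 < α < 1/2`**: for all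
`s, t ≥ 0` with `s + t = 1`, every `0 < α < 1/2` and every `0 < β < 1`, Alice has a winning
strategy for Schmidt's `(α,β)`-game on ℝ² with target set `Bad(s,t)`. -/
theorem badPair_schmidt_winning (s t : ℝ) (hs : 0 ≤ s) (ht : 0 ≤ t) (hst : s + t = 1)
    (α : ℝ) (hα0 : 0 < α) (hα : α < 1 / 2) (β : ℝ) (hβ0 : 0 < β) (hβ1 : β < 1) :
    SchmidtWinning α β (badPair s t) := by
  have hβα : 0 < β * α := mul_pos hβ0 hα0
  have hR : 1 < (β * α)⁻¹ := (one_lt_inv₀ hβα).2 (by nlinarith)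
  choose! F hF using fun ρ (hρ : 0 < ρ) =>
    exists_lines hs ht hst (κ := 1 - 2 * α) (by linarith) hR hρ
  refine schmidtWinning_of_lineNhd hα0 hα hβ0 hβ1 F fun ρ hρ z x hx hxF =>
    hF ρ hρ z x (fun m => ?_) fun m j => ?_
  · simpa only [inv_pow, div_inv_eq_mul] using hx m
  · simpa only [inv_pow, div_inv_eq_mul] using hxF m j
end
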